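/- Let h be a polynomial of degree N or N−1, either even or odd, with distinct real roots. Then there is a unique h-compatible Richardson variety X_{λ/μ}, and the number of even-odd points in X_{λ/μ}(h) := X_{λ/μ} ∩ Wr^{−1}(h) equals the number of standard 2-ribbon (domino) tableaux of shape λ/μ. -/

import Mathlib

open Polynomial

noncomputable section

/-! ### The Grassmannian `X = Gr(d, ℂ_{n-1}[z])` and the Wronski map -/

/-- The Wronskian determinant of a `d`-tuple of polynomials. -/
def wronskDet (d : ℕ) (f : Fin d → Polynomial ℂ) : Polynomial ℂ :=
  Matrix.det (Matrix.of fun i j : Fin d =>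
    (fun p : Polynomial ℂ => Polynomial.derivative p)^[(j : ℕ)] (f i))

/-- `x` is a point of the Grassmannian `Gr(d, ℂ_{n-1}[z])`. -/
def IsGrPoint (n d : ℕ) (x : Submodule ℂ (Polynomial ℂ)) : Prop :=
  x ≤ Polynomial.degreeLT ℂ n ∧ Module.finrank ℂ x = d

/-- `x` lies in the fibre of the Wronski map over `h` (an element of the
projective space `ℙ(ℂ_N[z])`, i.e. the Wronskian of a basis of `x` is a nonzero
scalar multiple of `h`). -/
def InFibre (d : ℕ) (x : Submodule ℂ (Polynomial ℂ)) (h : Polynomial ℂ) : Prop :=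
  ∃ (f : Fin d → Polynomial ℂ) (c : ℂ), c ≠ 0 ∧ LinearIndependent ℂ f ∧
    Submodule.span ℂ (Set.range f) = x ∧ wronskDet d f = c • h

/-- The linear substitution `f(z) ↦ f(c·z)` on polynomials. -/
def rotMap (c : ℂ) : Polynomial ℂ →ₗ[ℂ] Polynomial ℂ :=
  (Polynomial.aeval (Polynomial.C c * Polynomial.X) :
    Polynomial ℂ →ₐ[ℂ] Polynomial ℂ).toLinearMap

/-- `x` is fixed by the cyclic group `C_r ⊂ PGL₂(ℂ)` of classes of
`diag(e^{πij/r}, e^{-πij/r})`, `j = 0, …, r-1`; the induced (projective) action on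
`Gr(d, ℂ_{n-1}[z])` is via the substitutions `z ↦ e^{-2πij/r} z`. -/
def CrFixed (r : ℕ) (x : Submodule ℂ (Polynomial ℂ)) : Prop :=
  ∀ j : Fin r,
    Submodule.map
      (rotMap (Complex.exp (-(2 * (Real.pi : ℂ) * Complex.I * ((j : ℕ) : ℂ)) / (r : ℂ)))) x = x

/-- The linear map `f(z) ↦ z^{n-1} f(1/z)` on `ℂ_{n-1}[z]`,
realizing the reflection `(0 1; 1 0) ∈ PGL₂(ℂ)`. -/
def reflectMap (n : ℕ) : Polynomial ℂ →ₗ[ℂ] Polynomial ℂ :=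
  ∑ k ∈ Finset.range n,
    (Polynomial.lcoeff ℂ k).smulRight ((Polynomial.X : Polynomial ℂ) ^ (n - 1 - k))

/-- `x` is fixed by the dihedral group `D_r ⊂ PGL₂(ℂ)` generated by `C_r` and the
reflection `z ↦ 1/z`. -/
def DrFixed (n r : ℕ) (x : Submodule ℂ (Polynomial ℂ)) : Prop :=
  CrFixed r x ∧ Submodule.map (reflectMap n) x = x

/-! ### Partitions, Richardson varieties, compatibility -/

/-- A partition with at most `d` parts, each of size at most `w`
(recorded as a function `ℕ → ℕ` vanishing from index `d` on; part `i` (0-based)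
is the `(i+1)`-st part). -/
structure PartitionIn (d w : ℕ) where
  part : ℕ → ℕ
  antitone : ∀ ⦃i j : ℕ⦄, i ≤ j → part j ≤ part i
  le_w : ∀ i, part i ≤ w
  eq_zero : ∀ i, d ≤ i → part i = 0

/-- The size `|λ|` of a partition. -/
def PartitionIn.size {d w : ℕ} (lam : PartitionIn d w) : ℕ :=
  ∑ i ∈ Finset.range d, lam.part i

/-- Containment `μ ⊆ λ` of partitions. -/
def SubPartition {d w : ℕ} (mu lam : PartitionIn d w) : Prop :=
  ∀ i, mu.part i ≤ lam.part i

/-- The full rectangular partition `(w)^d`. -/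
def rectPart (d w : ℕ) : PartitionIn d w :=
  { part := fun i => if i < d then w else 0
    antitone := by
      intro i j hij
      by_cases hj : j < d
      · have hi : i < d := lt_of_le_of_lt hij hj
        simp [hi, hj]
      · simp [hj]
    le_w := by intro i; by_cases hi : i < d <;> simp [hi]
    eq_zero := by intro i hi; simp [Nat.not_lt.mpr hi] }

/-- The empty partition. -/
def zeroPart (d w : ℕ) : PartitionIn d w :=
  { part := fun _ => 0
    antitone := by intro i j _; exact le_rfl
    le_w := fun _ => Nat.zero_le _
    eq_zero := fun _ _ => rfl }

/-- The flag `F_i = z^{n-i} ℂ_{i-1}[z]` inside `ℂ_{n-1}[z]`. -/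
def Fflag (n i : ℕ) : Submodule ℂ (Polynomial ℂ) :=
  Polynomial.degreeLT ℂ n ⊓
    Submodule.restrictScalars ℂ (Ideal.span {(Polynomial.X : Polynomial ℂ) ^ (n - i)})

/-- The flag `F̃_i = ℂ_{i-1}[z]`. -/
def Ftilde (i : ℕ) : Submodule ℂ (Polynomial ℂ) := Polynomial.degreeLT ℂ i

/-- Membership in the Richardson variety `X_{λ/μ}`. -/
def InRichardson (n d : ℕ) (lam mu : PartitionIn d (n - d))
    (x : Submodule ℂ (Polynomial ℂ)) : Prop :=
  ∀ i : ℕ, i < d →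
    i + 1 ≤ Module.finrank ℂ ↥(x ⊓ Fflag n (n - d - mu.part i + (i + 1))) ∧
    i + 1 ≤ Module.finrank ℂ ↥(x ⊓ Ftilde (lam.part (d - 1 - i) + (i + 1)))

/-- The Richardson variety `X_{λ/μ}` is compatible with the polynomial `h`:
`μ ⊆ λ`, `|λ| = deg h` and `|μ| = mindeg h`. -/
def Compatible (n d : ℕ) (lam mu : PartitionIn d (n - d)) (h : Polynomial ℂ) : Prop :=
  SubPartition mu lam ∧ lam.size = h.natDegree ∧ mu.size = h.rootMultiplicity 0

/-! ### Ribbons and tableaux -/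

/-- Two boxes (row, column) are adjacent. -/
def BoxAdj (p q : ℕ × ℕ) : Prop :=
  (p.1 = q.1 ∧ (p.2 + 1 = q.2 ∨ q.2 + 1 = p.2)) ∨
  (p.2 = q.2 ∧ (p.1 + 1 = q.1 ∨ q.1 + 1 = p.1))

/-- A set of boxes is an `r`-ribbon: it has `r` boxes, is connected,
and contains no 2×2 square. -/
def IsRibbon (r : ℕ) (S : Set (ℕ × ℕ)) : Prop :=
  S.ncard = r ∧
  (∀ p ∈ S, ∀ q ∈ S, Relation.ReflTransGen (fun u v => u ∈ S ∧ v ∈ S ∧ BoxAdj u v) p q) ∧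
  ¬ ∃ i j : ℕ, (i, j) ∈ S ∧ (i + 1, j) ∈ S ∧ (i, j + 1) ∈ S ∧ (i + 1, j + 1) ∈ S

/-- The box `(i,j)` (0-based row and column) lies in the skew diagram `λ/μ`. -/
def InShape {d w : ℕ} (lam mu : PartitionIn d w) (i j : ℕ) : Prop :=
  i < d ∧ mu.part i ≤ j ∧ j < lam.part i

/-- `E` is a standard `r`-ribbon tableau of skew shape `λ/μ` with entries `1, …, ℓ`
(recorded as a function on boxes, normalized to `0` off the shape). -/
def IsSRT {d w : ℕ} (r ℓ : ℕ) (lam mu : PartitionIn d w) (E : ℕ → ℕ → ℕ) : Prop :=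
  (∀ i j, ¬ InShape lam mu i j → E i j = 0) ∧
  (∀ i j, InShape lam mu i j → 1 ≤ E i j ∧ E i j ≤ ℓ) ∧
  (∀ i j j', InShape lam mu i j → InShape lam mu i j' → j ≤ j' → E i j ≤ E i j') ∧
  (∀ i i' j, InShape lam mu i j → InShape lam mu i' j → i ≤ i' → E i j ≤ E i' j) ∧
  (∀ k, 1 ≤ k → k ≤ ℓ → IsRibbon r {p : ℕ × ℕ | InShape lam mu p.1 p.2 ∧ E p.1 p.2 = k})

/-- A tableau (with boxes inside the `d × w` rectangle and largest entry `m`) is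
rotationally invariant: it is fixed by rotating `180°` inside the rectangle and
replacing each entry `k` by `m + 1 - k`. -/
def RotInvariant {d w : ℕ} (m : ℕ) (lam mu : PartitionIn d w) (E : ℕ → ℕ → ℕ) : Prop :=
  ∀ i j, InShape lam mu i j →
    InShape lam mu (d - 1 - i) (w - 1 - j) ∧
    E (d - 1 - i) (w - 1 - j) = m + 1 - E i j

/-- For `ℓ` even: a tableau of shape `λ/μ` with entries `1, …, ℓ-1`, in which the
boxes with entry `k ≠ ℓ/2` form `r`-ribbons and the boxes with entry `ℓ/2`
form a `2r`-ribbon. -/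
def IsHatSRT {d w : ℕ} (r ℓ : ℕ) (lam mu : PartitionIn d w) (E : ℕ → ℕ → ℕ) : Prop :=
  (∀ i j, ¬ InShape lam mu i j → E i j = 0) ∧
  (∀ i j, InShape lam mu i j → 1 ≤ E i j ∧ E i j ≤ ℓ - 1) ∧
  (∀ i j j', InShape lam mu i j → InShape lam mu i j' → j ≤ j' → E i j ≤ E i j') ∧
  (∀ i i' j, InShape lam mu i j → InShape lam mu i' j → i ≤ i' → E i j ≤ E i' j) ∧
  (∀ k, 1 ≤ k → k ≤ ℓ - 1 → k ≠ ℓ / 2 →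
    IsRibbon r {p : ℕ × ℕ | InShape lam mu p.1 p.2 ∧ E p.1 p.2 = k}) ∧
  IsRibbon (2 * r) {p : ℕ × ℕ | InShape lam mu p.1 p.2 ∧ E p.1 p.2 = ℓ / 2}

/-! ### Rectangular standard Young tableaux, promotion and evacuation -/

/-- `E` is a standard Young tableau of rectangular shape `d × w`
(normalized to `0` outside the rectangle). -/
def IsSYT (d w : ℕ) (E : ℕ → ℕ → ℕ) : Prop :=
  (∀ i j, d ≤ i ∨ w ≤ j → E i j = 0) ∧
  (∀ i j, i < d → j < w → 1 ≤ E i j ∧ E i j ≤ d * w) ∧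
  (∀ i j, i < d → j + 1 < w → E i j < E i (j + 1)) ∧
  (∀ i j, i + 1 < d → j < w → E i j < E (i + 1) j) ∧
  (∀ m, 1 ≤ m → m ≤ d * w → ∃ i j, i < d ∧ j < w ∧ E i j = m)

/-- One step of the jeu de taquin slide of the empty box, restricted to the
subtableau of entries `≤ i₀`: the empty box swaps with the smaller of its east
and south neighbours (among entries `≤ i₀`), if any. -/
def slideStep (d w i₀ : ℕ) (E : ℕ → ℕ → ℕ) (p : ℕ × ℕ) : ℕ × ℕ :=
  if (p.1 + 1 < d ∧ E (p.1 + 1) p.2 ≤ i₀) ∧ (p.2 + 1 < w ∧ E p.1 (p.2 + 1) ≤ i₀) then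
    (if E (p.1 + 1) p.2 < E p.1 (p.2 + 1) then (p.1 + 1, p.2) else (p.1, p.2 + 1))
  else if p.1 + 1 < d ∧ E (p.1 + 1) p.2 ≤ i₀ then (p.1 + 1, p.2)
  else if p.2 + 1 < w ∧ E p.1 (p.2 + 1) ≤ i₀ then (p.1, p.2 + 1)
  else p

/-- The path of the empty box in the jeu de taquin slide, starting in the
northwest corner. -/
def slidePath (d w i₀ : ℕ) (E : ℕ → ℕ → ℕ) : ℕ → ℕ × ℕ
  | 0 => (0, 0)
  | k + 1 => slideStep d w i₀ E (slidePath d w i₀ E k)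

/-- Promotion restricted to the entries `1, …, i₀` (the operator `𝑗_{i₀}`):
delete the entry `1`, slide the empty box through the entries `≤ i₀`, decrement
those entries by one and place `i₀` in the final empty box. -/
def partialPromo (d w i₀ : ℕ) (E : ℕ → ℕ → ℕ) : ℕ → ℕ → ℕ := fun i j =>
  if d ≤ i ∨ w ≤ j then 0
  else if (i, j) = slidePath d w i₀ E i₀ then i₀
  else if slidePath d w i₀ E (i + j) = (i, j) then
    E (slidePath d w i₀ E (i + j + 1)).1 (slidePath d w i₀ E (i + j + 1)).2 - 1
  else if E i j ≤ i₀ then E i j - 1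
  else E i j

/-- Jeu de taquin promotion `𝑗` on fillings of the `d × w` rectangle. -/
def promo (d w : ℕ) (E : ℕ → ℕ → ℕ) : ℕ → ℕ → ℕ := partialPromo d w (d * w) E

/-- `evacAux d w i = 𝑗_1 ∘ 𝑗_2 ∘ ⋯ ∘ 𝑗_i`. -/
def evacAux (d w : ℕ) : ℕ → (ℕ → ℕ → ℕ) → (ℕ → ℕ → ℕ)
  | 0, E => E
  | i + 1, E => evacAux d w i (partialPromo d w (i + 1) E)

/-- Evacuation `𝑒 = 𝑗_1 ∘ 𝑗_2 ∘ ⋯ ∘ 𝑗_N` on fillings of the `d × w` rectangle. -/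
def evac (d w : ℕ) (E : ℕ → ℕ → ℕ) : ℕ → ℕ → ℕ := evacAux d w (d * w) E

/-- The `C_r`-fixed polynomial `z^m (z^r + h_1) ⋯ (z^r + h_ℓ)`. -/
def crPoly (r m ℓ : ℕ) (hs : Fin ℓ → ℂ) : Polynomial ℂ :=
  Polynomial.X ^ m * ∏ i : Fin ℓ, (Polynomial.X ^ r + Polynomial.C (hs i))

/-- The product `∏ (z^r + a_i)(z^r + a_i⁻¹)` of generic inverse pairs. -/
def pairsPoly (r t : ℕ) (a : Fin t → ℂ) : Polynomial ℂ :=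
  ∏ i : Fin t,
    ((Polynomial.X ^ r + Polynomial.C (a i)) * (Polynomial.X ^ r + Polynomial.C (a i)⁻¹))

/-- A `D_r`-fixed polynomial of type (1). -/
def type1poly (r m t : ℕ) (ε : ℂ) (a : Fin t → ℂ) : Polynomial ℂ :=
  Polynomial.X ^ m * (Polynomial.X ^ r + Polynomial.C ε) * pairsPoly r t a

/-- A `D_r`-fixed polynomial of type (2). -/
def type2poly (r m t : ℕ) (a : Fin t → ℂ) : Polynomial ℂ :=
  Polynomial.X ^ m * pairsPoly r t a

/-- A `D_r`-fixed polynomial of type (3). -/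
def type3poly (r m t : ℕ) (a : Fin t → ℂ) : Polynomial ℂ :=
  Polynomial.X ^ m * (Polynomial.X ^ r + 1) * (Polynomial.X ^ r - 1) * pairsPoly r t a

/-- `x` is an even-odd point: it has a basis each of whose members is an even or
an odd polynomial. -/
def IsEvenOddPoint (d : ℕ) (x : Submodule ℂ (Polynomial ℂ)) : Prop :=
  ∃ f : Fin d → Polynomial ℂ, LinearIndependent ℂ f ∧
    Submodule.span ℂ (Set.range f) = x ∧
    ∀ i, (f i).comp (-Polynomial.X) = f i ∨ (f i).comp (-Polynomial.X) = -(f i)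

/-- `x` is a real point: it has a basis of polynomials with real coefficients. -/
def IsRealPoint (d : ℕ) (x : Submodule ℂ (Polynomial ℂ)) : Prop :=
  ∃ f : Fin d → Polynomial ℂ, LinearIndependent ℂ f ∧
    Submodule.span ℂ (Set.range f) = x ∧
    ∀ i k, ((f i).coeff k).im = 0

/-- The Möbius action of a matrix on `ℂℙ¹ = ℂ ∪ {∞}` (modelled by `Option ℂ`,
with `none` playing the role of `∞`). -/
def mobP1 (M : Matrix (Fin 2) (Fin 2) ℂ) : Option ℂ → Option ℂ := fun p =>
  match p with
  | none => if M 1 0 = 0 then none else some (M 0 0 / M 1 0)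
  | some a =>
      if M 1 0 * a + M 1 1 = 0 then none
      else some ((M 0 0 * a + M 0 1) / (M 1 0 * a + M 1 1))

/-- The action of a matrix `φ` on `ℂ_{n-1}[z] `:
`(φf)(z) = (φ₂₁ z + φ₁₁)^{n-1} f((φ₂₂ z + φ₁₂)/(φ₂₁ z + φ₁₁))`. -/
def mobiusMap (n : ℕ) (M : Matrix (Fin 2) (Fin 2) ℂ) : Polynomial ℂ →ₗ[ℂ] Polynomial ℂ :=
  ∑ k ∈ Finset.range n, (Polynomial.lcoeff ℂ k).smulRight
    ((Polynomial.C (M 1 1) * Polynomial.X + Polynomial.C (M 0 1)) ^ k *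
     (Polynomial.C (M 1 0) * Polynomial.X + Polynomial.C (M 0 0)) ^ (n - 1 - k))

/-- The polynomial `∏_{a_i ≠ ∞} (z + a_i)` attached to a tuple of points of `ℂℙ¹`. -/
def rootsPoly (N : ℕ) (a : Fin N → Option ℂ) : Polynomial ℂ :=
  ∏ i : Fin N, (a i).elim 1 (fun c => Polynomial.X + Polynomial.C c)

/-- The eigenspace `M_k`: the span of the monomials `z^j`, `j < n`, `j ≡ k (mod r)`. -/
def eigSpace (n r : ℕ) (k : Fin r) : Submodule ℂ (Polynomial ℂ) :=
  Submodule.span ℂ {p : Polynomial ℂ | ∃ j : ℕ, j < n ∧ j % r = (k : ℕ) ∧ p = Polynomial.X ^ j}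

/-- The operator `c` on `ℂ_{n-1}[z]` with `c · z^k = ζ^{n-1-2k} z^k`, `ζ = e^{πi/r}`. -/
def cMap (n r : ℕ) : Polynomial ℂ →ₗ[ℂ] Polynomial ℂ :=
  (Complex.exp ((Real.pi : ℂ) * Complex.I / (r : ℂ))) ^ (n - 1) •
    (Polynomial.aeval
        (Polynomial.C (((Complex.exp ((Real.pi : ℂ) * Complex.I / (r : ℂ))) ^ 2)⁻¹) *
          Polynomial.X) :
      Polynomial ℂ →ₐ[ℂ] Polynomial ℂ).toLinearMap

/-- `μ` is obtained from `λ` by removing a single `r`-ribbon. -/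
def RibbonStep {d w : ℕ} (r : ℕ) (lam mu : PartitionIn d w) : Prop :=
  SubPartition mu lam ∧ IsRibbon r {p : ℕ × ℕ | InShape lam mu p.1 p.2}

/-- `λ` and `μ` have the same `r`-core: they are related by the equivalence
relation generated by removal of a single `r`-ribbon. -/
def RibbonEquiv {d w : ℕ} (r : ℕ) (lam mu : PartitionIn d w) : Prop :=
  Relation.EqvGen (fun a b => RibbonStep r a b) lam mu

/-- `κ` is an `r`-core: no `r`-ribbon can be removed from it. -/
def IsRCore {d w : ℕ} (r : ℕ) (kappa : PartitionIn d w) : Prop :=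
  ¬ ∃ mu : PartitionIn d w, RibbonStep r kappa mu

/-- The column set `J(λ) = {i - 1 + λ^{d+1-i} : 1 ≤ i ≤ d}` of the Plücker
coordinate `p_λ`, as a function of `i`. -/
def pluckerIndex {d w : ℕ} (lam : PartitionIn d w) (i : Fin d) : ℕ :=
  (i : ℕ) + lam.part (d - 1 - (i : ℕ))

/-- The Plücker coordinate `p_λ(x)` of `x` is nonzero (this does not depend on
the choice of basis of `x`). -/
def PluckerNonzero (d : ℕ) {w : ℕ} (lam : PartitionIn d w)
    (x : Submodule ℂ (Polynomial ℂ)) : Prop :=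
  ∃ f : Fin d → Polynomial ℂ, LinearIndependent ℂ f ∧
    Submodule.span ℂ (Set.range f) = x ∧
    Matrix.det (Matrix.of fun i i' : Fin d => (f i).coeff (pluckerIndex lam i')) ≠ 0

end

open Polynomial

namespace WS
noncomputable section

/-! ## Part 1 : the commuting operators -/

/-- The operators `H_i` on functions on the symmetric group. -/
def HH {R : Type*} [CommRing R] {N : ℕ} (q : Fin N → Fin N → R) (lam : Fin N → R) (i : Fin N) :
    Matrix (Equiv.Perm (Fin N)) (Equiv.Perm (Fin N)) R :=
  Matrix.of fun σ τ => (if τ = σ then lam (σ i) else 0) +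
    ∑ j, (if τ = σ * Equiv.swap i j then q i j else 0)

lemma HH_mulVec {R : Type*} [CommRing R] {N : ℕ} (q : Fin N → Fin N → R) (lam : Fin N → R)
    (i : Fin N) (ψ : Equiv.Perm (Fin N) → R) (σ : Equiv.Perm (Fin N)) :
    (HH q lam i).mulVec ψ σ = lam (σ i) * ψ σ + ∑ j, q i j * ψ (σ * Equiv.swap i j) := by
  simp only [Matrix.mulVec, dotProduct, HH, Matrix.of_apply, add_mul, Finset.sum_add_distrib,
    Finset.sum_mul, ite_mul, zero_mul]
  congr 1
  · simp
  · rw [Finset.sum_comm]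
    simp

/-- the relations satisfied by `q` -/
structure QRel {R : Type*} [CommRing R] {N : ℕ} (q : Fin N → Fin N → R) : Prop where
  anti : ∀ i j, q i j = - q j i
  diag : ∀ i, q i i = 0
  quad : ∀ i j k, i ≠ j → j ≠ k → i ≠ k → q i j * q j k + q j k * q k i + q k i * q i j = 0

lemma HH_comm_aux {R : Type*} [CommRing R] {N : ℕ} (q : Fin N → Fin N → R) (hq : QRel q)
    (i j : Fin N) (hij : i ≠ j) (f : Equiv.Perm (Fin N) → R) :
    ∑ k, ∑ l, q i k * q j l * (f (Equiv.swap i k * Equiv.swap j l) -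
      f (Equiv.swap j l * Equiv.swap i k)) = 0 := by
  set F : Fin N → Fin N → R := fun k l => q i k * q j l * (f (Equiv.swap i k * Equiv.swap j l) -
      f (Equiv.swap j l * Equiv.swap i k)) with hF
  have hpt : ∀ k l, F k l = (if k = j then F k l else 0) + (if l = i then F k l else 0)
      + (if k = l then F k l else 0) := by
    intro k l
    by_cases h1 : k = j
    · subst h1
      by_cases h2 : l = i
      · subst h2
        have : F k l = 0 := by
          simp only [hF]
          rw [Equiv.swap_comm l k]; simp
        simp [this]
      · by_cases h3 : k = l
        · subst h3
          simp [hF, hq.diag]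
        · simp [h2, h3]
    · by_cases h2 : l = i
      · subst h2
        by_cases h3 : k = l
        · subst h3
          simp [hF, hq.diag]
        · simp [h1, h3]
      · by_cases h3 : k = l
        · subst h3; simp [h1, h2]
        · simp only [h1, h2, h3, if_false, add_zero]
          by_cases h4 : k = i
          · subst h4; simp [hF, hq.diag]
          · by_cases h5 : l = j
            · subst h5; simp [hF, hq.diag]
            · simp only [hF]
              have hd : Equiv.Perm.Disjoint (Equiv.swap i k) (Equiv.swap j l) := by
                rw [Equiv.Perm.disjoint_iff_eq_or_eq]
                intro x
                by_cases hx : x = i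
                · right; subst hx
                  exact Equiv.swap_apply_of_ne_of_ne hij (Ne.symm h2)
                · by_cases hx' : x = k
                  · right; subst hx'
                    exact Equiv.swap_apply_of_ne_of_ne h1 h3
                  · left
                    exact Equiv.swap_apply_of_ne_of_ne hx hx'
              rw [hd.commute.eq]; simp
  have e1 : ∑ k, ∑ l, F k l = ∑ k, (F j k + F k i + F k k) := by
    calc ∑ k, ∑ l, F k l = ∑ k, ∑ l, ((if k = j then F k l else 0) + (if l = i then F k l else 0)
      + (if k = l then F k l else 0)) := by
          refine Finset.sum_congr rfl fun k _ => Finset.sum_congr rfl fun l _ => hpt k l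
      _ = _ := by
          simp only [Finset.sum_add_distrib]
          congr 1
          · congr 1
            · rw [Finset.sum_comm]; simp
            · simp
          · simp
  rw [e1]
  refine Finset.sum_eq_zero fun k _ => ?_
  by_cases hki : k = i
  · subst hki
    simp only [hF]
    rw [Equiv.swap_comm k j]; simp [hq.diag]
  by_cases hkj : k = j
  · subst hkj
    simp only [hF]
    rw [Equiv.swap_comm k i]; simp [hq.diag]
  simp only [hF]
  have hjk := Ne.symm hkj
  have hik := Ne.symm hki
  have s1 : Equiv.swap i j * Equiv.swap j k = Equiv.swap i k * Equiv.swap j i := by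
    rw [Equiv.mul_swap_eq_swap_mul, Equiv.swap_apply_right,
      Equiv.swap_apply_of_ne_of_ne hki hkj, Equiv.swap_comm i j]
  have s2 : Equiv.swap j k * Equiv.swap i j = Equiv.swap j i * Equiv.swap i k := by
    rw [Equiv.mul_swap_eq_swap_mul (Equiv.swap j i), Equiv.swap_apply_right,
      Equiv.swap_apply_of_ne_of_ne hkj hki, Equiv.swap_comm i j]
  have s3 : Equiv.swap i k * Equiv.swap j k = Equiv.swap j k * Equiv.swap i j := by
    rw [Equiv.mul_swap_eq_swap_mul (Equiv.swap j k), Equiv.swap_apply_left,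
      Equiv.swap_apply_of_ne_of_ne hij hik]
  have s4 : Equiv.swap j k * Equiv.swap i k = Equiv.swap i j * Equiv.swap j k := by
    rw [Equiv.mul_swap_eq_swap_mul (Equiv.swap j k), Equiv.swap_apply_right,
      Equiv.swap_apply_of_ne_of_ne hij hik]
  rw [s3, s4, ← s1, ← s2]
  have h1 := hq.quad i j k hij (Ne.symm hkj) (Ne.symm hki)
  have h2 := hq.anti k i
  have h3 := hq.anti j i
  rw [h2] at h1
  rw [h3]
  linear_combination (f (Equiv.swap i j * Equiv.swap j k) - f (Equiv.swap j k * Equiv.swap i j)) * h1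

lemma HH_comm {R : Type*} [CommRing R] {N : ℕ} (q : Fin N → Fin N → R) (hq : QRel q)
    (lam : Fin N → R) (i j : Fin N) : Commute (HH q lam i) (HH q lam j) := by
  by_cases hij : i = j
  · subst hij; rfl
  unfold Commute SemiconjBy
  apply Matrix.ext_of_mulVec_single
  intro τ
  set ψ : Equiv.Perm (Fin N) → R := Pi.single τ 1
  rw [← Matrix.mulVec_mulVec, ← Matrix.mulVec_mulVec]
  ext σ
  simp only [HH_mulVec]
  have key := HH_comm_aux q hq i j hij (fun π => ψ (σ * π))
  simp only [mul_sub, Finset.sum_sub_distrib] at key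
  have e1 : ∑ k, q i k * (lam ((σ * Equiv.swap i k) j) * ψ (σ * Equiv.swap i k)) =
      lam (σ j) * ∑ k, q i k * ψ (σ * Equiv.swap i k)
        + q i j * (lam (σ i) - lam (σ j)) * ψ (σ * Equiv.swap i j) := by
    rw [Finset.mul_sum, ← sub_eq_iff_eq_add', ← Finset.sum_sub_distrib, Finset.sum_eq_single j]
    · simp; ring
    · intro k _ hk
      by_cases hki : k = i
      · subst hki; simp [hq.diag]
      · have : Equiv.swap i k j = j := Equiv.swap_apply_of_ne_of_ne (Ne.symm hij) (Ne.symm hk)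
        simp [this]; ring
    · simp
  have e2 : ∑ k, q j k * (lam ((σ * Equiv.swap j k) i) * ψ (σ * Equiv.swap j k)) =
      lam (σ i) * ∑ k, q j k * ψ (σ * Equiv.swap j k)
        + q j i * (lam (σ j) - lam (σ i)) * ψ (σ * Equiv.swap i j) := by
    rw [Finset.mul_sum, ← sub_eq_iff_eq_add', ← Finset.sum_sub_distrib, Finset.sum_eq_single i]
    · rw [Equiv.swap_comm j i]; simp; ring
    · intro k _ hk
      by_cases hkj : k = j
      · subst hkj; simp [hq.diag]
      · have : Equiv.swap j k i = i := Equiv.swap_apply_of_ne_of_ne hij (Ne.symm hk)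
        simp [this]; ring
    · simp
  simp only [mul_add, Finset.sum_add_distrib, e1, e2, Finset.mul_sum] at *
  have k1 : ∑ k, ∑ l, q i k * q j l * ψ (σ * (Equiv.swap i k * Equiv.swap j l)) =
    ∑ k, ∑ l, q i k * (q j l * ψ (σ * Equiv.swap i k * Equiv.swap j l)) := by
    refine Finset.sum_congr rfl fun k _ => Finset.sum_congr rfl fun l _ => ?_
    rw [mul_assoc, mul_assoc]
  have k2 : ∑ k, ∑ l, q i k * q j l * ψ (σ * (Equiv.swap j l * Equiv.swap i k)) =
    ∑ l, ∑ k, q j l * (q i k * ψ (σ * Equiv.swap j l * Equiv.swap i k)) := by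
    rw [Finset.sum_comm]
    refine Finset.sum_congr rfl fun k _ => Finset.sum_congr rfl fun l _ => ?_
    rw [← mul_assoc σ]; ring
  rw [k1, k2] at key
  have h3 := hq.anti j i
  rw [h3]
  linear_combination key

lemma HH_symm {R : Type*} [CommRing R] {N : ℕ} (q : Fin N → Fin N → R)
    (lam : Fin N → R) (i : Fin N) : (HH q lam i).transpose = HH q lam i := by
  ext σ τ
  simp only [HH, Matrix.transpose_apply, Matrix.of_apply]
  congr 1
  · by_cases h : σ = τ
    · simp [h]
    · simp [h, Ne.symm h]
  · refine Finset.sum_congr rfl fun j _ => ?_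
    have : (σ = τ * Equiv.swap i j) ↔ (τ = σ * Equiv.swap i j) := by
      constructor
      · rintro rfl; simp [mul_assoc]
      · rintro rfl; simp [mul_assoc]
    simp [this]

/-- a joint eigenvector yields eigenvectors of the Calogero–Moser matrix -/
lemma joint_to_CM {R : Type*} [CommRing R] {N : ℕ} (q : Fin N → Fin N → R)
    (lam p : Fin N → R) (ψ : Equiv.Perm (Fin N) → R)
    (h : ∀ i, (HH q lam i).mulVec ψ = p i • ψ) (k : Fin N) :
    (Matrix.diagonal p - Matrix.of q).mulVec (fun i => ∑ σ, if σ i = k then ψ σ else 0)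
      = lam k • (fun i => ∑ σ, if σ i = k then ψ σ else 0) := by
  ext i
  rw [Matrix.sub_mulVec]
  simp only [Pi.sub_apply, Matrix.mulVec_diagonal, Pi.smul_apply, smul_eq_mul]
  have h1 : p i * (∑ σ : Equiv.Perm (Fin N), if σ i = k then ψ σ else 0) =
     lam k * (∑ σ : Equiv.Perm (Fin N), if σ i = k then ψ σ else 0) +
      ∑ j, q i j * ∑ σ : Equiv.Perm (Fin N), if σ j = k then ψ σ else 0 := by
    have : ∀ σ : Equiv.Perm (Fin N), p i * ψ σ =
        lam (σ i) * ψ σ + ∑ j, q i j * ψ (σ * Equiv.swap i j) := by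
      intro σ
      have := congrFun (h i) σ
      rw [HH_mulVec] at this
      simpa using this.symm
    calc p i * (∑ σ : Equiv.Perm (Fin N), if σ i = k then ψ σ else 0)
        = ∑ σ : Equiv.Perm (Fin N), if σ i = k then p i * ψ σ else 0 := by
          rw [Finset.mul_sum]; refine Finset.sum_congr rfl fun σ _ => ?_; split_ifs <;> simp
      _ = ∑ σ : Equiv.Perm (Fin N), ((if σ i = k then lam k * ψ σ else 0) +
            ∑ j, if σ i = k then q i j * ψ (σ * Equiv.swap i j) else 0) := by
          refine Finset.sum_congr rfl fun σ _ => ?_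
          split_ifs with hk
          · rw [this, hk]
          · simp
      _ = _ := by
          rw [Finset.sum_add_distrib]
          congr 1
          · rw [Finset.mul_sum]; refine Finset.sum_congr rfl fun σ _ => ?_; split_ifs <;> simp
          · rw [Finset.sum_comm]
            refine Finset.sum_congr rfl fun j _ => ?_
            rw [Finset.mul_sum]
            rw [← Equiv.sum_comp (Equiv.mulRight (Equiv.swap i j))]
            refine Finset.sum_congr rfl fun σ _ => ?_
            simp [mul_assoc]
  rw [h1]
  simp only [Matrix.mulVec, dotProduct, Matrix.of_apply]
  ring

end
end WS

open Polynomial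

namespace WS
noncomputable section

/-- Existence of a joint eigenvector with controlled eigenvalues. -/
lemma exists_joint {N : ℕ} (q : Fin N → Fin N → ℝ) (hq : QRel q) (lam : Fin N → ℝ) :
    ∃ (p : Fin N → ℝ) (ψ : Equiv.Perm (Fin N) → ℝ), ψ ≠ 0 ∧
      (∀ i, (HH q lam i).mulVec ψ = p i • ψ) ∧
      ∑ i, (p i - lam i) ^ 2 ≤ ∑ i, ∑ σ : Equiv.Perm (Fin N),
        (∑ j, q i j * (if σ * Equiv.swap i j = 1 then 1 else 0)) ^ 2 := by
  set T : Fin N → (EuclideanSpace ℝ (Equiv.Perm (Fin N)) →ₗ[ℝ] EuclideanSpace ℝ (Equiv.Perm (Fin N))) :=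
    fun i => (HH q lam i).toEuclideanLin with hT
  have hTs : ∀ i, (T i).IsSymmetric := by
    intro i
    rw [hT, Matrix.isSymmetric_toEuclideanLin_iff]
    unfold Matrix.IsHermitian
    rw [Matrix.conjTranspose_eq_transpose_of_trivial, HH_symm]
  have hTapp : ∀ i (x : EuclideanSpace ℝ (Equiv.Perm (Fin N))),
      T i x = WithLp.toLp 2 ((HH q lam i).mulVec (WithLp.ofLp x)) := by
    intro i x; simp [hT, Matrix.toLpLin_apply]
  have hTc : Pairwise (Function.onFun Commute T) := by
    intro i j _
    have := HH_comm q hq lam i j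
    apply LinearMap.ext
    intro x
    simp only [Module.End.mul_apply, hTapp, Matrix.mulVec_mulVec]
    rw [this.eq]
  have htop := LinearMap.IsSymmetric.iSup_iInf_eq_top_of_commute hTs hTc
  have hort := LinearMap.IsSymmetric.orthogonalFamily_iInf_eigenspaces hTs
  classical
  set δ : EuclideanSpace ℝ (Equiv.Perm (Fin N)) := EuclideanSpace.single 1 1 with hδ
  have hmem : δ ∈ ⨆ χ : Fin N → ℝ, ⨅ i, Module.End.eigenspace (T i) (χ i) := by
    rw [htop]; trivial
  rw [Submodule.mem_iSup_iff_exists_dfinsupp'] at hmem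
  obtain ⟨f, hf⟩ := hmem
  rw [DFinsupp.sum] at hf
  set s := f.support with hs
  have heig : ∀ (χ : Fin N → ℝ) i, T i (f χ : EuclideanSpace ℝ (Equiv.Perm (Fin N))) = χ i • (f χ : EuclideanSpace ℝ (Equiv.Perm (Fin N))) := by
    intro χ i
    have := (f χ).2
    rw [Submodule.mem_iInf] at this
    exact Module.End.mem_eigenspace_iff.1 (this i)
  set B := ∑ i, ∑ σ : Equiv.Perm (Fin N),
        (∑ j, q i j * (if σ * Equiv.swap i j = 1 then 1 else 0)) ^ 2 with hB
  have h1 : ∑ χ ∈ s, ‖f χ‖ ^ 2 = 1 := by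
    have := hort.norm_sum (fun χ => f χ) s
    rw [← this]
    have e : ∑ i ∈ s, ((⨅ j, Module.End.eigenspace (T j) (i j)).subtypeₗᵢ) (f i) = δ := by
      rw [← hf]; rfl
    rw [e, hδ]; simp
  have h2 : ∀ i, ∑ χ ∈ s, (χ i - lam i) ^ 2 * ‖f χ‖ ^ 2 = ∑ σ : Equiv.Perm (Fin N),
        (∑ j, q i j * (if σ * Equiv.swap i j = 1 then 1 else 0)) ^ 2 := by
    intro i
    have := hort.norm_sum (fun χ => (χ i - lam i) • f χ) s
    have e : ∑ χ ∈ s, ((⨅ j, Module.End.eigenspace (T j) (χ j)).subtypeₗᵢ) ((χ i - lam i) • f χ)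
        = T i δ - lam i • δ := by
      rw [← hf, map_sum, Finset.smul_sum, ← Finset.sum_sub_distrib]
      refine Finset.sum_congr rfl fun χ _ => ?_
      rw [heig, ← sub_smul]; rfl
    rw [e] at this
    have e2 : ∑ χ ∈ s, (χ i - lam i) ^ 2 * ‖f χ‖ ^ 2 = ∑ χ ∈ s, ‖(χ i - lam i) • f χ‖ ^ 2 := by
      refine Finset.sum_congr rfl fun χ _ => ?_
      rw [norm_smul, mul_pow, Real.norm_eq_abs, sq_abs]
    rw [e2, ← this, EuclideanSpace.norm_sq_eq]
    refine Finset.sum_congr rfl fun σ _ => ?_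
    rw [Real.norm_eq_abs, sq_abs]
    congr 1
    rw [hTapp]
    simp only [PiLp.sub_apply, PiLp.smul_apply, HH_mulVec, smul_eq_mul, hδ]
    have : ∀ τ : Equiv.Perm (Fin N), (EuclideanSpace.single (1 : Equiv.Perm (Fin N)) (1:ℝ)).ofLp τ = if τ = 1 then 1 else 0 := by
      intro τ; simp [PiLp.single_apply]
    simp only [this]
    by_cases h : σ = 1
    · subst h; simp
    · simp [h]
  have h3 : ∑ χ ∈ s, (∑ i, (χ i - lam i) ^ 2) * ‖f χ‖ ^ 2 = B := by
    rw [hB]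
    simp only [← h2, Finset.sum_mul]
    rw [Finset.sum_comm]
  have : ∃ χ ∈ s, ∑ i, (χ i - lam i) ^ 2 ≤ B := by
    by_contra hcon
    push Not at hcon
    have hne : s.Nonempty := by
      rw [Finset.nonempty_iff_ne_empty]
      intro h; rw [h] at h1; simp at h1
    have : ∑ χ ∈ s, B * ‖f χ‖ ^ 2 < ∑ χ ∈ s, (∑ i, (χ i - lam i) ^ 2) * ‖f χ‖ ^ 2 := by
      refine Finset.sum_lt_sum_of_nonempty hne fun χ hχ => ?_
      have hpos : 0 < ‖f χ‖ ^ 2 := by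
        have : f χ ≠ 0 := by simpa [hs] using hχ
        positivity
      exact mul_lt_mul_of_pos_right (hcon χ hχ) hpos
    rw [h3, ← Finset.mul_sum, h1] at this
    simp at this
  obtain ⟨χ, hχ, hle⟩ := this
  refine ⟨χ, WithLp.ofLp (f χ : EuclideanSpace ℝ (Equiv.Perm (Fin N))), ?_, ?_, hle⟩
  · have : f χ ≠ 0 := by simpa [hs] using hχ
    intro h0
    apply this
    apply Subtype.ext
    apply (WithLp.ofLp_injective 2)
    simpa using h0
  · intro i
    have := heig χ i
    rw [hTapp] at this
    have := congrArg WithLp.ofLp this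
    simpa using this

lemma HH_map {R S : Type*} [CommRing R] [CommRing S] (φ : R →+* S) {N : ℕ}
    (q : Fin N → Fin N → R) (lam : Fin N → R) (i : Fin N) :
    (HH q lam i).map φ = HH (fun i j => φ (q i j)) (fun i => φ (lam i)) i := by
  ext σ τ
  simp only [HH, Matrix.map_apply, Matrix.of_apply, map_add, map_sum]
  congr 1
  · split_ifs <;> simp
  · refine Finset.sum_congr rfl fun j _ => ?_
    split_ifs <;> simp

lemma HH_perm {R : Type*} [CommRing R] {N : ℕ}
    (q : Fin N → Fin N → R) (lam : Fin N → R) (i : Fin N) (π : Equiv.Perm (Fin N)) :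
    (HH q (fun k => lam (π k)) i) = (HH q lam i).submatrix (Equiv.mulLeft π) (Equiv.mulLeft π) := by
  ext σ τ
  simp only [HH, Matrix.submatrix_apply, Matrix.of_apply]
  simp [mul_assoc]

lemma exists_esymm {N : ℕ} (P : MvPolynomial (Fin N) ℝ) (hP : P.IsSymmetric) :
    ∃ g : MvPolynomial (Fin N) ℝ,
      MvPolynomial.aeval (fun j : Fin N => MvPolynomial.esymm (Fin N) ℝ (j + 1)) g = P := by
  obtain ⟨g, hg⟩ := MvPolynomial.esymmAlgHom_surjective (σ := Fin N) (n := N) ℝ (by simp)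
      ⟨P, hP⟩
  refine ⟨g, ?_⟩
  have h2 := congrArg (MvPolynomial.symmetricSubalgebra (Fin N) ℝ).val hg
  rw [MvPolynomial.esymmAlgHom, MvPolynomial.comp_aeval_apply] at h2
  exact h2

/-- The polynomial `Φ_i`. -/
lemma exists_Phi {N : ℕ} (q : Fin N → Fin N → ℝ) (i : Fin N) :
    ∃ Φ : MvPolynomial (Fin N) ℝ, ∀ (K : Type) [Field K] [Algebra ℝ K] (p lam : Fin N → K),
      (Matrix.diagonal p - Matrix.of (fun i j => algebraMap ℝ K (q i j))).charpoly =
        ∏ k, (X - C (lam k)) →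
      MvPolynomial.aeval p Φ =
        (HH (fun i j => algebraMap ℝ K (q i j)) lam i).charpoly.eval (p i) := by
  set A := MvPolynomial (Fin N) ℝ
  set Hm : Matrix (Equiv.Perm (Fin N)) (Equiv.Perm (Fin N)) A :=
    HH (fun i j => algebraMap ℝ A (q i j)) (fun k => MvPolynomial.X k) i with hHm
  have hsym : ∀ k, (Hm.charpoly.coeff k).IsSymmetric := by
    intro k π
    have h1 : MvPolynomial.rename π (Hm.charpoly.coeff k)
        = (Hm.map (MvPolynomial.rename (R := ℝ) π).toRingHom).charpoly.coeff k := by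
      rw [Matrix.charpoly_map, Polynomial.coeff_map]; rfl
    rw [h1, hHm, HH_map]
    have h2 : (fun i j => (MvPolynomial.rename (R := ℝ) π).toRingHom (algebraMap ℝ A (q i j)))
        = fun i j => algebraMap ℝ A (q i j) := by
      ext1 i; ext1 j; exact AlgHom.commutes _ _
    have h3 : (fun k => (MvPolynomial.rename (R := ℝ) π).toRingHom (MvPolynomial.X k))
        = fun k => (MvPolynomial.X (π k) : A) := by
      ext1 k; exact MvPolynomial.rename_X _ _
    rw [h2, h3]
    have := HH_perm (fun i j => algebraMap ℝ A (q i j)) (fun k => (MvPolynomial.X k : A)) i π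
    rw [this]
    have h4 := Matrix.charpoly_reindex (Equiv.mulLeft π).symm
      (HH (fun i j => algebraMap ℝ A (q i j)) (fun k => (MvPolynomial.X k : A)) i)
    rw [Matrix.reindex_apply, Equiv.symm_symm] at h4
    rw [h4]
  have hsurj : ∀ k, ∃ g : MvPolynomial (Fin N) ℝ,
      MvPolynomial.aeval (fun j : Fin N => MvPolynomial.esymm (Fin N) ℝ (j + 1)) g
        = Hm.charpoly.coeff k := by
    intro k
    exact exists_esymm _ (hsym k)
  choose g hg using hsurj
  set Mm : Matrix (Fin N) (Fin N) A :=
    Matrix.diagonal (fun k => (MvPolynomial.X k : A)) - Matrix.of (fun i j => algebraMap ℝ A (q i j))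
    with hMm
  set cc : Fin N → A := fun j => (-1) ^ ((j : ℕ) + 1) * Mm.charpoly.coeff (N - (j + 1)) with hcc
  refine ⟨∑ k ∈ Finset.range (Hm.charpoly.natDegree + 1),
    MvPolynomial.aeval cc (g k) * MvPolynomial.X i ^ k, ?_⟩
  intro K _ _ p lam hch
  have e1 : Mm.map (MvPolynomial.aeval (R := ℝ) p).toRingHom =
      (Matrix.diagonal p - Matrix.of (fun i j => algebraMap ℝ K (q i j))) := by
    ext a b
    simp only [hMm, Matrix.map_apply, Matrix.sub_apply, Matrix.of_apply, map_sub,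
      Matrix.diagonal_apply]
    congr 1
    · split_ifs <;> simp
    · exact AlgHom.commutes _ _
  have e2 : ∀ j : Fin N, MvPolynomial.aeval p (cc j) =
      MvPolynomial.aeval lam (MvPolynomial.esymm (Fin N) ℝ (j + 1)) := by
    intro j
    have h1 : MvPolynomial.aeval p (Mm.charpoly.coeff (N - (j + 1))) =
        (∏ k, (X - C (lam k))).coeff (N - (j + 1)) := by
      rw [← hch, ← e1, Matrix.charpoly_map, Polynomial.coeff_map]; rfl
    have h2 := Multiset.prod_X_sub_C_coeff (Finset.univ.val.map lam) (k := N - (j + 1)) (by simp)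
    rw [Multiset.map_map] at h2
    have h3 : (∏ k, (X - C (lam k))).coeff (N - (j + 1)) =
        (-1) ^ ((j : ℕ) + 1) * (Finset.univ.val.map lam).esymm (j + 1) := by
      have : ((Multiset.map ((fun t => X - C t) ∘ lam) Finset.univ.val).prod) = ∏ k, (X - C (lam k)) := rfl
      rw [← this, h2]
      have hj : N - (N - ((j:ℕ) + 1)) = j + 1 := by have := j.2; omega
      simp [hj]
    rw [MvPolynomial.aeval_esymm_eq_multiset_esymm]
    simp only [hcc, map_mul, h1, h3, map_pow, map_neg, map_one]
    rw [← mul_assoc, ← mul_pow]; simp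
  have e3 : Hm.map (MvPolynomial.aeval (R := ℝ) lam).toRingHom =
      HH (fun i j => algebraMap ℝ K (q i j)) lam i := by
    rw [hHm, HH_map]
    congr 1
    · ext1 a; ext1 b; exact AlgHom.commutes _ _
    · ext1 a; exact MvPolynomial.aeval_X _ _
  have e4 : ∀ k, (HH (fun i j => algebraMap ℝ K (q i j)) lam i).charpoly.coeff k =
      MvPolynomial.aeval p (MvPolynomial.aeval cc (g k)) := by
    intro k
    rw [← e3, Matrix.charpoly_map, Polynomial.coeff_map, ← hg]
    have h1 : (MvPolynomial.aeval (R := ℝ) lam).toRingHom ((MvPolynomial.aeval fun j : Fin N => MvPolynomial.esymm (Fin N) ℝ (j + 1)) (g k))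
      = MvPolynomial.aeval lam ((MvPolynomial.aeval fun j : Fin N => MvPolynomial.esymm (Fin N) ℝ (j + 1)) (g k)) := rfl
    rw [h1, MvPolynomial.comp_aeval_apply, MvPolynomial.comp_aeval_apply]
    simp only [e2]
  have hdeg : (HH (fun i j => algebraMap ℝ K (q i j)) lam i).charpoly.natDegree < Hm.charpoly.natDegree + 1 := by
    rw [Matrix.charpoly_natDegree_eq_dim, Matrix.charpoly_natDegree_eq_dim]; exact Nat.lt_succ_self _
  rw [Polynomial.eval_eq_sum_range' hdeg]
  simp only [e4, map_sum, map_mul, map_pow, MvPolynomial.aeval_X]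

end
end WS

open Polynomial Filter Topology

namespace WS
noncomputable section

/-- polynomial valued maps with continuously differentiable coefficients -/
def SmoothP {E : Type*} [NormedAddCommGroup E] [NormedSpace ℝ E] (P : E → ℝ[X]) : Prop :=
  ∀ k, ContDiff ℝ 1 (fun y => (P y).coeff k)

section smooth
variable {E : Type*} [NormedAddCommGroup E] [NormedSpace ℝ E]

lemma SmoothP.const (p : ℝ[X]) : SmoothP (fun _ : E => p) := fun _ => contDiff_const

lemma SmoothP.add {P Q : E → ℝ[X]} (hP : SmoothP P) (hQ : SmoothP Q) :
    SmoothP (fun y => P y + Q y) := by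
  intro k; simp only [coeff_add]; exact (hP k).add (hQ k)

lemma SmoothP.neg {P : E → ℝ[X]} (hP : SmoothP P) : SmoothP (fun y => - P y) := by
  intro k; simp only [coeff_neg]; exact (hP k).neg

lemma SmoothP.sub {P Q : E → ℝ[X]} (hP : SmoothP P) (hQ : SmoothP Q) :
    SmoothP (fun y => P y - Q y) := by
  intro k; simp only [coeff_sub]; exact (hP k).sub (hQ k)

lemma SmoothP.mul {P Q : E → ℝ[X]} (hP : SmoothP P) (hQ : SmoothP Q) :
    SmoothP (fun y => P y * Q y) := by
  intro k; simp only [coeff_mul]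
  exact ContDiff.sum fun i _ => (hP _).mul (hQ _)

lemma SmoothP.C {f : E → ℝ} (hf : ContDiff ℝ 1 f) : SmoothP (fun y => Polynomial.C (f y)) := by
  intro k
  simp only [coeff_C]
  split_ifs
  · exact hf
  · exact contDiff_const

lemma SmoothP.sum {ι : Type*} (s : Finset ι) {P : ι → E → ℝ[X]} (hP : ∀ i ∈ s, SmoothP (P i)) :
    SmoothP (fun y => ∑ i ∈ s, P i y) := by
  intro k; simp only [finsetSum_coeff]
  exact ContDiff.sum fun i hi => hP i hi k

lemma SmoothP.prod {ι : Type*} (s : Finset ι) {P : ι → E → ℝ[X]} (hP : ∀ i ∈ s, SmoothP (P i)) :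
    SmoothP (fun y => ∏ i ∈ s, P i y) := by
  classical
  induction s using Finset.induction_on with
  | empty => simpa using SmoothP.const 1
  | insert a s ha ih =>
    simp only [Finset.prod_insert ha]
    exact (hP a (by simp)).mul (ih fun i hi => hP i (by simp [hi]))

lemma SmoothP.det {n : Type*} [Fintype n] [DecidableEq n] {M : E → Matrix n n ℝ[X]}
    (hM : ∀ i j, SmoothP (fun y => M y i j)) : SmoothP (fun y => (M y).det) := by
  simp only [Matrix.det_apply]
  refine SmoothP.sum _ fun σ _ => ?_
  have : ∀ y, Equiv.Perm.sign σ • ∏ i, M y (σ i) i = ((Equiv.Perm.sign σ : ℤ) : ℝ[X]) * ∏ i, M y (σ i) i := by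
    intro y; rw [Units.smul_def, zsmul_eq_mul]
  simp only [this]
  exact (SmoothP.const _).mul (SmoothP.prod _ fun i _ => hM _ _)

lemma SmoothP.derivative {P : E → ℝ[X]} (hP : SmoothP P) :
    SmoothP (fun y => Polynomial.derivative (P y)) := by
  intro k; simp only [coeff_derivative]
  exact (hP _).mul contDiff_const

lemma SmoothP.iterate {P : E → ℝ[X]} (hP : SmoothP P) (j : ℕ) :
    SmoothP (fun y => Polynomial.derivative^[j] (P y)) := by
  induction j with
  | zero => simpa using hP
  | succ j ih => simp only [Function.iterate_succ']; exact ih.derivative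

lemma SmoothP.charpoly {n : Type*} [Fintype n] [DecidableEq n] {M : E → Matrix n n ℝ}
    (hM : ∀ i j, ContDiff ℝ 1 (fun y => M y i j)) : SmoothP (fun y => (M y).charpoly) := by
  refine SmoothP.det fun i j => ?_
  simp only [Matrix.charmatrix_apply]
  exact (SmoothP.const _).sub (SmoothP.C (hM i j))

lemma SmoothP.comp {F : Type*} [NormedAddCommGroup F] [NormedSpace ℝ F] {P : E → ℝ[X]}
    (hP : SmoothP P) {g : F → E} (hg : ContDiff ℝ 1 g) : SmoothP (fun y => P (g y)) :=
  fun k => (hP k).comp hg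
end smooth

/-- the inverse function theorem in the form that we need -/
lemma ift {E F : Type*} [NormedAddCommGroup E] [NormedSpace ℝ E] [FiniteDimensional ℝ E]
    [NormedAddCommGroup F] [NormedSpace ℝ F] [FiniteDimensional ℝ F]
    (Θ : E → F) (hΘ : ContDiff ℝ 1 Θ) (x : E)
    (hfin : Module.finrank ℝ E = Module.finrank ℝ F)
    (hinj : ∀ v, HasDerivAt (fun s : ℝ => Θ (x + s • v)) 0 0 → v = 0) :
    map Θ (𝓝 x) = 𝓝 (Θ x) ∧ ∃ U ∈ 𝓝 x, Set.InjOn Θ U := by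
  have hs : HasStrictFDerivAt Θ (fderiv ℝ Θ x) x :=
    hΘ.contDiffAt.hasStrictFDerivAt (by simp)
  have hker : Function.Injective (fderiv ℝ Θ x : E →ₗ[ℝ] F) := by
    rw [← LinearMap.ker_eq_bot, LinearMap.ker_eq_bot']
    intro v hv
    apply hinj
    have h1 : HasDerivAt (fun s : ℝ => x + s • v) v 0 := by
      simpa using ((hasDerivAt_id (0:ℝ)).smul_const v).const_add x
    have h2 : HasFDerivAt Θ (fderiv ℝ Θ x) (x + (0:ℝ) • v) := by
      simpa using hs.hasFDerivAt
    have := h2.comp_hasDerivAt (0:ℝ) h1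
    rw [show (fderiv ℝ Θ x) v = 0 from hv] at this
    exact this
  set e := (LinearEquiv.ofInjectiveOfFinrankEq (fderiv ℝ Θ x : E →ₗ[ℝ] F) hker hfin).toContinuousLinearEquiv
  have he : (e : E →L[ℝ] F) = fderiv ℝ Θ x := by
    ext v; rfl
  rw [← he] at hs
  refine ⟨hs.map_nhds_eq_of_equiv, ?_⟩
  refine ⟨(hs.toOpenPartialHomeomorph Θ).source,
    (hs.toOpenPartialHomeomorph Θ).open_source.mem_nhds hs.mem_toOpenPartialHomeomorph_source, ?_⟩
  have := (hs.toOpenPartialHomeomorph Θ).injOn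
  rwa [hs.toOpenPartialHomeomorph_coe] at this

lemma hasDerivAt_eval_of_coeff {P : ℝ → ℝ[X]} {D : ℕ} (hdeg : ∀ s, (P s).natDegree ≤ D)
    (h : ∀ k ≤ D, HasDerivAt (fun s => (P s).coeff k) 0 0) (z : ℝ) :
    HasDerivAt (fun s => (P s).eval z) 0 0 := by
  have : (fun s => (P s).eval z) = fun s => ∑ k ∈ Finset.range (D + 1), (P s).coeff k * z ^ k := by
    ext s; exact Polynomial.eval_eq_sum_range' (Nat.lt_succ_of_le (hdeg s)) z
  rw [this]
  have := HasDerivAt.fun_sum (u := Finset.range (D + 1)) (A := fun k s => (P s).coeff k * z ^ k)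
    (A' := fun k => 0) (x := (0:ℝ)) (fun k hk => by
      simpa using (h k (by simpa [Nat.lt_succ_iff] using hk)).mul_const (z ^ k))
  simpa using this

lemma natDegree_prodX {N : ℕ} {K : Type*} [CommRing K] [Nontrivial K] (p : Fin N → K) :
    (∏ k, (X - C (p k))).natDegree = N := by
  rw [natDegree_prod_of_monic _ _ (fun i _ => monic_X_sub_C _)]; simp

/-- velocity of roots is determined by the velocity of coefficients -/
lemma roots_inj {N : ℕ} (p v : Fin N → ℝ) (hp : Function.Injective p)
    (h : ∀ k < N, HasDerivAt (fun s : ℝ => (∏ k, (X - C (p k + s * v k))).coeff k) 0 0) : v = 0 := by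
  have h1 := hasDerivAt_eval_of_coeff (P := fun s : ℝ => ∏ k, (X - C (p k + s * v k))) (D := N)
    (fun s => (natDegree_prodX _).le) (by
      intro k hk
      rcases hk.lt_or_eq with hk | rfl
      · exact h k hk
      · have : (fun s : ℝ => (∏ j : Fin k, (X - C (p j + s * v j))).coeff k) = fun _ => 1 := by
          ext s
          have hm : (∏ j : Fin k, (X - C (p j + s * v j))).Monic := monic_prod_of_monic _ _ (fun i _ => monic_X_sub_C _)
          have := hm.coeff_natDegree
          rwa [natDegree_prodX] at this
        rw [this]; exact hasDerivAt_const _ _)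
  ext k
  have h2 := h1 (p k)
  have h3 : HasDerivAt (fun s : ℝ => ∏ j, (p k - (p j + s * v j)))
      (∑ i, (∏ j ∈ Finset.univ.erase i, (p k - (p j + 0 * v j))) • (- v i)) 0 := by
    refine HasDerivAt.fun_finsetProd fun i _ => ?_
    have := (((hasDerivAt_id (0:ℝ)).mul_const (v i)).const_add (p i)).const_sub (p k)
    simpa using this
  have h4 : (fun s : ℝ => (∏ j, (X - C (p j + s * v j))).eval (p k)) = fun s : ℝ => ∏ j, (p k - (p j + s * v j)) := by
    ext s; simp [eval_prod]
  rw [h4] at h2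
  have h5 := h3.unique h2
  rw [Finset.sum_eq_single k] at h5
  · simp only [zero_mul, add_zero, smul_eq_mul, mul_neg, neg_eq_zero, mul_eq_zero] at h5
    rcases h5 with h5 | h5
    · rw [Finset.prod_eq_zero_iff] at h5
      obtain ⟨j, hj, hj'⟩ := h5
      rw [sub_eq_zero] at hj'
      exact absurd (hp hj').symm (Finset.ne_of_mem_erase hj)
    · simpa using h5
  · intro i _ hi
    rw [Finset.prod_eq_zero (i := k)]
    · simp
    · simp [Ne.symm hi]
    · simp
  · simp

/-- the coefficients map -/
def cf (N : ℕ) (P : ℝ[X]) : Fin N → ℝ := fun k => P.coeff k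

lemma cf_inj_monic {N : ℕ} {P Q : ℝ[X]} (hP : P.Monic) (hQ : Q.Monic) (hPd : P.natDegree = N)
    (hQd : Q.natDegree = N) (h : cf N P = cf N Q) : P = Q := by
  ext k
  rcases lt_trichotomy k N with hk | hk | hk
  · exact congrFun h ⟨k, hk⟩
  · subst hk; rw [← hPd, hP.coeff_natDegree, hPd, ← hQd, hQ.coeff_natDegree]
  · rw [coeff_eq_zero_of_natDegree_lt (by omega), coeff_eq_zero_of_natDegree_lt (by omega)]

lemma hasDerivAt_cf {N : ℕ} {P : ℝ → ℝ[X]} (h : HasDerivAt (fun s => cf N (P s)) 0 0) (k : ℕ) (hk : k < N) :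
    HasDerivAt (fun s => (P s).coeff k) 0 0 := by
  have := (hasDerivAt_pi.1 h) ⟨k, hk⟩
  simpa [cf] using this

lemma contDiff_cf {E : Type*} [NormedAddCommGroup E] [NormedSpace ℝ E] {N : ℕ} {P : E → ℝ[X]} (h : SmoothP P) :
    ContDiff ℝ 1 (fun y => cf N (P y)) := by
  rw [contDiff_pi]; intro k; exact h k

/-- roots depend nicely on coefficients -/
lemma roots_ift {N : ℕ} (p : Fin N → ℝ) (hp : Function.Injective p) :
    map (fun p : Fin N → ℝ => cf N (∏ k, (X - C (p k)))) (𝓝 p) = 𝓝 (cf N (∏ k, (X - C (p k)))) := by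
  refine (ift _ (contDiff_cf (SmoothP.prod _ fun i _ => (SmoothP.const _).sub (SmoothP.C (contDiff_apply ..)))) p (by simp) ?_).1
  intro v hv
  refine roots_inj p v hp fun k hk => hasDerivAt_cf ?_ k hk
  simpa using hv

end
end WS

open Polynomial Filter Topology

namespace WS
noncomputable section

lemma eq_prod_of_roots {K : Type*} [Field K] {N : ℕ} (P : K[X]) (hP : P.Monic) (hd : P.natDegree = N)
    (lam : Fin N → K) (hl : Function.Injective lam) (h : ∀ k, P.eval (lam k) = 0) :
    P = ∏ k, (X - C (lam k)) := by
  have hdvd : ∏ k, (X - C (lam k)) ∣ P := by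
    apply Finset.prod_dvd_of_coprime
    · intro i _ j _ hij
      exact Polynomial.pairwise_coprime_X_sub_C hl hij
    · intro k _
      exact Polynomial.dvd_iff_isRoot.2 (h k)
  refine (Polynomial.eq_of_monic_of_dvd_of_natDegree_le
    (monic_prod_of_monic _ _ fun i _ => monic_X_sub_C _) hP hdvd ?_)
  rw [natDegree_prodX, hd]

lemma charpoly_root_of_mulVec {K : Type*} [Field K] {n : Type*} [Fintype n] [DecidableEq n]
    (M : Matrix n n K) (v : n → K) (hv : v ≠ 0) (μ : K) (h : M.mulVec v = μ • v) :
    M.charpoly.eval μ = 0 := by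
  rw [Matrix.eval_charpoly]
  apply Matrix.exists_mulVec_eq_zero_iff.1
  refine ⟨v, hv, ?_⟩
  rw [Matrix.sub_mulVec, h, sub_eq_zero]
  ext i; simp [Matrix.scalar_apply, Matrix.mulVec_diagonal]

lemma QRel.smul {R : Type*} [CommRing R] {N : ℕ} {q : Fin N → Fin N → R} (hq : QRel q) (ε : R) :
    QRel (fun i j => ε * q i j) where
  anti i j := by rw [hq.anti i j]; ring
  diag i := by rw [hq.diag i]; ring
  quad i j k h1 h2 h3 := by linear_combination ε ^ 2 * hq.quad i j k h1 h2 h3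

lemma QRel_inv {N : ℕ} (a : Fin N → ℝ) (ha : Function.Injective a) :
    QRel (fun i j => (a i - a j)⁻¹) where
  anti i j := by rw [← neg_sub, inv_neg]
  diag i := by simp
  quad i j k h1 h2 h3 := by
    have e1 : a i - a j ≠ 0 := sub_ne_zero.2 (ha.ne h1)
    have e2 : a j - a k ≠ 0 := sub_ne_zero.2 (ha.ne h2)
    have e3 : a k - a i ≠ 0 := sub_ne_zero.2 (ha.ne h3.symm)
    field_simp
    ring

lemma joint_near {N : ℕ} (q : Fin N → Fin N → ℝ) (hq : QRel q) (U : Set (Fin N → ℝ))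
    (hU : U ∈ 𝓝 (fun k : Fin N => ((k : ℕ) : ℝ))) :
    ∀ᶠ x : ℝ × (Fin N → ℝ) in 𝓝 ((0 : ℝ), (fun k : Fin N => ((k : ℕ) : ℝ))),
      ∃ p ∈ U, (Matrix.diagonal p - Matrix.of (fun i j => x.1 * q i j)).charpoly
          = ∏ k, (X - C (x.2 k)) ∧
        ∀ i, (HH (fun i j => x.1 * q i j) x.2 i).charpoly.eval (p i) = 0 := by
  set p0 : Fin N → ℝ := fun k => ((k : ℕ) : ℝ) with hp0
  obtain ⟨r0, hr0, hball⟩ := Metric.mem_nhds_iff.1 hU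
  set r := min r0 (1/4) with hr
  have hrpos : 0 < r := by positivity
  have hr4 : r ≤ 1/4 := min_le_right _ _
  set B := ∑ i, ∑ σ : Equiv.Perm (Fin N),
        (∑ j, q i j * (if σ * Equiv.swap i j = 1 then 1 else 0)) ^ 2 with hB
  have hB0 : 0 ≤ B := by positivity
  set c := ∑ i, ∑ j, |q i j| with hc
  have hc0 : 0 ≤ c := by positivity
  set F : ℝ := (Fintype.card (Equiv.Perm (Fin N)) : ℝ) with hF
  have hF1 : 1 ≤ F := by
    rw [hF]; exact_mod_cast Fintype.card_pos
  have ev1 : ∀ᶠ x : ℝ × (Fin N → ℝ) in 𝓝 ((0 : ℝ), p0), |x.1| * Real.sqrt B < r / 2 := by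
    have : ContinuousAt (fun x : ℝ × (Fin N → ℝ) => |x.1| * Real.sqrt B) ((0:ℝ), p0) := by fun_prop
    exact this.eventually_lt continuousAt_const (by simp; positivity)
  have ev2 : ∀ᶠ x : ℝ × (Fin N → ℝ) in 𝓝 ((0 : ℝ), p0), F * (2 * (|x.1| * c)) < 1 := by
    have : ContinuousAt (fun x : ℝ × (Fin N → ℝ) => F * (2 * (|x.1| * c))) ((0:ℝ), p0) := by fun_prop
    exact this.eventually_lt continuousAt_const (by simp)
  have ev3 : ∀ᶠ x : ℝ × (Fin N → ℝ) in 𝓝 ((0 : ℝ), p0), dist x.2 p0 < r / 2 := by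
    have : ContinuousAt (fun x : ℝ × (Fin N → ℝ) => dist x.2 p0) ((0:ℝ), p0) := by fun_prop
    exact this.eventually_lt continuousAt_const (by simp; positivity)
  filter_upwards [ev1, ev2, ev3] with x hx1 hx2 hx3
  obtain ⟨ε, lam⟩ := x
  simp only at hx1 hx2 hx3 ⊢
  obtain ⟨p, ψ, hψ, heig, hbd⟩ := exists_joint _ (hq.smul ε) lam
  have hbd' : ∑ i, (p i - lam i) ^ 2 ≤ ε ^ 2 * B := by
    refine hbd.trans_eq ?_
    rw [hB, Finset.mul_sum]
    refine Finset.sum_congr rfl fun i _ => ?_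
    rw [Finset.mul_sum]
    refine Finset.sum_congr rfl fun σ _ => ?_
    rw [← mul_pow, Finset.mul_sum]
    simp only [mul_assoc]
  have hpl : ∀ i, |p i - lam i| < r / 2 := by
    intro i
    refine lt_of_le_of_lt ?_ hx1
    have h1 : (p i - lam i) ^ 2 ≤ ε ^ 2 * B :=
      (Finset.single_le_sum (f := fun i => (p i - lam i) ^ 2) (fun i _ => sq_nonneg _) (Finset.mem_univ i)).trans hbd'
    have h2 := Real.sqrt_le_sqrt h1
    rwa [Real.sqrt_sq_eq_abs, Real.sqrt_mul (sq_nonneg _), Real.sqrt_sq_eq_abs] at h2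
  have hl0 : ∀ i, |lam i - (i : ℕ)| < r / 2 := by
    intro i
    have := (dist_le_pi_dist lam p0 i).trans_lt hx3
    rwa [Real.dist_eq] at this
  have hp0' : ∀ i, |p i - (i : ℕ)| < r := by
    intro i
    have := abs_sub_le (p i) (lam i) (i : ℕ)
    linarith [hpl i, hl0 i]
  have hsep : ∀ i j : Fin N, i ≠ j → (1:ℝ) ≤ |((i:ℕ):ℝ) - ((j:ℕ):ℝ)| := by
    intro i j hij
    have : ((i : ℕ) : ℤ) - ((j : ℕ) : ℤ) ≠ 0 := by
      intro h; apply hij; apply Fin.ext; omega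
    have := Int.one_le_abs this
    exact_mod_cast this
  have hlinj : Function.Injective lam := by
    intro i j hij
    by_contra hne
    have h1 := hsep i j hne
    have h2 := hl0 i
    have h3 := hl0 j
    rw [hij] at h2
    rw [abs_sub_lt_iff] at h2 h3
    rcases le_abs.1 h1 with h | h <;> linarith
  -- the maximum of `ψ`
  obtain ⟨σ0, -, hσ0⟩ := Finset.exists_max_image (Finset.univ : Finset (Equiv.Perm (Fin N)))
    (fun σ => |ψ σ|) ⟨1, Finset.mem_univ _⟩
  set m := |ψ σ0| with hm
  have hmpos : 0 < m := by
    obtain ⟨σ, hσ⟩ := Function.ne_iff.1 hψ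
    exact (abs_pos.2 hσ).trans_le (hσ0 σ (Finset.mem_univ _))
  have hsmall : ∀ σ : Equiv.Perm (Fin N), σ ≠ 1 → |ψ σ| ≤ 2 * (|ε| * c) * m := by
    intro σ hσ
    obtain ⟨i, hi⟩ : ∃ i, σ i ≠ i := by
      by_contra hcon; push Not at hcon; exact hσ (Equiv.ext hcon)
    have h1 := congrFun (heig i) σ
    rw [HH_mulVec] at h1
    simp only [Pi.smul_apply, smul_eq_mul] at h1
    have h2 : (p i - lam (σ i)) * ψ σ = ∑ j, ε * q i j * ψ (σ * Equiv.swap i j) := by linarith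
    have h3 : |∑ j, ε * q i j * ψ (σ * Equiv.swap i j)| ≤ |ε| * c * m := by
      refine (Finset.abs_sum_le_sum_abs _ _).trans ?_
      calc ∑ j, |ε * q i j * ψ (σ * Equiv.swap i j)| ≤ ∑ j, |ε| * |q i j| * m := by
            refine Finset.sum_le_sum fun j _ => ?_
            rw [abs_mul, abs_mul]
            exact mul_le_mul_of_nonneg_left (hσ0 _ (Finset.mem_univ _)) (by positivity)
        _ = |ε| * (∑ j, |q i j|) * m := by rw [Finset.mul_sum, Finset.sum_mul]
        _ ≤ |ε| * c * m := by
            gcongr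
            exact Finset.single_le_sum (f := fun i => ∑ j, |q i j|) (fun i _ => by positivity) (Finset.mem_univ i)
    have h4 : (1/2 : ℝ) ≤ |p i - lam (σ i)| := by
      have g1 := hsep (σ i) i hi
      have g2 := hp0' i
      have g3 := hl0 (σ i)
      rw [abs_sub_lt_iff] at g2 g3
      rw [le_abs] at g1 ⊢
      rcases g1 with h | h
      · right; linarith
      · left; linarith
    rw [← h2, abs_mul] at h3
    have : (1/2 : ℝ) * |ψ σ| ≤ |p i - lam (σ i)| * |ψ σ| := by gcongr
    linarith
  have hlt1 : 2 * (|ε| * c) < 1 := by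
    refine lt_of_le_of_lt ?_ hx2
    exact le_mul_of_one_le_left (by positivity) hF1
  have hσ1 : σ0 = 1 := by
    by_contra hne
    have := hsmall σ0 hne
    rw [← hm] at this
    nlinarith
  have hvne : ∀ k : Fin N, (fun i => ∑ σ : Equiv.Perm (Fin N), if σ i = k then ψ σ else 0) ≠ 0 := by
    intro k h0
    have h1 := congrFun h0 k
    simp only [Pi.zero_apply] at h1
    rw [← Finset.add_sum_erase _ _ (Finset.mem_univ (1 : Equiv.Perm (Fin N)))] at h1
    simp only [Equiv.Perm.coe_one, id_eq, if_true] at h1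
    have h2 : |∑ σ ∈ Finset.univ.erase (1 : Equiv.Perm (Fin N)), (if σ k = k then ψ σ else 0)| < m := by
      refine (Finset.abs_sum_le_sum_abs _ _).trans_lt ?_
      calc ∑ σ ∈ Finset.univ.erase (1 : Equiv.Perm (Fin N)), |(if σ k = k then ψ σ else 0)|
          ≤ ∑ σ ∈ Finset.univ.erase (1 : Equiv.Perm (Fin N)), 2 * (|ε| * c) * m := by
            refine Finset.sum_le_sum fun σ hσ => ?_
            split_ifs
            · exact hsmall σ (Finset.ne_of_mem_erase hσ)
            · simp; positivity
        _ ≤ ∑ σ : Equiv.Perm (Fin N), 2 * (|ε| * c) * m :=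
            Finset.sum_le_sum_of_subset_of_nonneg (Finset.erase_subset _ _) (fun _ _ _ => by positivity)
        _ = F * (2 * (|ε| * c)) * m := by
            simp [hF, mul_assoc]
        _ < 1 * m := by gcongr
        _ = m := one_mul m
    rw [← hσ1] at h1
    have h3 : |ψ σ0| < m := by
      rw [eq_neg_of_add_eq_zero_left h1, abs_neg, hσ1]; exact h2
    exact lt_irrefl _ h3
  refine ⟨p, ?_, ?_, ?_⟩
  · apply hball
    rw [Metric.mem_ball, dist_pi_lt_iff hr0]
    intro i
    rw [Real.dist_eq]
    exact (hp0' i).trans_le (min_le_left _ _)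
  · apply eq_prod_of_roots _ (Matrix.charpoly_monic _) (by rw [Matrix.charpoly_natDegree_eq_dim]; simp) _ hlinj
    intro k
    exact charpoly_root_of_mulVec _ _ (hvne k) _ (joint_to_CM _ lam p ψ heig k)
  · intro i
    exact charpoly_root_of_mulVec _ ψ hψ _ (heig i)

/-- Every real `(ε, p)` close to `(0, p⁰)` satisfies the spectral relation. -/
lemma box_near {N : ℕ} (q : Fin N → Fin N → ℝ) (hq : QRel q) :
    ∀ᶠ x : ℝ × (Fin N → ℝ) in 𝓝 ((0 : ℝ), (fun k : Fin N => ((k : ℕ) : ℝ))),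
      ∃ lam : Fin N → ℝ, (Matrix.diagonal x.2 - Matrix.of (fun i j => x.1 * q i j)).charpoly
          = ∏ k, (X - C (lam k)) ∧
        ∀ i, (HH (fun i j => x.1 * q i j) lam i).charpoly.eval (x.2 i) = 0 := by
  set p0 : Fin N → ℝ := fun k => ((k : ℕ) : ℝ) with hp0
  have hp0i : Function.Injective p0 := by
    intro i j h; simp only [hp0, Nat.cast_inj] at h; exact Fin.ext h
  set Mx : ℝ × (Fin N → ℝ) → Matrix (Fin N) (Fin N) ℝ :=
    fun x => Matrix.diagonal x.2 - Matrix.of (fun i j => x.1 * q i j) with hMx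
  set Θ : ℝ × (Fin N → ℝ) → ℝ × (Fin N → ℝ) := fun x => (x.1, cf N (Mx x).charpoly) with hΘ
  set Θ0 : ℝ × (Fin N → ℝ) → ℝ × (Fin N → ℝ) := fun x => (x.1, cf N (∏ k, (X - C (x.2 k)))) with hΘ0
  have hdiag : ∀ v : Fin N → ℝ, (Matrix.diagonal v).charpoly = ∏ k, (X - C (v k)) := by
    intro v; exact Matrix.charpoly_diagonal v
  have hΘs : ContDiff ℝ 1 Θ := by
    refine contDiff_fst.prodMk (contDiff_cf (SmoothP.charpoly ?_))
    intro i j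
    simp only [hMx, Matrix.sub_apply, Matrix.diagonal_apply, Matrix.of_apply]
    split_ifs <;> fun_prop
  have hΘ0s : ContDiff ℝ 1 Θ0 := by
    refine contDiff_fst.prodMk (contDiff_cf (SmoothP.prod _ fun i _ => (SmoothP.const _).sub (SmoothP.C ?_)))
    fun_prop
  have hinj0 : ∀ v, HasDerivAt (fun s : ℝ => Θ0 (((0 : ℝ), p0) + s • v)) 0 0 → v = 0 := by
    rintro ⟨e, v⟩ hv
    have h1 : HasDerivAt (fun s : ℝ => (Θ0 (((0 : ℝ), p0) + s • (e, v))).1) 0 0 := hv.fst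
    have h2 : HasDerivAt (fun s : ℝ => (Θ0 (((0 : ℝ), p0) + s • (e, v))).2) 0 0 := hv.snd
    have he : e = 0 := by
      have : HasDerivAt (fun s : ℝ => (Θ0 (((0 : ℝ), p0) + s • (e, v))).1) e 0 := by
        simpa [hΘ0] using (hasDerivAt_id (0:ℝ)).mul_const e
      exact this.unique h1
    have hv0 : v = 0 := by
      refine roots_inj p0 v hp0i fun k hk => hasDerivAt_cf ?_ k hk
      simpa [hΘ0] using h2
    rw [he, hv0]; rfl
  have hinj : ∀ v, HasDerivAt (fun s : ℝ => Θ (((0 : ℝ), p0) + s • v)) 0 0 → v = 0 := by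
    rintro ⟨e, v⟩ hv
    have h1 : HasDerivAt (fun s : ℝ => (Θ (((0 : ℝ), p0) + s • (e, v))).1) 0 0 := hv.fst
    have he : e = 0 := by
      have : HasDerivAt (fun s : ℝ => (Θ (((0 : ℝ), p0) + s • (e, v))).1) e 0 := by
        simpa [hΘ] using (hasDerivAt_id (0:ℝ)).mul_const e
      exact this.unique h1
    subst he
    apply hinj0
    convert hv using 2 with s
    simp only [hΘ0, hΘ, hMx]
    have : (Matrix.of fun i j => (((0:ℝ), p0) + s • ((0:ℝ), v)).1 * q i j) = 0 := by
      ext i j; simp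
    rw [this, sub_zero, hdiag]
  obtain ⟨-, U, hU, hUinj⟩ := ift Θ hΘs (0, p0) rfl hinj
  obtain ⟨hmap0, -⟩ := ift Θ0 hΘ0s (0, p0) rfl hinj0
  have hΘeq : Θ (0, p0) = Θ0 (0, p0) := by
    simp only [hΘ0, hΘ, hMx]
    have : (Matrix.of fun i j => (0:ℝ) * q i j) = 0 := by
      ext i j; simp
    rw [this, sub_zero, hdiag]
  -- neighbourhood in product form
  obtain ⟨U1, hU1, U2, hU2, hUU⟩ := mem_nhds_prod_iff.1 hU
  have hjn := joint_near q hq U2 hU2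
  have hU1' : ∀ᶠ x : ℝ × (Fin N → ℝ) in 𝓝 ((0 : ℝ), p0), x.1 ∈ U1 :=
    (continuous_fst.tendsto ((0 : ℝ), p0)).eventually hU1
  have hev := hjn.and hU1'
  -- push forward under Θ0
  have h3 : ∀ᶠ y in 𝓝 (Θ0 (0, p0)), ∃ x, Θ0 x = y ∧ ((∃ p ∈ U2, (Matrix.diagonal p - Matrix.of (fun i j => x.1 * q i j)).charpoly
          = ∏ k, (X - C (x.2 k)) ∧
        ∀ i, (HH (fun i j => x.1 * q i j) x.2 i).charpoly.eval (p i) = 0) ∧ x.1 ∈ U1) := by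
    rw [← hmap0, eventually_map]
    filter_upwards [hev] with x hx
    exact ⟨x, rfl, hx⟩
  rw [← hΘeq] at h3
  have h4 := hΘs.continuous.continuousAt.eventually h3
  filter_upwards [h4, hU] with x hx hxU
  obtain ⟨⟨ε, lam⟩, hy1, ⟨p, hp, hch, hroot⟩, hε⟩ := hx
  obtain ⟨ε', p'⟩ := x
  simp only at hch hroot hε
  have hee : ε = ε' := congrArg Prod.fst hy1
  subst hee
  have hmem : ((ε, p) : ℝ × (Fin N → ℝ)) ∈ U := hUU ⟨hε, hp⟩
  have : ((ε, p') : ℝ × (Fin N → ℝ)) = (ε, p) := by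
    apply hUinj hxU hmem
    rw [← hy1]
    simp only [hΘ0, hΘ, hMx, hch]
  have hpp : p' = p := congrArg Prod.snd this
  subst hpp
  exact ⟨lam, hch, hroot⟩

lemma HH_smul_charpoly {K : Type*} [Field K] {N : ℕ} (q : Fin N → Fin N → K) (ε : K) (hε : ε ≠ 0)
    (i : Fin N) (t : K) (h : (HH (fun i j => ε * q i j) (fun _ => 0) i).charpoly.eval (ε * t) = 0) :
    (HH q (fun _ => 0) i).charpoly.eval t = 0 := by
  rw [Matrix.eval_charpoly] at *
  have : Matrix.scalar (Equiv.Perm (Fin N)) (ε * t) - HH (fun i j => ε * q i j) (fun _ => 0) i =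
      ε • (Matrix.scalar (Equiv.Perm (Fin N)) t - HH q (fun _ => 0) i) := by
    ext σ τ
    simp only [Matrix.sub_apply, Matrix.smul_apply, smul_eq_mul, Matrix.scalar_apply, Matrix.diagonal_apply, HH,
      Matrix.of_apply, mul_sub, Finset.mul_sum, ite_self, zero_add, mul_ite, mul_zero]
  rw [this, Matrix.det_smul] at h
  exact (mul_eq_zero.1 h).resolve_left (pow_ne_zero _ hε)

theorem thmR {N : ℕ} (a : Fin N → ℝ) (ha : Function.Injective a) (K : Type) [Field K] [Algebra ℝ K]
    (p : Fin N → K)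
    (h : (Matrix.diagonal p - Matrix.of (fun i j => algebraMap ℝ K ((a i - a j)⁻¹))).charpoly = X ^ N)
    (i : Fin N) :
    ((HH (fun i j => (a i - a j)⁻¹) (fun _ => (0 : ℝ)) i).charpoly.map (algebraMap ℝ K)).eval (p i) = 0 := by
  set q : Fin N → Fin N → ℝ := fun i j => (a i - a j)⁻¹ with hq
  have hQ : QRel q := QRel_inv a ha
  have hb := box_near q hQ
  rw [nhds_prod_eq] at hb
  obtain ⟨P1, hP1, P2, hP2, hP⟩ := eventually_prod_iff.1 hb
  obtain ⟨ε, hεpos, hε⟩ : ∃ ε : ℝ, 0 < ε ∧ P1 ε := by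
    obtain ⟨r, hr, hb⟩ := Metric.eventually_nhds_iff.1 hP1
    refine ⟨r / 2, by positivity, hb ?_⟩
    rw [Real.dist_eq, sub_zero, abs_of_pos (by positivity)]; linarith
  obtain ⟨Φ, hΦ⟩ := exists_Phi (fun i j => ε * q i j) i
  have hΦ0 : Φ = 0 := by
    obtain ⟨r, hr, hb⟩ := Metric.eventually_nhds_iff.1 hP2
    apply MvPolynomial.funext_set (fun k : Fin N => Metric.ball ((k : ℕ) : ℝ) r)
    · intro k
      rw [Real.ball_eq_Ioo]
      exact Set.Ioo_infinite (by linarith)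
    · intro x hx
      have hx2 : P2 x := by
        apply hb
        rw [dist_pi_lt_iff hr]
        intro k
        exact hx k (Set.mem_univ _)
      obtain ⟨lam, h1, h2⟩ := hP hε hx2
      have := hΦ ℝ x lam h1
      simp only [Algebra.algebraMap_self, RingHom.id_apply] at this
      rw [map_zero, ← MvPolynomial.coe_aeval_eq_eval]
      exact this.trans (h2 i)
  have hε' : algebraMap ℝ K ε ≠ 0 := by
    rw [Ne, map_eq_zero]; exact hεpos.ne'
  have hch : (Matrix.diagonal (fun k => algebraMap ℝ K ε * p k) -
      Matrix.of (fun i j => algebraMap ℝ K (ε * q i j))).charpoly = ∏ k : Fin N, (X - C ((fun _ => (0 : K)) k)) := by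
    simp only [C_0, sub_zero, Finset.prod_const, Finset.card_univ, Fintype.card_fin]
    have e1 : (Matrix.diagonal (fun k => algebraMap ℝ K ε * p k) -
      Matrix.of (fun i j => algebraMap ℝ K (ε * q i j))) = algebraMap ℝ K ε •
        (Matrix.diagonal p - Matrix.of (fun i j => algebraMap ℝ K ((a i - a j)⁻¹))) := by
      ext k l
      simp only [Matrix.sub_apply, Matrix.smul_apply, Matrix.diagonal_apply, Matrix.of_apply, hq, map_mul,
        smul_eq_mul, mul_sub, mul_ite, mul_zero]
    rw [e1]
    have hnil : IsNilpotent (Matrix.diagonal p - Matrix.of (fun i j => algebraMap ℝ K ((a i - a j)⁻¹))) := by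
      refine ⟨N, ?_⟩
      have := Matrix.aeval_self_charpoly (Matrix.diagonal p - Matrix.of (fun i j => algebraMap ℝ K ((a i - a j)⁻¹)))
      rw [h] at this
      simpa using this
    have hnil2 : IsNilpotent (algebraMap ℝ K ε •
        (Matrix.diagonal p - Matrix.of (fun i j => algebraMap ℝ K ((a i - a j)⁻¹)))) := hnil.smul _
    have := Matrix.isNilpotent_charpoly_sub_pow_of_isNilpotent hnil2
    rw [isNilpotent_iff_eq_zero, sub_eq_zero] at this
    simpa using this
  have h1 := hΦ K _ _ hch
  rw [hΦ0, map_zero] at h1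
  have h2 := HH_smul_charpoly (fun i j => algebraMap ℝ K (q i j)) _ hε' i (p i) (by
    simpa only [map_mul] using h1.symm)
  have h3 := HH_map (algebraMap ℝ K) q (fun _ => 0) i
  rw [← Matrix.charpoly_map, h3]
  simpa using h2

end
end WS

open Polynomial Filter Topology

namespace WS
noncomputable section

/-! ## Part 2 : Wronskians -/

def wr {K : Type*} [CommRing K] {d : ℕ} (f : Fin d → K[X]) : K[X] :=
  Matrix.det (Matrix.of fun i j : Fin d => derivative^[(j : ℕ)] (f i))

/-- `0 + 1 + ... + (d-1)` -/
def tri (d : ℕ) : ℕ := ∑ j : Fin d, (j : ℕ)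

section basics
set_option linter.unusedSectionVars false
variable {K : Type*} [Field K] [CharZero K]

lemma wr_mul {d : ℕ} (A : Matrix (Fin d) (Fin d) K) (f : Fin d → K[X]) :
    wr (fun i => ∑ k, C (A i k) * f k) = C A.det * wr f := by
  have : (Matrix.of fun i j : Fin d => derivative^[(j : ℕ)] (∑ k, C (A i k) * f k)) =
      (A.map C) * (Matrix.of fun i j : Fin d => derivative^[(j : ℕ)] (f i)) := by
    ext1 i j
    simp only [Matrix.of_apply, Matrix.mul_apply, Matrix.map_apply, iterate_derivative_sum,
      iterate_derivative_C_mul]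
  rw [wr, this, Matrix.det_mul]
  congr 1
  exact (RingHom.map_det C A).symm

lemma X_pow_mul_iterate (f : K[X]) (D : ℕ) (hf : f.natDegree < D) (j : ℕ) :
    X ^ j * derivative^[j] f = ∑ k : Fin D, C (f.coeff k) * X ^ (k : ℕ) * C ((Nat.descFactorial k j : ℕ) : K) := by
  conv_lhs => rw [f.as_sum_range' D hf]
  rw [iterate_derivative_sum, Finset.mul_sum, ← Fin.sum_univ_eq_sum_range
    (fun k => X ^ j * derivative^[j] ((monomial k) (f.coeff k)))]
  refine Finset.sum_congr rfl fun k _ => ?_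
  rw [← C_mul_X_pow_eq_monomial, iterate_derivative_C_mul, iterate_derivative_X_pow_eq_C_mul]
  by_cases h : j ≤ (k : ℕ)
  · have : (X : K[X]) ^ (k : ℕ) = X ^ j * X ^ ((k : ℕ) - j) := by rw [← pow_add]; congr 1; omega
    rw [this]; ring
  · rw [Nat.descFactorial_eq_zero_iff_lt.2 (by omega)]; simp

lemma det_descFactorial {d : ℕ} (r : Fin d → ℕ) :
    (Matrix.of fun i j : Fin d => ((Nat.descFactorial (r i) j : ℕ) : K)).det =
      (Matrix.vandermonde (fun i => (r i : K))).det := by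
  rw [Matrix.det_eval_matrixOfPolynomials_eq_det_vandermonde (fun i ↦ (r i : K))
      (fun i => descPochhammer K i) (fun i => descPochhammer_natDegree K i)
      (fun i => monic_descPochhammer K i)]
  simp only [descPochhammer_eval_eq_descFactorial]

lemma X_pow_mul_wr {d : ℕ} (f : Fin d → K[X]) (D : ℕ) (hf : ∀ i, (f i).natDegree < D) :
    X ^ tri d * wr f = ∑ r : Fin d → Fin D,
      C ((Matrix.vandermonde (fun i => ((r i : ℕ) : K))).det * ∏ i, (f i).coeff (r i)) * X ^ (∑ i, (r i : ℕ)) := by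
  rw [tri, ← Finset.prod_pow_eq_pow_sum, wr, ← Matrix.det_mul_row]
  have h1 : (Matrix.of fun i j : Fin d => (X : K[X]) ^ (j : ℕ) * (Matrix.of fun i j : Fin d => derivative^[(j : ℕ)] (f i)) i j)
     = fun i => ∑ k : Fin D, (C ((f i).coeff k) * X ^ (k : ℕ)) • (fun j : Fin d => (C ((Nat.descFactorial k j : ℕ) : K) : K[X])) := by
    refine funext fun i => funext fun j => ?_
    simp only [Matrix.of_apply, Finset.sum_apply, Pi.smul_apply, smul_eq_mul]
    exact X_pow_mul_iterate _ _ (hf i) _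
  rw [h1]
  have h2 := MultilinearMap.map_sum (Matrix.detRowAlternating (R := K[X]) (n := Fin d)).toMultilinearMap
    (fun (i : Fin d) (k : Fin D) => (C ((f i).coeff k) * X ^ (k : ℕ)) • (fun j : Fin d => (C ((Nat.descFactorial k j : ℕ) : K) : K[X])))
  refine Eq.trans h2 ?_
  refine Finset.sum_congr rfl fun r _ => ?_
  have h3 := MultilinearMap.map_smul_univ (Matrix.detRowAlternating (R := K[X]) (n := Fin d)).toMultilinearMap
    (fun i => (C ((f i).coeff (r i)) * X ^ ((r i : ℕ)) : K[X])) (fun i => (fun j : Fin d => (C ((Nat.descFactorial (r i) j : ℕ) : K) : K[X])))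
  refine Eq.trans h3 ?_
  have h4 : (Matrix.detRowAlternating (R := K[X]) (n := Fin d)).toMultilinearMap (fun i => (fun j : Fin d => (C ((Nat.descFactorial (r i) j : ℕ) : K) : K[X])))
     = C ((Matrix.vandermonde (fun i => ((r i : ℕ) : K))).det) := by
    rw [← det_descFactorial]
    exact (RingHom.map_det C _).symm
  rw [h4, Finset.prod_mul_distrib, Finset.prod_pow_eq_pow_sum, smul_eq_mul, C_mul, map_prod]
  ring

lemma wr_coeff {d : ℕ} (f : Fin d → K[X]) (D : ℕ) (hf : ∀ i, (f i).natDegree < D) (m : ℕ) :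
    (wr f).coeff m = ∑ r : Fin d → Fin D, if ∑ i, (r i : ℕ) = m + tri d then
      (Matrix.vandermonde (fun i => ((r i : ℕ) : K))).det * ∏ i, (f i).coeff (r i) else 0 := by
  have h1 := congrArg (fun P : K[X] => P.coeff (m + tri d)) (X_pow_mul_wr f D hf)
  simp only [mul_comm (X ^ tri d), coeff_mul_X_pow, finsetSum_coeff, coeff_C_mul, coeff_X_pow] at h1
  rw [h1]
  refine Finset.sum_congr rfl fun r _ => ?_
  simp [eq_comm]

lemma exists_bound {d : ℕ} (f : Fin d → K[X]) : ∃ D, ∀ i, (f i).natDegree < D :=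
  ⟨(Finset.univ.sup fun i => (f i).natDegree) + 1, fun i =>
    Nat.lt_succ_of_le (Finset.le_sup (f := fun i => (f i).natDegree) (Finset.mem_univ i))⟩

lemma wr_supp {d : ℕ} (f : Fin d → K[X]) (m : ℕ) (h : (wr f).coeff m ≠ 0) :
    ∃ k : Fin d → ℕ, Function.Injective k ∧ (∀ i, (f i).coeff (k i) ≠ 0) ∧ ∑ i, k i = m + tri d := by
  obtain ⟨D, hD⟩ := exists_bound f
  rw [wr_coeff f D hD] at h
  obtain ⟨r, -, hr⟩ := Finset.exists_ne_zero_of_sum_ne_zero h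
  split_ifs at hr with h1
  · have hr1 := left_ne_zero_of_mul hr
    have hr2 := right_ne_zero_of_mul hr
    rw [Matrix.det_vandermonde_ne_zero_iff] at hr1
    refine ⟨fun i => r i, ?_, ?_, h1⟩
    · intro i j hij; exact hr1 (by simpa using hij)
    · intro i; exact (Finset.prod_ne_zero_iff.1 hr2) i (Finset.mem_univ i)
  · exact absurd rfl hr

lemma wr_lead {d : ℕ} (f : Fin d → K[X]) (l : Fin d → ℕ) (hf : ∀ i, (f i).natDegree ≤ l i) (m : ℕ)
    (hm : ∑ i, l i = m + tri d) :
    (wr f).coeff m = (Matrix.vandermonde (fun i => (l i : K))).det * ∏ i, (f i).coeff (l i) := by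
  set D := (Finset.univ.sup l) + 1 with hD
  have hl : ∀ i, l i < D := fun i => Nat.lt_succ_of_le (Finset.le_sup (f := l) (Finset.mem_univ i))
  rw [wr_coeff f D (fun i => (hf i).trans_lt (hl i)), Finset.sum_eq_single (fun i => ⟨l i, hl i⟩)]
  · simp [hm]
  · intro r _ hr
    split_ifs with h1
    · by_cases h2 : ∃ i, l i < r i
      · obtain ⟨i, hi⟩ := h2
        rw [Finset.prod_eq_zero (Finset.mem_univ i), mul_zero]
        exact coeff_eq_zero_of_natDegree_lt ((hf i).trans_lt hi)
      · push Not at h2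
        exfalso
        apply hr
        ext i
        by_contra hne
        have : ∑ i, (r i : ℕ) < ∑ i, l i :=
          Finset.sum_lt_sum (fun i _ => h2 i) ⟨i, Finset.mem_univ _, lt_of_le_of_ne (h2 i) hne⟩
        omega
    · rfl
  · simp

lemma vander_ne {d : ℕ} (l : Fin d → ℕ) (hl : Function.Injective l) :
    (Matrix.vandermonde (fun i => (l i : K))).det ≠ 0 := by
  rw [Matrix.det_vandermonde_ne_zero_iff]
  intro i j h; exact hl (by simpa using h)

lemma wr_natDegree_le {d : ℕ} (f : Fin d → K[X]) (l : Fin d → ℕ) (hf : ∀ i, (f i).natDegree ≤ l i) :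
    ∀ m, (wr f).coeff m ≠ 0 → m + tri d ≤ ∑ i, l i := by
  intro m hm
  obtain ⟨k, -, hk, hs⟩ := wr_supp f m hm
  rw [← hs]
  exact Finset.sum_le_sum fun i _ => (le_natDegree_of_ne_zero (hk i)).trans (hf i)

/-- an injective exponent sequence has big sum -/
lemma tri_le_sum {d : ℕ} (l : Fin d → ℕ) (hl : Function.Injective l) : tri d ≤ ∑ i, l i := by
  have hl' : Function.Injective (fun i => (l i : ℤ)) := fun i j h => hl (by simpa using h)
  have h2 := Finset.sum_range_le_sum (s := Finset.univ.map ⟨fun i => (l i : ℤ), hl'⟩) (c := 0)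
    (by simp)
  simp only [Finset.card_map, Finset.card_univ, Fintype.card_fin, zero_add, Finset.sum_map,
    Function.Embedding.coeFn_mk] at h2
  rw [tri, Fin.sum_univ_eq_sum_range (fun j => j)]
  have h3 : ((∑ i ∈ Finset.range d, i : ℕ) : ℤ) ≤ ((∑ i, l i : ℕ) : ℤ) := by
    push_cast; exact h2
  exact Int.ofNat_le.1 h3

end basics
end
end WS

open Polynomial Filter Topology

namespace WS
noncomputable section
section cofs
set_option linter.unusedSectionVars false
variable {K : Type*} [Field K] [CharZero K]

/-- Coefficients of the differential operator `g ↦ wr (f, g)`. -/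
def cof {d : ℕ} (f : Fin d → K[X]) (j : ℕ) : K[X] :=
  (-1) ^ (d + j) * Matrix.det (Matrix.of fun i k : Fin d =>
    derivative^[if (k : ℕ) < j then (k : ℕ) else k + 1] (f i))

lemma wr_snoc {d : ℕ} (f : Fin d → K[X]) (g : K[X]) :
    wr (Fin.snoc f g : Fin (d + 1) → K[X]) = ∑ j ∈ Finset.range (d + 1), derivative^[j] g * cof f j := by
  rw [wr, Matrix.det_succ_row _ (Fin.last d), ← Fin.sum_univ_eq_sum_range
    (fun j => derivative^[j] g * cof f j)]
  refine Finset.sum_congr rfl fun j _ => ?_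
  simp only [Matrix.of_apply, Fin.snoc_last, Fin.val_last, cof]
  have : ((Matrix.of fun i j : Fin (d+1) => derivative^[(j : ℕ)] ((Fin.snoc f g : Fin (d + 1) → K[X]) i)).submatrix
      (Fin.last d).succAbove j.succAbove) = Matrix.of fun i k : Fin d =>
    derivative^[if (k : ℕ) < j then (k : ℕ) else k + 1] (f i) := by
    ext1 i k
    simp only [Matrix.submatrix_apply, Matrix.of_apply, Fin.succAbove_last, Fin.snoc_castSucc]
    congr 2
    simp only [Fin.succAbove, Fin.lt_def, Fin.val_castSucc]
    split_ifs <;> simp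
  rw [this]; ring

lemma cof_self {d : ℕ} (f : Fin d → K[X]) : cof f d = wr f := by
  simp [cof, wr, ← two_mul]

lemma derivative_det' {d : ℕ} (M : Matrix (Fin d) (Fin d) K[X]) :
    derivative M.det = ∑ c, (M.updateCol c (fun i => derivative (M i c))).det := by
  simp only [Matrix.det_apply, derivative_sum]
  rw [Finset.sum_comm]
  refine Finset.sum_congr rfl fun σ _ => ?_
  rw [derivative_smul, derivative_prod_finset, Finset.smul_sum]
  refine Finset.sum_congr rfl fun c _ => ?_
  congr 1
  rw [← Finset.mul_prod_erase _ _ (Finset.mem_univ c), mul_comm]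
  congr 1
  · simp
  · refine Finset.prod_congr rfl fun i hi => ?_
    rw [Matrix.updateCol_ne (Finset.ne_of_mem_erase hi)]

lemma cof_pred {e : ℕ} (f : Fin (e + 1) → K[X]) : cof f e = - derivative (wr f) := by
  rw [wr, derivative_det', Finset.sum_eq_single (Fin.last e)]
  · have h : ((-1 : K[X]) ^ (e + 1 + e)) = -1 := by
      rw [show e + 1 + e = 2 * e + 1 by ring, pow_succ, pow_mul]; simp
    rw [cof, h, neg_one_mul]
    congr 2
    ext1 i k
    simp only [Matrix.of_apply]
    by_cases hk : k = Fin.last e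
    · subst hk
      simp [Function.iterate_succ_apply']
    · rw [Matrix.updateCol_ne hk, Matrix.of_apply, if_pos]
      exact Fin.val_lt_last hk
  · intro c _ hc
    have hlt : (c : ℕ) < e := Fin.val_lt_last hc
    refine Matrix.det_zero_of_column_eq (i := c) (j := ⟨c + 1, by omega⟩) ?_ ?_
    · intro h; simp [Fin.ext_iff] at h
    · intro i
      rw [Matrix.updateCol_self, Matrix.updateCol_ne]
      · simp [Function.iterate_succ_apply']
      · intro h; simp [Fin.ext_iff] at h
  · simp

lemma det_deriv_degree {d : ℕ} (f : Fin d → K[X]) (l : Fin d → ℕ) (hf : ∀ i, (f i).natDegree ≤ l i)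
    (e : Fin d → ℕ) (m : ℕ) (h : (Matrix.det (Matrix.of fun i k : Fin d => derivative^[e k] (f i))).coeff m ≠ 0) :
    m + ∑ k, e k ≤ ∑ i, l i := by
  rw [Matrix.det_apply, finsetSum_coeff] at h
  obtain ⟨σ, -, hσ⟩ := Finset.exists_ne_zero_of_sum_ne_zero h
  have h1 : (∏ i, derivative^[e i] (f (σ i))).coeff m ≠ 0 := by
    intro h0; apply hσ; simp [Units.smul_def, h0]
  have h2 : ∏ i, derivative^[e i] (f (σ i)) ≠ 0 := by
    intro h0; rw [h0] at h1; simp at h1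
  have h3 := le_natDegree_of_ne_zero h1
  rw [natDegree_prod _ _ (fun i _ => (Finset.prod_ne_zero_iff.1 h2) i (Finset.mem_univ i))] at h3
  rw [← Equiv.sum_comp σ l]
  calc m + ∑ k, e k ≤ ∑ i, (derivative^[e i] (f (σ i))).natDegree + ∑ k, e k := by omega
    _ = ∑ i, ((derivative^[e i] (f (σ i))).natDegree + e i) := by rw [Finset.sum_add_distrib]
    _ ≤ _ := by
      refine Finset.sum_le_sum fun i _ => ?_
      have h4 := (Finset.prod_ne_zero_iff.1 h2) i (Finset.mem_univ i)
      have h5 : e i ≤ (f (σ i)).natDegree := by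
        by_contra hc
        exact h4 (iterate_derivative_eq_zero (by omega))
      have h6 := natDegree_iterate_derivative (f (σ i)) (e i)
      have := hf (σ i)
      omega

lemma cof_degree {d N : ℕ} (f : Fin d → K[X]) (l : Fin d → ℕ) (hf : ∀ i, (f i).natDegree ≤ l i)
    (hN : ∑ i, l i = N + tri d) (j : ℕ) (hj : j < d) : (cof f j).degree < N := by
  rw [degree_lt_iff_coeff_zero]
  intro m hm
  by_contra hne
  have h1 : (Matrix.det (Matrix.of fun i k : Fin d =>
    derivative^[if (k : ℕ) < j then (k : ℕ) else k + 1] (f i))).coeff m ≠ 0 := by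
    intro h0; apply hne
    rw [cof, show ((-1 : K[X]) ^ (d + j)) = C ((-1) ^ (d + j)) by simp, coeff_C_mul, h0, mul_zero]
  have h2 := det_deriv_degree f l hf (fun k => if (k : ℕ) < j then (k : ℕ) else k + 1) m h1
  have h3 : tri d < ∑ k : Fin d, (if (k : ℕ) < j then (k : ℕ) else k + 1) := by
    refine Finset.sum_lt_sum (fun k _ => by split_ifs <;> omega) ⟨⟨j, hj⟩, Finset.mem_univ _, by simp⟩
  omega

lemma cof_kill {d : ℕ} (f : Fin d → K[X]) (t : Fin d) :
    ∑ j ∈ Finset.range (d + 1), derivative^[j] (f t) * cof f j = 0 := by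
  rw [← wr_snoc, wr]
  refine Matrix.det_zero_of_row_eq (i := t.castSucc) (j := Fin.last d) ?_ ?_
  · exact (Fin.castSucc_lt_last t).ne
  · ext1 j
    simp

lemma cof_kill' {d : ℕ} (f : Fin d → K[X]) (t : Fin d) :
    ∑ j ∈ Finset.range d, cof f j * derivative^[j] (f t) + wr f * derivative^[d] (f t) = 0 := by
  have := cof_kill f t
  rw [Finset.sum_range_succ, cof_self] at this
  rw [← this]
  congr 1
  · exact Finset.sum_congr rfl fun _ _ => mul_comm _ _
  · ring

/-- kernel lemma -/
lemma ker_lem {e : ℕ} (f : Fin (e + 1) → K[X]) (x : K) (hx : (derivative (wr f)).eval x ≠ 0)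
    (v : ℕ → K) (hv : v e = 0) (h : ∀ t, ∑ j ∈ Finset.range (e + 1), v j * (derivative^[j] (f t)).eval x = 0) :
    ∀ j ≤ e, v j = 0 := by
  have h1 : (Matrix.of fun i k : Fin (e + 1) =>
    (derivative^[if (k : ℕ) < e then (k : ℕ) else k + 1] (f i)).eval x).det ≠ 0 := by
    have h2 := congrArg (eval x) (cof_pred f)
    rw [cof, eval_mul, eval_neg] at h2
    intro h0
    have h3 : eval x (Matrix.of fun i k : Fin (e + 1) =>
        derivative^[if (k : ℕ) < e then (k : ℕ) else k + 1] (f i)).det = 0 := by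
      rw [← h0]
      exact RingHom.map_det (evalRingHom x) _
    rw [h3, mul_zero] at h2
    exact hx (by simpa using h2.symm)
  have h4 := Matrix.eq_zero_of_mulVec_eq_zero (v := fun k : Fin (e + 1) => v k) h1 (by
    ext t
    simp only [Matrix.mulVec, dotProduct, Matrix.of_apply, Pi.zero_apply]
    rw [← h t, ← Fin.sum_univ_eq_sum_range (fun j => v j * (derivative^[j] (f t)).eval x)]
    refine Finset.sum_congr rfl fun k _ => ?_
    by_cases hk : k = Fin.last e
    · subst hk; simp [hv]
    · rw [if_pos (Fin.val_lt_last hk), mul_comm])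
  intro j hj
  exact congrFun h4 ⟨j, by omega⟩

end cofs
end
end WS

open Polynomial Filter Topology
open scoped Matrix

namespace WS
noncomputable section
section link
set_option linter.unusedSectionVars false
variable {K : Type*} [Field K] [CharZero K]

lemma degree_C_mul_le' (c : K) (p : K[X]) : (C c * p).degree ≤ p.degree := by
  rw [← smul_eq_C_mul]; exact degree_smul_le c p

def ww {N : ℕ} (a : Fin N → K) (i : Fin N) : K[X] := ∏ l ∈ Finset.univ.erase i, (X - C (a l))

lemma ww_eval_ne {N : ℕ} (a : Fin N → K) {i l : Fin N} (h : l ≠ i) : (ww a l).eval (a i) = 0 := by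
  rw [ww, eval_prod]
  exact Finset.prod_eq_zero (Finset.mem_erase.2 ⟨h.symm, Finset.mem_univ i⟩) (by simp)

lemma ww_eval_self {N : ℕ} (a : Fin N → K) (ha : Function.Injective a) (i : Fin N) :
    (ww a i).eval (a i) ≠ 0 := by
  rw [ww, eval_prod, Finset.prod_ne_zero_iff]
  intro l hl
  simp only [eval_sub, eval_X, eval_C]
  exact sub_ne_zero.2 fun h => (Finset.ne_of_mem_erase hl) (ha h).symm

lemma mul_ww {N : ℕ} (a : Fin N → K) (i : Fin N) : (X - C (a i)) * ww a i = ∏ l, (X - C (a l)) :=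
  Finset.mul_prod_erase _ (fun l => X - C (a l)) (Finset.mem_univ i)

lemma deriv_prod_eval {N : ℕ} (a : Fin N → K) (i : Fin N) :
    (derivative (∏ l, (X - C (a l)))).eval (a i) = (ww a i).eval (a i) := by
  rw [← mul_ww a i, derivative_mul]; simp

lemma ww_deriv {N : ℕ} (a : Fin N → K) (ha : Function.Injective a) {i l : Fin N} (h : l ≠ i) :
    (derivative (ww a l)).eval (a i) = (ww a i).eval (a i) * (a i - a l)⁻¹ := by
  have h1 : ww a l = (X - C (a i)) * ∏ m ∈ (Finset.univ.erase l).erase i, (X - C (a m)) :=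
    (Finset.mul_prod_erase _ (fun l => X - C (a l)) (Finset.mem_erase.2 ⟨h.symm, Finset.mem_univ i⟩)).symm
  have h2 : ww a i = (X - C (a l)) * ∏ m ∈ (Finset.univ.erase i).erase l, (X - C (a m)) :=
    (Finset.mul_prod_erase _ (fun l => X - C (a l)) (Finset.mem_erase.2 ⟨h, Finset.mem_univ l⟩)).symm
  have h3 : a i - a l ≠ 0 := sub_ne_zero.2 fun h' => h (ha h').symm
  rw [h1, h2, derivative_mul, Finset.erase_right_comm]
  simp only [derivative_sub, derivative_X, derivative_C, sub_zero, one_mul, eval_add, eval_mul, eval_sub,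
    eval_X, eval_C, sub_self, zero_mul, add_zero]
  field_simp

lemma lagr {N : ℕ} (a : Fin N → K) (ha : Function.Injective a) (P : K[X]) (hP : P.degree < N) :
    P = ∑ i, C (P.eval (a i) / (ww a i).eval (a i)) * ww a i := by
  refine eq_of_degrees_lt_of_eval_index_eq (s := Finset.univ) (v := a) (Set.injOn_of_injective ha)
    (by simpa using hP) ?_ ?_
  · rw [Finset.card_univ, Fintype.card_fin]
    refine (degree_sum_le _ _).trans_lt ?_
    rw [Finset.sup_lt_iff (by exact WithBot.bot_lt_coe N)]
    intro i _
    refine (degree_C_mul_le' _ _).trans_lt ?_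
    rw [ww, degree_prod]
    simp only [degree_X_sub_C, Finset.sum_const, Finset.card_erase_of_mem (Finset.mem_univ i),
      Finset.card_univ, Fintype.card_fin, nsmul_eq_mul, mul_one]
    have := i.2
    exact_mod_cast (by omega : N - 1 < N)
  · intro i _
    rw [eval_finsetSum, Finset.sum_eq_single i]
    · simp [ww_eval_self a ha i]
    · intro l _ hl; simp [ww_eval_ne a hl]
    · simp

def rr {e N : ℕ} (f : Fin (e + 1) → K[X]) (γ : K) (a : Fin N → K) (k : ℕ) (i : Fin N) : K :=
  if k ≤ e then (cof f (e - k)).eval (a i) / (γ * (ww a i).eval (a i)) else 0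

def pp {e N : ℕ} (f : Fin (e + 1) → K[X]) (γ : K) (a : Fin N → K) (i : Fin N) : K :=
  ∑ l, (a i - a l)⁻¹ - rr f γ a 1 i

def MM {N : ℕ} (p a : Fin N → K) : Matrix (Fin N) (Fin N) K :=
  Matrix.diagonal p - Matrix.of (fun i j => (a i - a j)⁻¹)

structure Setup {e N : ℕ} (f : Fin (e + 1) → K[X]) (γ : K) (a : Fin N → K) : Prop where
  ha : Function.Injective a
  hγ : γ ≠ 0
  hw : wr f = C γ * ∏ l, (X - C (a l))
  hdeg : ∃ l : Fin (e + 1) → ℕ, (∀ i, (f i).natDegree ≤ l i) ∧ ∑ i, l i = N + tri (e + 1)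

variable {e N : ℕ} {f : Fin (e + 1) → K[X]} {γ : K} {a : Fin N → K}

lemma Setup.cof_eq (S : Setup f γ a) (k : ℕ) (hk : k ≤ e) :
    cof f (e - k) = ∑ i, C (γ * rr f γ a k i) * ww a i := by
  obtain ⟨l, hl, hN⟩ := S.hdeg
  conv_lhs => rw [lagr a S.ha _ (cof_degree f l hl hN (e - k) (by omega))]
  refine Finset.sum_congr rfl fun i _ => ?_
  rw [rr, if_pos hk]
  congr 2
  have := ww_eval_self a S.ha i
  have := S.hγ
  field_simp

lemma Setup.cof_eval (S : Setup f γ a) (k : ℕ) (hk : k ≤ e) (i : Fin N) :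
    (cof f (e - k)).eval (a i) = γ * (ww a i).eval (a i) * rr f γ a k i := by
  rw [rr, if_pos hk]
  have := ww_eval_self a S.ha i
  have := S.hγ
  field_simp

lemma Setup.cof_deriv (S : Setup f γ a) (k : ℕ) (hk : k ≤ e) (i : Fin N) :
    (derivative (cof f (e - k))).eval (a i) = γ * (rr f γ a k i * (derivative (ww a i)).eval (a i)
      + (ww a i).eval (a i) * ∑ l, (a i - a l)⁻¹ * rr f γ a k l) := by
  rw [S.cof_eq k hk]
  simp only [derivative_sum, derivative_C_mul, eval_finsetSum, eval_mul, eval_C]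
  rw [← Finset.add_sum_erase _ _ (Finset.mem_univ i), ← Finset.add_sum_erase _ (fun l => (a i - a l)⁻¹ * rr f γ a k l) (Finset.mem_univ i)]
  simp only [sub_self, inv_zero, zero_mul, zero_add, mul_add, Finset.mul_sum]
  congr 1
  · ring
  · refine Finset.sum_congr rfl fun l hl => ?_
    rw [ww_deriv a S.ha (Finset.ne_of_mem_erase hl)]; ring

lemma Setup.rr_zero (S : Setup f γ a) (i : Fin N) : rr f γ a 0 i = -1 := by
  have := ww_eval_self a S.ha i
  have := S.hγ
  rw [rr, if_pos (Nat.zero_le _), Nat.sub_zero, cof_pred, S.hw, derivative_C_mul, eval_neg, eval_mul,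
    eval_C, deriv_prod_eval]
  field_simp

lemma Setup.link (S : Setup f γ a) (k : ℕ) (hk : k ≤ e) (i : Fin N) :
    pp f γ a i * rr f γ a k i - ∑ l, (a i - a l)⁻¹ * rr f γ a k l = rr f γ a (k + 1) i := by
  have hω := ww_eval_self a S.ha i
  have hγ := S.hγ
  set ω := (ww a i).eval (a i) with hωd
  have hW0 : (wr f).eval (a i) = 0 := by
    rw [S.hw, eval_mul, eval_prod, Finset.prod_eq_zero (Finset.mem_univ i) (by simp), mul_zero]
  have hW1 : (derivative (wr f)).eval (a i) = γ * ω := by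
    rw [S.hw, derivative_C_mul, eval_mul, eval_C, deriv_prod_eval]
  have key := ker_lem f (a i) (by rw [hW1]; exact mul_ne_zero hγ hω)
    (fun j => ∑ l, (a i - a l)⁻¹ * rr f γ a (e - j) l + rr f γ a (e - j + 1) i - pp f γ a i * rr f γ a (e - j) i)
    (by simp only [Nat.sub_self, S.rr_zero, pp, zero_add, mul_neg, mul_one, Finset.sum_neg_distrib]; ring) (by
      intro t
      have E1 := congrArg (eval (a i)) (cof_kill' f t)
      have E2 := congrArg (eval (a i)) (congrArg derivative (cof_kill' f t))
      set F : ℕ → K := fun j => (derivative^[j] (f t)).eval (a i) with hF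
      simp only [eval_add, eval_finsetSum, eval_mul, hW0, zero_mul, add_zero, eval_zero, derivative_add, derivative_sum,
        derivative_mul, derivative_zero, hW1, ← Function.iterate_succ_apply', Nat.succ_eq_add_one] at E1 E2
      change ∑ j ∈ Finset.range (e + 1), eval (a i) (cof f j) * F j = 0 at E1
      change ∑ j ∈ Finset.range (e + 1), (eval (a i) (derivative (cof f j)) * F j + eval (a i) (cof f j) * F (j + 1))
        + γ * ω * F (e + 1) = 0 at E2
      have c0 : ∀ j ∈ Finset.range (e + 1), eval (a i) (cof f j) = γ * ω * rr f γ a (e - j) i := by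
        intro j hj
        rw [Finset.mem_range] at hj
        have := S.cof_eval (e - j) (by omega) i
        rwa [show e - (e - j) = j by omega] at this
      have c1 : ∀ j ∈ Finset.range (e + 1), eval (a i) (derivative (cof f j)) = γ * (rr f γ a (e - j) i * (derivative (ww a i)).eval (a i)
      + (ww a i).eval (a i) * ∑ l, (a i - a l)⁻¹ * rr f γ a (e - j) l) := by
        intro j hj
        rw [Finset.mem_range] at hj
        have := S.cof_deriv (e - j) (by omega) i
        rwa [show e - (e - j) = j by omega] at this
      have E1' : ∑ j ∈ Finset.range (e + 1), rr f γ a (e - j) i * F j = 0 := by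
        rw [Finset.sum_congr rfl fun j hj => by rw [c0 j hj, mul_assoc], ← Finset.mul_sum] at E1
        exact (mul_eq_zero.1 E1).resolve_left (mul_ne_zero hγ hω)
      have E3 : ∑ j ∈ Finset.range (e + 1), eval (a i) (cof f j) * F (j + 1) + γ * ω * F (e + 1)
          = γ * ω * ∑ j ∈ Finset.range (e + 1), rr f γ a (e - j + 1) i * F j := by
        rw [Finset.sum_range_succ, c0 e (by simp), Finset.sum_range_succ' (fun j => rr f γ a (e - j + 1) i * F j)]
        have : rr f γ a (e - 0 + 1) i = 0 := by rw [rr, if_neg (by omega)]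
        rw [this, Nat.sub_self, S.rr_zero, zero_mul, add_zero, Finset.mul_sum]
        have : ∀ j ∈ Finset.range e, eval (a i) (cof f j) * F (j + 1) = γ * ω * (rr f γ a (e - (j + 1) + 1) i * F (j + 1)) := by
          intro j hj
          rw [Finset.mem_range] at hj
          rw [c0 j (by simp; omega), show e - (j + 1) + 1 = e - j by omega]; ring
        rw [Finset.sum_congr rfl this]; ring
      rw [Finset.sum_add_distrib, add_assoc, E3, Finset.sum_congr rfl fun j hj => by rw [c1 j hj]] at E2
      have E4 : ∑ j ∈ Finset.range (e + 1), γ * (rr f γ a (e - j) i * (derivative (ww a i)).eval (a i)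
        + ω * ∑ l, (a i - a l)⁻¹ * rr f γ a (e - j) l) * F j = γ * (derivative (ww a i)).eval (a i) *
          (∑ j ∈ Finset.range (e + 1), rr f γ a (e - j) i * F j) + γ * ω *
          ∑ j ∈ Finset.range (e + 1), (∑ l, (a i - a l)⁻¹ * rr f γ a (e - j) l) * F j := by
        rw [Finset.mul_sum, Finset.mul_sum, ← Finset.sum_add_distrib]
        exact Finset.sum_congr rfl fun j _ => by ring
      rw [E4, E1', mul_zero, zero_add, ← mul_add] at E2
      have E5 := (mul_eq_zero.1 E2).resolve_left (mul_ne_zero hγ hω)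
      have E6 : ∑ j ∈ Finset.range (e + 1), (∑ l, (a i - a l)⁻¹ * rr f γ a (e - j) l + rr f γ a (e - j + 1) i
         - pp f γ a i * rr f γ a (e - j) i) * F j = (∑ j ∈ Finset.range (e + 1), (∑ l, (a i - a l)⁻¹ * rr f γ a (e - j) l) * F j
         + ∑ j ∈ Finset.range (e + 1), rr f γ a (e - j + 1) i * F j) -
          pp f γ a i * ∑ j ∈ Finset.range (e + 1), rr f γ a (e - j) i * F j := by
        rw [Finset.mul_sum, ← Finset.sum_add_distrib, ← Finset.sum_sub_distrib]
        exact Finset.sum_congr rfl fun j _ => by ring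
      rw [E5, E1'] at E6
      simpa using E6)
  have := key (e - k) (by omega)
  rw [show e - (e - k) = k by omega] at this
  linear_combination -this

lemma Setup.link' (S : Setup f γ a) (k : ℕ) (hk : k ≤ e) :
    MM (pp f γ a) a *ᵥ rr f γ a k = rr f γ a (k + 1) := by
  ext i
  rw [MM, Matrix.sub_mulVec, Pi.sub_apply, Matrix.mulVec_diagonal, ← S.link k hk i]
  rfl

lemma Setup.rr_eq (S : Setup f γ a) (k : ℕ) (hk : k ≤ e + 1) :
    rr f γ a k = - ((MM (pp f γ a) a) ^ k *ᵥ (fun _ => 1)) := by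
  induction k with
  | zero => ext i; simp [S.rr_zero]
  | succ k ih =>
    rw [← S.link' k (by omega), ih (by omega), pow_succ', Matrix.mulVec_neg, Matrix.mulVec_mulVec]

lemma MM_mulVec {N : ℕ} (p a : Fin N → K) (v : Fin N → K) (i : Fin N) :
    (MM p a *ᵥ v) i = p i * v i - ∑ l, (a i - a l)⁻¹ * v l := by
  rw [MM, Matrix.sub_mulVec, Pi.sub_apply, Matrix.mulVec_diagonal]
  rfl

lemma MM_comm {N : ℕ} (p a : Fin N → K) (ha : Function.Injective a) (v : Fin N → K) :
    MM p a *ᵥ (a * v) = a * (MM p a *ᵥ v) - v + (fun _ => ∑ i, v i) := by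
  ext i
  simp only [Pi.sub_apply, Pi.add_apply, Pi.mul_apply, MM_mulVec]
  have : ∑ x, (a i - a x)⁻¹ * (a x * v x) = a i * ∑ x, (a i - a x)⁻¹ * v x - ∑ x, v x + v i := by
    rw [← Finset.add_sum_erase _ _ (Finset.mem_univ i), ← Finset.add_sum_erase _ (fun x => (a i - a x)⁻¹ * v x) (Finset.mem_univ i),
      ← Finset.add_sum_erase _ v (Finset.mem_univ i)]
    simp only [sub_self, inv_zero, zero_mul, zero_add]
    have : ∑ x ∈ Finset.univ.erase i, (a i - a x)⁻¹ * (a x * v x) = ∑ x ∈ Finset.univ.erase i, (a i * ((a i - a x)⁻¹ * v x) - v x) := by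
      refine Finset.sum_congr rfl fun x hx => ?_
      have : a i - a x ≠ 0 := sub_ne_zero.2 fun h => (Finset.ne_of_mem_erase hx) (ha h).symm
      field_simp
      ring
    rw [this, Finset.sum_sub_distrib, Finset.mul_sum]; ring
  rw [this]; ring

lemma MM_nilp {N : ℕ} (p a : Fin N → K) (ha : Function.Injective a) (d : ℕ)
    (h : (MM p a) ^ d *ᵥ (fun _ => 1) = 0) : (MM p a).charpoly = X ^ N := by
  set M := MM p a with hM
  let φ : (Fin N → K) →ₗ[K] (Fin N → K) := Matrix.toLin' M
  let α : (Fin N → K) →ₗ[K] (Fin N → K) := LinearMap.mulLeft K a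
  have hφα : ∀ v, φ (α v) = α (φ v) - v + (∑ i, v i) • (fun _ => 1) := by
    intro v
    have := MM_comm p a ha v
    simp only [φ, α, LinearMap.mulLeft_apply, Matrix.toLin'_apply]
    rw [← hM] at this
    rw [this]
    ext i; simp [α]
  let E : Submodule K (Fin N → K) := Module.End.maxGenEigenspace φ 0
  have hE : ∀ v, v ∈ E ↔ ∃ k, (φ ^ k) v = 0 := by
    intro v
    simp only [E, Module.End.mem_maxGenEigenspace, zero_smul, sub_zero]
  have he : (fun _ => 1 : Fin N → K) ∈ E := by
    rw [hE]; refine ⟨d, ?_⟩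
    rw [← Matrix.toLin'_pow, Matrix.toLin'_apply]; exact h
  have hφE : ∀ v, φ v ∈ E → v ∈ E := by
    intro v hv
    rw [hE] at hv ⊢
    obtain ⟨k, hk⟩ := hv
    exact ⟨k + 1, by rw [pow_succ]; exact hk⟩
  have hφE' : E ≤ E.comap φ := by
    intro v hv
    rw [Submodule.mem_comap, hE]
    rw [hE] at hv
    obtain ⟨k, hk⟩ := hv
    exact ⟨k, by rw [← Module.End.mul_apply, ← pow_succ, pow_succ', Module.End.mul_apply, hk, map_zero]⟩
  have hαE : ∀ k, ∀ v, (φ ^ k) v = 0 → α v ∈ E := by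
    intro k
    induction k with
    | zero => intro v hv; simp at hv; rw [hv, map_zero]; exact E.zero_mem
    | succ k ih =>
      intro v hv
      apply hφE
      rw [hφα]
      refine E.add_mem (E.sub_mem (ih _ ?_) ((hE v).2 ⟨_, hv⟩)) (E.smul_mem _ he)
      rw [← Module.End.mul_apply, ← pow_succ]; exact hv
  have hαE' : E ≤ E.comap α := by
    intro v hv
    obtain ⟨k, hk⟩ := (hE v).1 hv
    exact hαE k v hk
  let φ' := E.mapQ E φ hφE'
  let α' := E.mapQ E α hαE'
  have hcomm : α' * φ' - φ' * α' = 1 := by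
    refine LinearMap.ext fun w => ?_
    obtain ⟨v, rfl⟩ := Submodule.Quotient.mk_surjective _ w
    simp only [LinearMap.sub_apply, Module.End.mul_apply, φ', α', Submodule.mapQ_apply, Module.End.one_apply]
    rw [hφα, ← Submodule.Quotient.mk_sub, Submodule.Quotient.eq]
    have : α (φ v) - (α (φ v) - v + (∑ i, v i) • (fun _ => 1)) - v = -((∑ i, v i) • (fun _ => 1)) := by
      abel
    rw [this]
    exact E.neg_mem (E.smul_mem _ he)
  have htr := congrArg (LinearMap.trace K _) hcomm
  rw [map_sub, LinearMap.trace_mul_comm, sub_self, LinearMap.trace_one] at htr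
  have hfr : Module.finrank K ((Fin N → K) ⧸ E) = 0 := by exact_mod_cast htr.symm
  have hsub : Subsingleton ((Fin N → K) ⧸ E) := Module.finrank_zero_iff.1 hfr
  have hT : E = ⊤ := Submodule.Quotient.subsingleton_iff.1 hsub
  have hnil : IsNilpotent M := by
    have h1 := Module.End.maxGenEigenspace_eq φ 0
    refine ⟨Module.End.maxGenEigenspaceIndex φ 0, ?_⟩
    have h2 : Module.End.genEigenspace φ 0 (Module.End.maxGenEigenspaceIndex φ 0) = ⊤ := by rw [← h1]; exact hT
    have h3 : φ ^ (Module.End.maxGenEigenspaceIndex φ 0) = 0 := by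
      refine LinearMap.ext fun v => ?_
      have : v ∈ Module.End.genEigenspace φ 0 (Module.End.maxGenEigenspaceIndex φ 0) := by rw [h2]; trivial
      rw [Module.End.mem_genEigenspace_nat] at this
      simpa using this
    apply (Matrix.toLin' (R := K) (n := Fin N) (m := Fin N)).injective
    rw [Matrix.toLin'_pow, map_zero]; exact h3
  have h4 := Matrix.isNilpotent_charpoly_sub_pow_of_isNilpotent hnil
  have h5 := h4.eq_zero
  rw [Fintype.card_fin] at h5
  exact sub_eq_zero.1 h5

lemma Setup.charpoly (S : Setup f γ a) : (MM (pp f γ a) a).charpoly = X ^ N := by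
  refine MM_nilp _ _ S.ha (e + 1) ?_
  have h1 := S.rr_eq (e + 1) le_rfl
  have h2 : rr f γ a (e + 1) = 0 := by ext i; rw [rr, if_neg (by omega)]; rfl
  rw [h2] at h1
  exact neg_eq_zero.1 h1.symm

end link
end
end WS

open Polynomial Filter Topology
open scoped Matrix

namespace WS
noncomputable section

/-! ## Perturbation of eigenvalues, transversality -/

/-- functions with zero derivative at `0` -/
def Zf (u : ℝ → ℝ) : Prop := HasDerivAt u 0 0

lemma Zf.add {u v : ℝ → ℝ} (hu : Zf u) (hv : Zf v) : Zf (fun s => u s + v s) := by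
  simpa [Zf] using HasDerivAt.fun_add hu hv
lemma Zf.sub {u v : ℝ → ℝ} (hu : Zf u) (hv : Zf v) : Zf (fun s => u s - v s) := by
  simpa [Zf] using HasDerivAt.fun_sub hu hv
lemma Zf.neg {u : ℝ → ℝ} (hu : Zf u) : Zf (fun s => - u s) := by
  simpa [Zf] using HasDerivAt.fun_neg hu
lemma Zf.mul {u v : ℝ → ℝ} (hu : Zf u) (hv : Zf v) : Zf (fun s => u s * v s) := by
  simpa [Zf] using HasDerivAt.fun_mul hu hv
lemma Zf.const (c : ℝ) : Zf (fun _ => c) := hasDerivAt_const _ _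
lemma Zf.inv {u : ℝ → ℝ} (hu : Zf u) (h : u 0 ≠ 0) : Zf (fun s => (u s)⁻¹) := by
  simpa [Zf] using HasDerivAt.fun_inv hu h
lemma Zf.sum {ι : Type*} (t : Finset ι) {u : ι → ℝ → ℝ} (hu : ∀ i ∈ t, Zf (u i)) : Zf (fun s => ∑ i ∈ t, u i s) := by
  have := HasDerivAt.fun_sum (u := t) (A := u) (A' := fun _ => 0) (x := 0) (fun i hi => hu i hi)
  simpa [Zf] using this
lemma Zf.prod {ι : Type*} (t : Finset ι) {u : ι → ℝ → ℝ} (hu : ∀ i ∈ t, Zf (u i)) : Zf (fun s => ∏ i ∈ t, u i s) := by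
  classical
  induction t using Finset.induction_on with
  | empty => simpa using Zf.const 1
  | insert a t ha ih =>
    simp only [Finset.prod_insert ha]
    exact (hu a (by simp)).mul (ih fun i hi => hu i (by simp [hi]))

lemma Zf.matPow {n : Type*} [Fintype n] [DecidableEq n] {S : ℝ → Matrix n n ℝ} (hS : ∀ i j, Zf fun s => S s i j)
    (k : ℕ) (i j : n) : Zf fun s => (S s ^ k) i j := by
  induction k generalizing i j with
  | zero => simp only [pow_zero]; exact Zf.const _
  | succ k ih =>
    simp only [pow_succ, Matrix.mul_apply]
    exact Zf.sum _ fun l _ => (ih i l).mul (hS l j)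

lemma Zf.mulVec {n : Type*} [Fintype n] [DecidableEq n] {S : ℝ → Matrix n n ℝ} (hS : ∀ i j, Zf fun s => S s i j)
    (v : n → ℝ) (i : n) : Zf fun s => (S s *ᵥ v) i := by
  simp only [Matrix.mulVec, dotProduct]
  exact Zf.sum _ fun l _ => (hS i l).mul (Zf.const _)

lemma Zf.aeval {n : Type*} [Fintype n] [DecidableEq n] {S : ℝ → Matrix n n ℝ} (hS : ∀ i j, Zf fun s => S s i j)
    (m : ℝ[X]) (i j : n) : Zf fun s => (Polynomial.aeval (S s) m) i j := by
  simp only [aeval_eq_sum_range, Matrix.sum_apply, Matrix.smul_apply, smul_eq_mul]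
  exact Zf.sum _ fun k _ => (Zf.const _).mul (Zf.matPow hS k i j)

lemma eig_bound {n : Type*} [Fintype n] [DecidableEq n] (A : Matrix n n ℝ) (v : n → ℝ) (hv : v ≠ 0) (μ : ℝ)
    (h : A *ᵥ v = μ • v) : |μ| ≤ ∑ i, ∑ j, |A i j| := by
  have hne : Nonempty n := by
    by_contra hc
    rw [not_nonempty_iff] at hc
    exact hv (Subsingleton.elim _ _)
  obtain ⟨i, hi⟩ := Finite.exists_max (fun i => |v i|)
  have hpos : 0 < |v i| := by
    by_contra hc
    apply hv
    ext j
    have := (hi j).trans (not_lt.1 hc)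
    simpa using this
  have h1 := congrFun h i
  simp only [Matrix.mulVec, dotProduct, Pi.smul_apply, smul_eq_mul] at h1
  have h2 : |μ| * |v i| ≤ (∑ j, |A i j|) * |v i| := by
    rw [← abs_mul, ← h1, Finset.sum_mul]
    refine (Finset.abs_sum_le_sum_abs _ _).trans (Finset.sum_le_sum fun j _ => ?_)
    rw [abs_mul]
    exact mul_le_mul_of_nonneg_left (hi j) (abs_nonneg _)
  refine (le_of_mul_le_mul_right h2 hpos).trans ?_
  exact Finset.single_le_sum (f := fun i => ∑ j, |A i j|) (fun i _ => Finset.sum_nonneg fun j _ => abs_nonneg _) (Finset.mem_univ i)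

lemma exists_eigvec {n : Type*} [Fintype n] [DecidableEq n] (A : Matrix n n ℝ) (μ : ℝ) (h : A.charpoly.eval μ = 0) :
    ∃ v : n → ℝ, v ≠ 0 ∧ A *ᵥ v = μ • v := by
  rw [Matrix.eval_charpoly] at h
  obtain ⟨v, hv, hv2⟩ := Matrix.exists_mulVec_eq_zero_iff.2 h
  refine ⟨v, hv, ?_⟩
  rw [Matrix.sub_mulVec, sub_eq_zero] at hv2
  rw [← hv2]
  ext i; simp [Matrix.scalar_apply, Matrix.mulVec_diagonal]

lemma aeval_mulVec {n : Type*} [Fintype n] [DecidableEq n] (A : Matrix n n ℝ) (v : n → ℝ) (μ : ℝ)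
    (h : A *ᵥ v = μ • v) (m : ℝ[X]) : (Polynomial.aeval A m) *ᵥ v = (m.eval μ) • v := by
  have hk : ∀ k : ℕ, (A ^ k) *ᵥ v = μ ^ k • v := by
    intro k
    induction k with
    | zero => simp
    | succ k ih => rw [pow_succ, ← Matrix.mulVec_mulVec, h, Matrix.mulVec_smul, ih, smul_smul, pow_succ']
  rw [aeval_eq_sum_range, eval_eq_sum_range, Matrix.sum_mulVec, Finset.sum_smul]
  refine Finset.sum_congr rfl fun k _ => ?_
  rw [Matrix.smul_mulVec, hk, smul_smul]

lemma herm_poly {n : Type*} [Fintype n] [DecidableEq n] (A : Matrix n n ℝ) (hA : A.IsHermitian) (μ : ℝ)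
    (h : A.charpoly.eval μ = 0) : ∃ m : ℝ[X], Polynomial.aeval A ((X - C μ) * m) = 0 ∧ m.eval μ ≠ 0 := by
  have h1 : (Matrix.toEuclideanLin A).IsSymmetric := Matrix.isSymmetric_toEuclideanLin_iff.2 hA
  have h2 := h1.isFinitelySemisimple
  have h3 := (Module.End.isFinitelySemisimple_iff_isSemisimple.1 h2).minpoly_squarefree
  set T := Matrix.toEuclideanLin A with hT
  have hroot : (minpoly ℝ T).IsRoot μ := by
    rw [← Module.End.hasEigenvalue_iff_isRoot]
    obtain ⟨v, hv, hv2⟩ := exists_eigvec A μ h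
    refine Module.End.hasEigenvalue_of_hasEigenvector (x := WithLp.toLp 2 v) ⟨?_, ?_⟩
    · rw [Module.End.mem_eigenspace_iff, hT, Matrix.toLpLin_toLp, Matrix.toLin'_apply, hv2]; rfl
    · intro h0; apply hv; simpa using h0
  obtain ⟨m, hm⟩ := dvd_iff_isRoot.2 hroot
  refine ⟨m, ?_, ?_⟩
  · rw [← hm]
    have h5 := minpoly.aeval ℝ T
    have h6 : ∀ q : ℝ[X], Matrix.toEuclideanLin (Polynomial.aeval A q) = Polynomial.aeval T q := by
      intro q
      exact (aeval_algHom_apply (Matrix.toLpLinAlgEquiv (R := ℝ) (n := n) 2).toAlgHom A q).symm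
    apply Matrix.toEuclideanLin.injective
    rw [h6, h5, map_zero]
  · intro h0
    obtain ⟨r, hr⟩ := dvd_iff_isRoot.2 h0
    have h7 := h3 (X - C μ) ⟨r, by rw [hm, hr]; ring⟩
    exact not_isUnit_X_sub_C μ h7

lemma eig_pert {n : Type*} [Fintype n] [DecidableEq n] (S : ℝ → Matrix n n ℝ) (hS0 : (S 0).IsHermitian)
    (hS : ∀ i j, Zf fun s => S s i j) (p : ℝ → ℝ) (hp : ContinuousAt p 0)
    (hroot : ∀ᶠ s in 𝓝 0, (S s).charpoly.eval (p s) = 0) : Zf p := by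
  obtain ⟨m, hm, hm0⟩ := herm_poly (S 0) hS0 (p 0) hroot.self_of_nhds
  have hE : ∀ i j, (fun s => (Polynomial.aeval (S s) ((X - C (p 0)) * m)) i j) =o[𝓝 0] (fun s : ℝ => s) := by
    intro i j
    have := Zf.aeval hS ((X - C (p 0)) * m) i j
    rw [Zf, hasDerivAt_iff_isLittleO] at this
    simpa [hm] using this
  have hE2 : (fun s => ∑ i, ∑ j, |(Polynomial.aeval (S s) ((X - C (p 0)) * m)) i j|) =o[𝓝 0] (fun s : ℝ => s) :=
    Asymptotics.IsLittleO.fun_sum fun i _ => Asymptotics.IsLittleO.fun_sum fun j _ => (hE i j).abs_left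
  have hE3 : (fun s => p s - p 0) =O[𝓝 0] (fun s => ∑ i, ∑ j, |(Polynomial.aeval (S s) ((X - C (p 0)) * m)) i j|) := by
    have hc : ContinuousAt (fun s => |m.eval (p s)|) 0 :=
      ((m.continuous.continuousAt).comp hp).abs
    have hlt : |m.eval (p 0)| / 2 < |m.eval (p 0)| := half_lt_self (abs_pos.2 hm0)
    have h1 := hc.eventually_const_lt hlt
    refine Asymptotics.IsBigO.of_bound (2 / |m.eval (p 0)|) ?_
    filter_upwards [h1, hroot] with s hs1 hs2
    obtain ⟨v, hv, hv2⟩ := exists_eigvec (S s) (p s) hs2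
    have h3 := eig_bound _ v hv _ (aeval_mulVec (S s) v (p s) hv2 ((X - C (p 0)) * m))
    rw [Real.norm_eq_abs, Real.norm_eq_abs, abs_of_nonneg (a := ∑ i, ∑ j, |(Polynomial.aeval (S s) ((X - C (p 0)) * m)) i j|)
      (Finset.sum_nonneg fun i _ => Finset.sum_nonneg fun j _ => abs_nonneg _)]
    rw [eval_mul, eval_sub, eval_X, eval_C, abs_mul] at h3
    have hpos := abs_pos.2 hm0
    rw [div_mul_eq_mul_div, le_div_iff₀ hpos]
    have h4 : |p s - p 0| * (|m.eval (p 0)| / 2) ≤ |p s - p 0| * |eval (p s) m| :=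
      mul_le_mul_of_nonneg_left hs1.le (abs_nonneg _)
    linarith
  rw [Zf, hasDerivAt_iff_isLittleO]
  simpa using hE3.trans_isLittleO hE2

lemma exists_section {X Y : Type*} [TopologicalSpace X] [TopologicalSpace Y] (Θ : X → Y) (x : X)
    (hmap : map Θ (𝓝 x) = 𝓝 (Θ x)) (U : Set X) (hU : U ∈ 𝓝 x) (hinj : Set.InjOn Θ U) :
    ∃ g : Y → X, Tendsto g (𝓝 (Θ x)) (𝓝 x) ∧ (∀ᶠ c in 𝓝 (Θ x), Θ (g c) = c) ∧ g (Θ x) = x := by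
  classical
  have hne : Nonempty X := ⟨x⟩
  have hleft : ∀ y ∈ U, Function.invFunOn Θ U (Θ y) = y := fun y hy => hinj.leftInvOn_invFunOn hy
  refine ⟨Function.invFunOn Θ U, ?_, ?_, hleft x (mem_of_mem_nhds hU)⟩
  · rw [← hmap, tendsto_map'_iff]
    refine (tendsto_id).congr' ?_
    filter_upwards [hU] with y hy
    simp [hleft y hy]
  · rw [← hmap, eventually_map]
    filter_upwards [hU] with y hy
    rw [hleft y hy]

end
end WS

open Polynomial Filter Topology
open scoped Matrix

namespace WS
noncomputable section
section T
set_option linter.unusedSectionVars false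

lemma ech_zero {K : Type*} [Field K] [CharZero K] {d : ℕ} (f : Fin d → K[X]) (l : Fin d → ℕ)
    (hl : Function.Injective l) (hf : ∀ i, (f i).natDegree ≤ l i) (hf1 : ∀ i, (f i).coeff (l i) ≠ 0)
    (g : K[X]) (hg : ∀ t, g.coeff (l t) = 0) (h : wr (Fin.snoc f g : Fin (d + 1) → K[X]) = 0) : g = 0 := by
  by_contra hg0
  set L : Fin (d + 1) → ℕ := Fin.snoc l g.natDegree with hL
  have hLi : Function.Injective L := by
    rw [hL, Fin.snoc_injective_iff]
    refine ⟨hl, ?_⟩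
    rintro ⟨t, ht⟩
    have := hg t
    rw [ht] at this
    exact hg0 (leadingCoeff_eq_zero.1 this)
  obtain ⟨m, hm⟩ := Nat.exists_eq_add_of_le' (tri_le_sum L hLi)
  have h1 := wr_lead (Fin.snoc f g : Fin (d + 1) → K[X]) L (by
    intro i
    refine Fin.lastCases ?_ (fun i => ?_) i
    · simp [hL]
    · simpa [hL] using hf i) m hm
  rw [h, coeff_zero] at h1
  refine mul_ne_zero (vander_ne L hLi) ?_ h1.symm
  rw [Finset.prod_ne_zero_iff]
  intro i _
  refine Fin.lastCases ?_ (fun i => ?_) i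
  · simpa [hL] using hg0
  · simpa [hL] using hf1 i

lemma roots_section {N : ℕ} (p : Fin N → ℝ) (hp : Function.Injective p) :
    ∃ g : (Fin N → ℝ) → (Fin N → ℝ), Tendsto g (𝓝 (cf N (∏ k, (X - C (p k))))) (𝓝 p) ∧
     (∀ᶠ c in 𝓝 (cf N (∏ k, (X - C (p k)))), cf N (∏ k, (X - C (g c k))) = c) ∧ g (cf N (∏ k, (X - C (p k)))) = p := by
  obtain ⟨h1, U, hU, hinj⟩ := ift (fun p : Fin N → ℝ => cf N (∏ k, (X - C (p k))))
    (contDiff_cf (SmoothP.prod _ fun i _ => (SmoothP.const _).sub (SmoothP.C (contDiff_apply ..)))) p (by simp) (by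
      intro v hv
      refine roots_inj p v hp fun k hk => hasDerivAt_cf ?_ k hk
      simpa using hv)
  exact exists_section _ _ h1 U hU hinj

lemma Zf.of_mul {u v w : ℝ → ℝ} (hv : ContinuousAt v 0) (hv0 : v 0 ≠ 0) (hw : Zf w)
    (h : ∀ᶠ s in 𝓝 0, u s * v s = w s) (hu : u 0 = 0) : Zf u := by
  have hw0 : w 0 = 0 := by rw [← h.self_of_nhds, hu, zero_mul]
  have h1 : w =o[𝓝 0] (fun s : ℝ => s) := by
    rw [Zf, hasDerivAt_iff_isLittleO] at hw
    simpa [hw0] using hw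
  have h2 : (fun s => (v s)⁻¹) =O[𝓝 0] (fun _ => (1 : ℝ)) := (hv.inv₀ hv0).tendsto.isBigO_one ℝ
  have h3 := h1.mul_isBigO h2
  rw [Zf, hasDerivAt_iff_isLittleO]
  simp only [hu, sub_zero, smul_zero]
  refine (h3.congr' ?_ ?_)
  · filter_upwards [h, hv.eventually_ne hv0] with s hs hs2
    rw [← hs]; field_simp
  · exact Eventually.of_forall fun s => by simp

lemma Zf.congr {u v : ℝ → ℝ} (hu : Zf u) (h : ∀ᶠ s in 𝓝 0, v s = u s) : Zf v :=
  HasDerivAt.congr_of_eventuallyEq hu h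

lemma Zf.cont {u : ℝ → ℝ} (hu : Zf u) : ContinuousAt u 0 := HasDerivAt.continuousAt hu

lemma smooth_wr {E : Type*} [NormedAddCommGroup E] [NormedSpace ℝ E] {d : ℕ} {F : E → Fin d → ℝ[X]}
    (hF : ∀ i, SmoothP fun y => F y i) : SmoothP fun y => wr (F y) := by
  refine SmoothP.det fun i j => ?_
  simp only [Matrix.of_apply]
  exact (hF i).iterate _

lemma smooth_cof {E : Type*} [NormedAddCommGroup E] [NormedSpace ℝ E] {d : ℕ} {F : E → Fin d → ℝ[X]}
    (hF : ∀ i, SmoothP fun y => F y i) (j : ℕ) : SmoothP fun y => cof (F y) j := by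
  refine (SmoothP.const _).mul (SmoothP.det fun i j => ?_)
  simp only [Matrix.of_apply]
  exact (hF i).iterate _

lemma transv {e N : ℕ} (f g : Fin (e + 1) → ℝ[X]) (l : Fin (e + 1) → ℕ) (hl : Function.Injective l)
    (hN : ∑ i, l i = N + tri (e + 1)) (hf : ∀ i, (f i).natDegree ≤ l i) (hf1 : ∀ i, (f i).coeff (l i) = 1)
    (hg : ∀ i, (g i).natDegree ≤ l i) (hg0 : ∀ i t, (g i).coeff (l t) = 0) (γ : ℝ) (a : Fin N → ℝ)
    (ha : Function.Injective a) (hw : wr f = C γ * ∏ k, (X - C (a k)))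
    (hZ : ∀ k, Zf fun s => (wr (fun i => f i + C s * g i)).coeff k) (t : Fin (e + 1)) : g t = 0 := by
  set Fs : ℝ → Fin (e + 1) → ℝ[X] := fun s i => f i + C s * g i with hFs
  have hF0 : Fs 0 = f := by ext1 i; simp [hFs]
  have hFd : ∀ s i, (Fs s i).natDegree ≤ l i := by
    intro s i
    refine (natDegree_add_le _ _).trans (max_le (hf i) ((natDegree_C_mul_le _ _).trans (hg i)))
  have hF1 : ∀ s i, (Fs s i).coeff (l i) = 1 := by
    intro s i
    simp [hFs, hf1, hg0]
  have hlead : ∀ s, (wr (Fs s)).coeff N = (Matrix.vandermonde (fun i => (l i : ℝ))).det := by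
    intro s
    rw [wr_lead (Fs s) l (hFd s) N hN]
    simp [hF1]
  have hγV : γ = (Matrix.vandermonde (fun i => (l i : ℝ))).det := by
    rw [← hlead 0, hF0, hw, coeff_C_mul]
    have h1 : (∏ k, (X - C (a k))).Monic := monic_prod_of_monic _ _ fun i _ => monic_X_sub_C _
    have h2 := h1.coeff_natDegree
    rw [natDegree_prodX] at h2
    rw [h2, mul_one]
  have hγ : γ ≠ 0 := by rw [hγV]; exact vander_ne l hl
  have hdeg : ∀ s, (wr (Fs s)).natDegree ≤ N := by
    intro s
    rw [natDegree_le_iff_coeff_eq_zero]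
    intro m hm
    by_contra hne
    have := wr_natDegree_le (Fs s) l (hFd s) m hne
    omega
  set P : ℝ → ℝ[X] := fun s => C γ⁻¹ * wr (Fs s) with hP
  have hPc : ∀ s, wr (Fs s) = C γ * P s := by
    intro s; rw [hP, ← mul_assoc, ← C_mul, mul_inv_cancel₀ hγ]; simp
  have hPN : ∀ s, (P s).coeff N = 1 := by
    intro s; rw [hP, coeff_C_mul, hlead, ← hγV, inv_mul_cancel₀ hγ]
  have hPd : ∀ s, (P s).natDegree ≤ N := fun s => (natDegree_C_mul_le _ _).trans (hdeg s)
  have hPd' : ∀ s, (P s).natDegree = N := fun s => le_antisymm (hPd s)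
    (le_natDegree_of_ne_zero (by rw [hPN]; exact one_ne_zero))
  have hPm : ∀ s, (P s).Monic := by
    intro s; rw [Monic, leadingCoeff, hPd', hPN]
  have hP0 : P 0 = ∏ k, (X - C (a k)) := by
    rw [hP]; simp only [hF0, hw]; rw [← mul_assoc, ← C_mul, inv_mul_cancel₀ hγ]; simp
  have hPZ : ∀ k, Zf fun s => (P s).coeff k := by
    intro k; simp only [hP, coeff_C_mul]; exact (Zf.const _).mul (hZ k)
  have hPeZ : ∀ z, Zf fun s => (P s).eval z := fun z =>
    hasDerivAt_eval_of_coeff hPd (fun k _ => hPZ k) z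
  obtain ⟨G, hG1, hG2, hG3⟩ := roots_section a ha
  set α : ℝ → Fin N → ℝ := fun s => G (cf N (P s)) with hα
  have hα0 : α 0 = a := by simp only [hα, hP0]; exact hG3
  have hct : Tendsto (fun s => cf N (P s)) (𝓝 0) (𝓝 (cf N (∏ k, (X - C (a k))))) := by
    rw [← hP0, tendsto_pi_nhds]
    intro k
    exact (hPZ k).cont.tendsto
  have hαt : Tendsto α (𝓝 0) (𝓝 a) := hG1.comp hct
  have hαc : ∀ i, ContinuousAt (fun s => α s i) 0 := by
    intro i
    have := (tendsto_pi_nhds.1 hαt) i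
    rw [ContinuousAt, hα0]; exact this
  have hPα : ∀ᶠ s in 𝓝 0, P s = ∏ k, (X - C (α s k)) := by
    filter_upwards [hct.eventually hG2] with s hs
    exact cf_inj_monic (hPm s) (monic_prod_of_monic _ _ fun i _ => monic_X_sub_C _) (hPd' s) (natDegree_prodX _) hs.symm
  have hainj : ∀ᶠ s in 𝓝 0, Function.Injective (α s) := by
    have : ∀ i j, i ≠ j → ∀ᶠ s in 𝓝 0, α s i ≠ α s j := by
      intro i j hij
      refine ((hαc i).sub (hαc j)).eventually_ne (y := 0) ?_ |>.mono fun s hs h => hs (sub_eq_zero.2 h)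
      change α 0 i - α 0 j ≠ 0
      rw [hα0]; exact sub_ne_zero.2 fun h => hij (ha h)
    have h2 : ∀ᶠ s in 𝓝 0, ∀ i j, i ≠ j → α s i ≠ α s j := by
      rw [eventually_all]; intro i; rw [eventually_all]; intro j
      by_cases hij : i = j
      · exact Eventually.of_forall fun s h => absurd hij h
      · exact (this i j hij).mono fun s hs _ => hs
    exact h2.mono fun s hs i j h => by_contra fun hne => hs i j hne h
  have hS : ∀ᶠ s in 𝓝 0, Setup (Fs s) γ (α s) := by
    filter_upwards [hPα, hainj] with s h1 h2
    exact ⟨h2, hγ, by rw [hPc, h1], l, hFd s, hN⟩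
  have hprodc : ∀ i, ContinuousAt (fun s => ∏ k ∈ Finset.univ.erase i, (a i - α s k)) 0 := by
    intro i
    exact tendsto_finsetProd _ fun k _ => (continuousAt_const.sub (hαc k))
  have hαZ : ∀ i, Zf fun s => α s i := by
    intro i
    have : Zf fun s => a i - α s i := by
      refine Zf.of_mul (v := fun s => ∏ k ∈ Finset.univ.erase i, (a i - α s k)) (w := fun s => (P s).eval (a i)) (hprodc i) ?_ (hPeZ _) ?_ ?_
      · simp only [hα0]
        rw [Finset.prod_ne_zero_iff]
        intro k hk
        exact sub_ne_zero.2 fun h => (Finset.ne_of_mem_erase hk) (ha h).symm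
      · filter_upwards [hPα] with s hs
        rw [hs, eval_prod, ← Finset.mul_prod_erase _ _ (Finset.mem_univ i)]
        simp
      · simp [hα0]
    have h2 := (Zf.const (a i)).sub this
    simpa using h2
  have hqZ : ∀ i k, Zf fun s => (α s i - α s k)⁻¹ := by
    intro i k
    by_cases hik : i = k
    · subst hik; simpa using Zf.const 0
    · refine ((hαZ i).sub (hαZ k)).inv ?_
      rw [hα0]; exact sub_ne_zero.2 fun h => hik (ha h)
  have hsm : ∀ i, SmoothP fun s : ℝ => Fs s i := fun i =>
    (SmoothP.const _).add ((SmoothP.C contDiff_id).mul (SmoothP.const _))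
  have hpc : ∀ i, ContinuousAt (fun s => pp (Fs s) γ (α s) i) 0 := by
    intro i
    simp only [pp, rr]
    refine ContinuousAt.sub (Zf.sum _ fun k _ => hqZ i k).cont ?_
    by_cases he : 1 ≤ e
    · simp only [if_pos he]
      refine ContinuousAt.div₀ ?_ ?_ ?_
      · have hc : ∀ s, (cof (Fs s) (e - 1)).eval (α s i) = ∑ k ∈ Finset.range N, (cof (Fs s) (e - 1)).coeff k * (α s i) ^ k := by
          intro s
          have h1 := cof_degree (Fs s) l (hFd s) hN (e - 1) (by omega)
          rw [eval_eq_sum_range' (n := N)]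
          by_cases h0 : cof (Fs s) (e - 1) = 0
          · rw [h0, natDegree_zero]; exact Nat.pos_of_ne_zero (by rintro rfl; exact i.elim0)
          · exact (natDegree_lt_iff_degree_lt h0).2 h1
        simp only [hc]
        exact tendsto_finsetSum _ fun k _ => (((smooth_cof hsm (e - 1)) k).continuous.continuousAt.mul ((hαc i).pow k))
      · refine continuousAt_const.mul ?_
        simp only [ww, eval_prod, eval_sub, eval_X, eval_C]
        exact tendsto_finsetProd _ fun k _ => ((hαc i).sub (hαc k))
      · rw [hα0]; exact mul_ne_zero hγ (ww_eval_self a ha i)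
    · simp only [if_neg he]; exact continuousAt_const
  have hpZ : ∀ i, Zf fun s => pp (Fs s) γ (α s) i := by
    intro i
    refine eig_pert (fun s => HH (fun i j => (α s i - α s j)⁻¹) (fun _ => (0 : ℝ)) i) ?_ ?_ _ (hpc i) ?_
    · rw [Matrix.IsHermitian, Matrix.conjTranspose_eq_transpose_of_trivial]; exact HH_symm _ _ _
    · intro σ τ
      simp only [HH, Matrix.of_apply]
      refine Zf.add (Zf.const _) (Zf.sum _ fun j _ => ?_)
      split_ifs
      · exact hqZ i j
      · exact Zf.const _
    · filter_upwards [hS] with s hs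
      have := thmR (α s) hs.ha ℝ (pp (Fs s) γ (α s)) hs.charpoly i
      simpa using this
  have hMZ : ∀ i k, Zf fun s => MM (pp (Fs s) γ (α s)) (α s) i k := by
    intro i k
    simp only [MM, Matrix.sub_apply, Matrix.of_apply, Matrix.diagonal_apply]
    refine Zf.sub ?_ (hqZ i k)
    split_ifs
    · exact hpZ i
    · exact Zf.const _
  have hrZ : ∀ k ≤ e, ∀ i, Zf fun s => rr (Fs s) γ (α s) k i := by
    intro k hk i
    refine (Zf.mulVec (Zf.matPow hMZ k) (fun _ => 1) i).neg.congr ?_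
    filter_upwards [hS] with s hs
    rw [hs.rr_eq k (by omega)]; rfl
  have hcZ : ∀ j ≤ e, ∀ z, Zf fun s => (cof (Fs s) j).eval z := by
    intro j hj z
    have h1 : Zf fun s => ∑ i, γ * rr (Fs s) γ (α s) (e - j) i * ∏ k ∈ Finset.univ.erase i, (z - α s k) :=
      Zf.sum _ fun i _ => ((Zf.const _).mul (hrZ _ (by omega) i)).mul (Zf.prod _ fun k _ => (Zf.const _).sub (hαZ k))
    refine h1.congr ?_
    filter_upwards [hS] with s hs
    have := hs.cof_eq (e - j) (by omega)
    rw [show e - (e - j) = j by omega] at this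
    rw [this, eval_finsetSum]
    simp only [eval_mul, eval_C, ww, eval_prod, eval_sub, eval_X]
  have hWZ : ∀ z, Zf fun s => (wr (Fs s)).eval z := by
    intro z
    simp only [hPc, eval_mul, eval_C]
    exact (Zf.const _).mul (hPeZ z)
  have hder : ∀ (u : ℝ → ℝ) (x y : ℝ), Zf u → HasDerivAt (fun s => u s * (x + s * y)) (u 0 * y) 0 := by
    intro u x y hu
    have h1 : HasDerivAt (fun s : ℝ => x + s * y) y 0 := by
      simpa using ((hasDerivAt_id (0 : ℝ)).mul_const y).const_add x
    have h2 := HasDerivAt.fun_mul hu h1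
    simpa using h2
  refine ech_zero f l hl hf (fun i => by rw [hf1]; exact one_ne_zero) (g t) (hg0 t) ?_
  rw [wr_snoc, Finset.sum_range_succ, cof_self]
  refine Polynomial.funext fun z => ?_
  have hD : HasDerivAt (fun s => ∑ j ∈ Finset.range (e + 1), (cof (Fs s) j).eval z * ((derivative^[j] (f t)).eval z + s * (derivative^[j] (g t)).eval z)
      + (wr (Fs s)).eval z * ((derivative^[e + 1] (f t)).eval z + s * (derivative^[e + 1] (g t)).eval z))
      (∑ j ∈ Finset.range (e + 1), (cof (Fs 0) j).eval z * (derivative^[j] (g t)).eval z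
      + (wr (Fs 0)).eval z * (derivative^[e + 1] (g t)).eval z) 0 := by
    refine HasDerivAt.fun_add (HasDerivAt.fun_sum fun j hj => ?_) (hder _ _ _ (hWZ z))
    exact hder _ _ _ (hcZ j (by rw [Finset.mem_range] at hj; omega) z)
  have hzero : (fun s => ∑ j ∈ Finset.range (e + 1), (cof (Fs s) j).eval z * ((derivative^[j] (f t)).eval z + s * (derivative^[j] (g t)).eval z)
      + (wr (Fs s)).eval z * ((derivative^[e + 1] (f t)).eval z + s * (derivative^[e + 1] (g t)).eval z)) = fun _ => 0 := by
    ext s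
    have := congrArg (eval z) (cof_kill' (Fs s) t)
    simp only [eval_add, eval_finsetSum, eval_mul, hFs, iterate_map_add, iterate_derivative_C_mul, eval_C, eval_zero] at this
    exact this
  rw [hzero, hF0] at hD
  have := hD.unique (hasDerivAt_const _ _)
  simp only [eval_add, eval_finsetSum, eval_mul, eval_zero]
  rw [← this]
  congr 1
  · exact Finset.sum_congr rfl fun _ _ => mul_comm _ _
  · ring

/-- Reality of reduced bases. -/
lemma reality {e N : ℕ} (f : Fin (e + 1) → ℂ[X]) (l : Fin (e + 1) → ℕ) (hl : Function.Injective l)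
    (hN : ∑ i, l i = N + tri (e + 1)) (hf : ∀ i, (f i).natDegree ≤ l i)
    (hf1 : ∀ i t, (f i).coeff (l t) = if i = t then 1 else 0) (γ : ℂ) (hγ : γ ≠ 0) (a : Fin N → ℝ)
    (ha : Function.Injective a) (hw : wr f = C γ * ∏ k, (X - C (a k : ℂ))) (t : Fin (e + 1)) :
    ∀ k, (starRingEnd ℂ) ((f t).coeff k) = (f t).coeff k := by
  have hac : Function.Injective (fun k => (a k : ℂ)) := fun i j h => ha (by simpa using h)
  have S : Setup f γ (fun k => (a k : ℂ)) := ⟨hac, hγ, hw, l, hf, hN⟩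
  have hp : ∀ i, ∃ r : ℝ, (r : ℂ) = pp f γ (fun k => (a k : ℂ)) i := by
    intro i
    have h1 := thmR a ha ℂ (pp f γ (fun k => (a k : ℂ))) (by
      have h2 := S.charpoly
      rw [MM] at h2
      rw [← h2]
      congr 2
      ext i j; simp) i
    have hH : (HH (fun i j => (a i - a j)⁻¹) (fun _ => (0:ℝ)) i).IsHermitian := by
      rw [Matrix.IsHermitian, Matrix.conjTranspose_eq_transpose_of_trivial]; exact HH_symm _ _ _
    have h3 := hH.splits_charpoly
    have hmo := Matrix.charpoly_monic (HH (fun i j => (a i - a j)⁻¹) (fun _ => (0:ℝ)) i)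
    have h4 := h3.eq_prod_roots_of_monic hmo
    rw [h4, Polynomial.map_multiset_prod, eval_multiset_prod, Multiset.prod_eq_zero_iff] at h1
    simp only [Multiset.map_map, Multiset.mem_map, Function.comp] at h1
    obtain ⟨r, -, hr⟩ := h1
    refine ⟨r, ?_⟩
    simp at hr
    exact (sub_eq_zero.1 hr).symm
  choose r hr using hp
  have hM : MM (pp f γ (fun k => (a k : ℂ))) (fun k => (a k : ℂ)) = (MM r a).map Complex.ofRealHom := by
    ext i j
    simp only [MM, Matrix.sub_apply, Matrix.diagonal_apply, Matrix.map_apply, Matrix.of_apply, ← hr]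
    split_ifs <;> simp
  have hrr : ∀ k ≤ e, ∀ i, (starRingEnd ℂ) (rr f γ (fun k => (a k : ℂ)) k i) = rr f γ (fun k => (a k : ℂ)) k i := by
    intro k hk i
    rw [S.rr_eq k (by omega), hM, ← Matrix.map_pow]
    simp [Matrix.mulVec, dotProduct]
  have hR : ∀ j ≤ e + 1, ∃ R : ℂ[X], cof f j = C γ * R ∧ R.map (starRingEnd ℂ) = R := by
    intro j hj
    rcases Nat.lt_or_ge e j with h | h
    · obtain rfl : j = e + 1 := by omega
      refine ⟨_, (cof_self f).trans hw, ?_⟩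
      rw [Polynomial.map_prod]; simp
    · refine ⟨∑ i, C (rr f γ (fun k => (a k : ℂ)) (e - j) i) * ww (fun k => (a k : ℂ)) i, ?_, ?_⟩
      · have := S.cof_eq (e - j) (by omega)
        rw [show e - (e - j) = j by omega] at this
        rw [this, Finset.mul_sum]
        exact Finset.sum_congr rfl fun i _ => by rw [C_mul, mul_assoc]
      · rw [Polynomial.map_sum]
        refine Finset.sum_congr rfl fun i _ => ?_
        rw [Polynomial.map_mul, map_C, hrr _ (by omega), ww, Polynomial.map_prod]
        simp
  choose! R hR1 hR2 using hR
  have key : ∀ g : ℂ[X], wr (Fin.snoc f g : Fin (e + 1 + 1) → ℂ[X]) = C γ * ∑ j ∈ Finset.range (e + 2), derivative^[j] g * R j := by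
    intro g
    rw [wr_snoc, Finset.mul_sum]
    refine Finset.sum_congr rfl fun j hj => ?_
    rw [hR1 j (by rw [Finset.mem_range] at hj; omega)]; ring
  have h1 : ∑ j ∈ Finset.range (e + 2), derivative^[j] (f t) * R j = 0 := by
    have := key (f t)
    rw [wr_snoc, cof_kill] at this
    exact (mul_eq_zero.1 this.symm).resolve_left (by simpa using hγ)
  have h2 : ∑ j ∈ Finset.range (e + 2), derivative^[j] ((f t).map (starRingEnd ℂ)) * R j = 0 := by
    have := congrArg (Polynomial.map (starRingEnd ℂ)) h1
    rw [Polynomial.map_sum, Polynomial.map_zero] at this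
    rw [← this]
    refine Finset.sum_congr rfl fun j hj => ?_
    rw [Polynomial.map_mul, hR2 j (by rw [Finset.mem_range] at hj; omega), iterate_derivative_map]
  have h3 := ech_zero f l hl hf (fun i => by rw [hf1]; simp) ((f t).map (starRingEnd ℂ) - f t) (by
    intro i; rw [coeff_sub, coeff_map, hf1]; split_ifs <;> simp) (by
    rw [key]
    simp only [iterate_derivative_sub, sub_mul, Finset.sum_sub_distrib, h1, h2]; simp)
  intro k
  have h4 := congrArg (fun q => coeff q k) (sub_eq_zero.1 h3)
  simpa using h4

end T
end
end WS

open Polynomial Filter Topology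
open scoped Matrix

namespace WS
noncomputable section

/-! ## Part 3 : counting real reduced bases -/

/-- counting lemma with filters -/
lemma count_filter {X T Λ : Type*} [Fintype Λ] (l : Filter T) (S : T → Set X) (F : Λ → Filter X)
    (h1 : ∀ α, ∀ U ∈ F α, ∀ᶠ τ in l, ∃ x ∈ U, x ∈ S τ)
    (h2 : ∀ α, ∃ U ∈ F α, ∀ᶠ τ in l, (U ∩ S τ).Subsingleton)
    (h3 : ∀ U : Λ → Set X, (∀ α, U α ∈ F α) → ∀ᶠ τ in l, S τ ⊆ ⋃ α, U α)
    (h4 : ∀ α β, α ≠ β → Disjoint (F α) (F β)) :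
    ∀ᶠ τ in l, (S τ).ncard = Fintype.card Λ := by
  classical
  have h5 : ∀ α β, ∃ V W, V ∈ F α ∧ W ∈ F β ∧ (α ≠ β → Disjoint V W) := by
    intro α β
    by_cases h : α = β
    · exact ⟨Set.univ, Set.univ, univ_mem, univ_mem, fun h' => absurd h h'⟩
    · obtain ⟨V, hV, W, hW, hd⟩ := Filter.disjoint_iff.1 (h4 α β h)
      exact ⟨V, W, hV, hW, fun _ => hd⟩
  choose V W hV hW hVW using h5
  choose U0 hU0 hsub using h2
  set U : Λ → Set X := fun α => U0 α ∩ (⋂ β, V α β) ∩ (⋂ β, W β α) with hU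
  have hUF : ∀ α, U α ∈ F α := fun α => inter_mem (inter_mem (hU0 α)
    (iInter_mem.2 fun β => hV α β)) (iInter_mem.2 fun β => hW β α)
  have hdis : ∀ α β, α ≠ β → ∀ x, x ∈ U α → x ∈ U β → False := by
    intro α β hne x hx hx'
    exact Set.disjoint_left.1 (hVW α β hne) (Set.mem_iInter.1 hx.1.2 β) (Set.mem_iInter.1 hx'.2 α)
  have e1 : ∀ᶠ τ in l, ∀ α, ∃ x ∈ U α, x ∈ S τ := eventually_all.2 fun α => h1 α _ (hUF α)
  have e2 : ∀ᶠ τ in l, ∀ α, (U0 α ∩ S τ).Subsingleton := eventually_all.2 fun α => hsub α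
  filter_upwards [e1, e2, h3 U hUF] with τ he1 he2 he3
  choose x hxU hxS using he1
  have hinj : Function.Injective x := by
    intro α β h
    by_contra hne
    exact hdis α β hne _ (hxU α) (h ▸ hxU β)
  have hS : S τ = Set.range x := by
    ext z
    constructor
    · intro hz
      obtain ⟨α, hα⟩ := Set.mem_iUnion.1 (he3 hz)
      exact ⟨α, he2 α ⟨(hxU α).1.1, hxS α⟩ ⟨hα.1.1, hz⟩⟩
    · rintro ⟨α, rfl⟩; exact hxS α
  rw [hS, ← Set.image_univ, Set.ncard_image_of_injective _ hinj, Set.ncard_univ, Nat.card_eq_fintype_card]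

/-- implicit function theorem for a chart -/
lemma chart_ift {ι : Type*} [Fintype ι] {M m : ℕ} (hι : Fintype.card ι = M) (Φ : (ι → ℝ) → ℝ[X]) (hΦ : SmoothP Φ)
    (hs : ∀ y k, (Φ y).coeff k ≠ 0 → ∃ r ≤ M, k = m + 2 * r) (h : ℝ → ℝ[X]) (hh : SmoothP h)
    (hhs : ∀ τ k, (h τ).coeff k ≠ 0 → ∃ r ≤ M, k = m + 2 * r) (c0 : ℝ) (hc0 : c0 ≠ 0) (hc : ∀ τ, (h τ).coeff m = c0)
    (y0 : ι → ℝ) (τ0 : ℝ) (γ0 : ℝ) (hsol : Φ y0 = C γ0 * h τ0)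
    (hnd : ∀ (v : ι → ℝ) (g : ℝ), (∀ k, HasDerivAt (fun s : ℝ => (Φ (y0 + s • v)).coeff k) (g * (h τ0).coeff k) 0) → v = 0) :
    (∀ V ∈ 𝓝 y0, ∀ᶠ τ in 𝓝 τ0, ∃ y ∈ V, ∃ γ, Φ y = C γ * h τ) ∧
    ∃ V ∈ 𝓝 y0, ∀ᶠ τ in 𝓝 τ0, ∀ y ∈ V, ∀ y' ∈ V, (∃ γ, Φ y = C γ * h τ) → (∃ γ, Φ y' = C γ * h τ) → y = y' := by
  let Ψ : ℝ × (ι → ℝ) → ℝ[X] := fun x => C c0 * Φ x.2 - C ((Φ x.2).coeff m) * h x.1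
  have hΨ : SmoothP Ψ := by
    refine ((SmoothP.const _).mul (hΦ.comp contDiff_snd)).sub ((SmoothP.C ?_).mul (hh.comp contDiff_fst))
    exact (hΦ m).comp contDiff_snd
  let Θ : ℝ × (ι → ℝ) → ℝ × (Fin M → ℝ) := fun x => (x.1, fun k => (Ψ x).coeff (m + 2 * ((k : ℕ) + 1)))
  have hΘ : ContDiff ℝ 1 Θ := by
    refine contDiff_fst.prodMk ?_
    rw [contDiff_pi]; intro k; exact hΨ _
  have hzero : ∀ τ y, (∃ γ, Φ y = C γ * h τ) ↔ Θ (τ, y) = (τ, 0) := by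
    intro τ y
    constructor
    · rintro ⟨γ, hγ⟩
      simp only [Θ, Prod.mk.injEq, true_and]
      ext k
      simp only [Ψ, hγ, coeff_sub, coeff_C_mul, hc, Pi.zero_apply]; ring
    · intro hT
      refine ⟨(Φ y).coeff m / c0, ?_⟩
      ext k
      rw [coeff_C_mul]
      by_cases hk : ∃ r ≤ M, k = m + 2 * r
      · obtain ⟨r, hr, rfl⟩ := hk
        rcases Nat.eq_zero_or_pos r with rfl | hr0
        · simp only [mul_zero, add_zero, hc]; field_simp
        · have := congrFun (congrArg Prod.snd hT) ⟨r - 1, by omega⟩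
          simp only [Θ, Ψ, coeff_sub, coeff_C_mul, Pi.zero_apply, Nat.sub_add_cancel hr0] at this
          field_simp
          linarith
      · rw [not_imp_comm.1 (hs y k) hk, not_imp_comm.1 (hhs τ k) hk, mul_zero]
  obtain ⟨hmap, U, hU, hinj⟩ := ift Θ hΘ (τ0, y0) (by simp [hι]) (by
    rintro ⟨t, v⟩ hv
    have hv1 : HasDerivAt (fun s : ℝ => τ0 + s * t) 0 0 := by
      have := (hasFDerivAt_fst (𝕜 := ℝ)).comp_hasDerivAt (0:ℝ) hv
      simpa [Θ, Function.comp_def] using this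
    have ht : t = 0 := by
      have h1 : HasDerivAt (fun s : ℝ => τ0 + s * t) t 0 := by
        simpa using ((hasDerivAt_id (0 : ℝ)).mul_const t).const_add τ0
      exact h1.unique hv1
    subst ht
    have hv2 : HasDerivAt (fun s : ℝ => (Θ ((τ0, y0) + s • ((0 : ℝ), v))).2) 0 0 := by
      have := (hasFDerivAt_snd (𝕜 := ℝ)).comp_hasDerivAt (0:ℝ) hv
      simpa only [Function.comp_def, map_zero] using this
    rw [hasDerivAt_pi] at hv2
    have hdf : ∀ k, DifferentiableAt ℝ (fun s : ℝ => (Φ (y0 + s • v)).coeff k) 0 := by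
      intro k
      refine (((hΦ k).differentiable one_ne_zero).differentiableAt).comp (0 : ℝ) ?_
      fun_prop
    have hv0 := hnd v (deriv (fun s : ℝ => (Φ (y0 + s • v)).coeff m) 0 / c0) (by
      intro k
      by_cases hk : ∃ r ≤ M, k = m + 2 * r
      · obtain ⟨r, hr, rfl⟩ := hk
        rcases Nat.eq_zero_or_pos r with rfl | hr0
        · simp only [mul_zero, add_zero, hc]
          rw [div_mul_cancel₀ _ hc0]
          exact (hdf m).hasDerivAt
        · have h1 := hv2 ⟨r - 1, by omega⟩
          simp only [Θ, Ψ, coeff_sub, coeff_C_mul, Nat.sub_add_cancel hr0, Prod.fst_add, Prod.smul_fst, Prod.snd_add,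
            Prod.smul_snd, smul_zero, add_zero, Prod.mk_add_mk, Prod.smul_mk] at h1
          have h2 := ((hdf (m + 2 * r)).hasDerivAt.const_mul c0).fun_sub ((hdf m).hasDerivAt.mul_const ((h τ0).coeff (m + 2 * r)))
          have h3 := h1.unique h2
          have h4 : deriv (fun s : ℝ => (Φ (y0 + s • v)).coeff m) 0 / c0 * (h τ0).coeff (m + 2 * r) =
             deriv (fun s : ℝ => (Φ (y0 + s • v)).coeff (m + 2 * r)) 0 := by
            rw [Pi.zero_apply] at h3
            field_simp; linarith
          rw [h4]; exact (hdf _).hasDerivAt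
      · rw [not_imp_comm.1 (hhs τ0 k) hk, mul_zero]
        have : (fun s : ℝ => (Φ (y0 + s • v)).coeff k) = fun _ => 0 := by
          ext s; exact not_imp_comm.1 (hs _ k) hk
        rw [this]; exact hasDerivAt_const _ _)
    rw [hv0]; rfl)
  have hT0 : Θ (τ0, y0) = (τ0, 0) := (hzero τ0 y0).1 ⟨γ0, hsol⟩
  rw [hT0] at hmap
  have hline : Tendsto (fun τ : ℝ => (τ, (0 : Fin M → ℝ))) (𝓝 τ0) (𝓝 (τ0, 0)) := by
    exact (Continuous.prodMk_left (0 : Fin M → ℝ)).tendsto τ0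
  constructor
  · intro V hV
    have h1 : Θ '' (Set.univ ×ˢ V) ∈ 𝓝 ((τ0, 0) : ℝ × (Fin M → ℝ)) := by
      rw [← hmap]; exact image_mem_map (prod_mem_nhds univ_mem hV)
    filter_upwards [hline h1] with τ hτ
    obtain ⟨⟨τ', y⟩, hy, hy2⟩ := hτ
    have : τ' = τ := congrArg Prod.fst hy2
    subst this
    exact ⟨y, hy.2, (hzero _ _).2 hy2⟩
  · obtain ⟨I, hI, V, hV, hIV⟩ := mem_nhds_prod_iff.1 hU
    refine ⟨V, hV, ?_⟩
    filter_upwards [hI] with τ hτ y hy y' hy' h1 h2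
    have := hinj (hIV ⟨hτ, hy⟩) (hIV ⟨hτ, hy'⟩) (((hzero _ _).1 h1).trans ((hzero _ _).1 h2).symm)
    exact congrArg Prod.snd this

end
end WS

open Polynomial Filter Topology
open scoped Matrix

namespace WS
noncomputable section

section nrm
set_option linter.unusedSectionVars false
variable {K : Type*} [Field K] [CharZero K] {d : ℕ}

/-- matrix of the coefficients at positions `J` -/
def At (J : Fin d → ℕ) (f : Fin d → K[X]) : Matrix (Fin d) (Fin d) K :=
  Matrix.of fun i t => (f i).coeff (J t)

/-- action of matrices on families -/
def act (A : Matrix (Fin d) (Fin d) K) (f : Fin d → K[X]) : Fin d → K[X] :=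
  fun i => ∑ k, C (A i k) * f k

/-- normalisation of a family at positions `J` -/
def nrm (J : Fin d → ℕ) (f : Fin d → K[X]) : Fin d → K[X] := act (At J f)⁻¹ f

lemma act_coeff (A : Matrix (Fin d) (Fin d) K) (f : Fin d → K[X]) (i : Fin d) (k : ℕ) :
    (act A f i).coeff k = ∑ r, A i r * (f r).coeff k := by
  simp [act, finsetSum_coeff]

lemma At_act (J : Fin d → ℕ) (A : Matrix (Fin d) (Fin d) K) (f : Fin d → K[X]) : At J (act A f) = A * At J f := by
  ext i t
  simp [At, act_coeff, Matrix.mul_apply]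

lemma act_act (A B : Matrix (Fin d) (Fin d) K) (f : Fin d → K[X]) : act A (act B f) = act (A * B) f := by
  ext i k
  rw [act_coeff, act_coeff]
  simp only [act_coeff, Matrix.mul_apply, Finset.mul_sum, Finset.sum_mul]
  rw [Finset.sum_comm]
  simp only [mul_assoc]

lemma act_one (f : Fin d → K[X]) : act 1 f = f := by
  ext i k
  simp [act_coeff, Matrix.one_apply]

lemma nrm_act (J : Fin d → ℕ) (A : Matrix (Fin d) (Fin d) K) (hA : A.det ≠ 0) (f : Fin d → K[X]) :
    nrm J (act A f) = nrm J f := by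
  rw [nrm, At_act, act_act, Matrix.mul_inv_rev, mul_assoc, Matrix.nonsing_inv_mul _ (isUnit_iff_ne_zero.2 hA), mul_one, nrm]

lemma At_nrm {J : Fin d → ℕ} {f : Fin d → K[X]} (h : (At J f).det ≠ 0) : At J (nrm J f) = 1 := by
  rw [nrm, At_act, Matrix.nonsing_inv_mul _ (isUnit_iff_ne_zero.2 h)]

lemma nrm_of_one {J : Fin d → ℕ} {f : Fin d → K[X]} (h : At J f = 1) : nrm J f = f := by
  rw [nrm, h, inv_one, act_one]

lemma det_inv_ne {A : Matrix (Fin d) (Fin d) K} (h : A.det ≠ 0) : (A⁻¹).det ≠ 0 := by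
  rw [Matrix.det_nonsing_inv, Ring.inverse_eq_inv']; exact inv_ne_zero h

lemma nrm_nrm (J J' : Fin d → ℕ) {f : Fin d → K[X]} (h : (At J' f).det ≠ 0) : nrm J (nrm J' f) = nrm J f := by
  conv_lhs => rw [show nrm J' f = act (At J' f)⁻¹ f from rfl]
  exact nrm_act _ _ (det_inv_ne h) _

lemma act_nrm {J : Fin d → ℕ} {f : Fin d → K[X]} (h : (At J f).det ≠ 0) : act (At J f) (nrm J f) = f := by
  rw [nrm, act_act, Matrix.mul_nonsing_inv _ (isUnit_iff_ne_zero.2 h), act_one]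

lemma wr_act (A : Matrix (Fin d) (Fin d) K) (f : Fin d → K[X]) : wr (act A f) = C A.det * wr f := wr_mul A f

lemma wr_nrm (J : Fin d → ℕ) (f : Fin d → K[X]) : wr (nrm J f) = C ((At J f)⁻¹).det * wr f := wr_act _ _

lemma At_det_nrm (J J' : Fin d → ℕ) (f : Fin d → K[X]) : (At J (nrm J' f)).det = ((At J' f)⁻¹).det * (At J f).det := by
  rw [nrm, At_act, Matrix.det_mul]

lemma nrm_cramer {J : Fin d → ℕ} {f : Fin d → K[X]} (h : (At J f).det ≠ 0) (t : Fin d) (k : ℕ) :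
    (At J f).det * (nrm J f t).coeff k = (At (Function.update J t k) f).det := by
  have h1 := congrFun (Matrix.det_smul_inv_mulVec_eq_cramer (At J f) (fun i => (f i).coeff k) (isUnit_iff_ne_zero.2 h)) t
  rw [Matrix.cramer_apply] at h1
  have h2 : (At (Function.update J t k) f) = (At J f).updateCol t (fun i => (f i).coeff k) := by
    ext i s
    by_cases hs : s = t
    · subst hs; simp [At]
    · simp [At, hs]
  rw [h2, ← h1]
  simp [nrm, act_coeff, Matrix.mulVec, dotProduct]

lemma At_inj {J : Fin d → ℕ} {f : Fin d → K[X]} (h : (At J f).det ≠ 0) : Function.Injective J := by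
  intro s t hst
  by_contra hne
  exact h (Matrix.det_zero_of_column_eq hne fun i => by simp [At, hst])

lemma At_lt {J : Fin d → ℕ} {f : Fin d → K[X]} (h : (At J f).det ≠ 0) {D : ℕ} (hD : ∀ i, (f i).natDegree < D) (t : Fin d) :
    J t < D := by
  by_contra hne
  exact h (Matrix.det_eq_zero_of_column_eq_zero t fun i => by
    simp only [At, Matrix.of_apply]; exact coeff_eq_zero_of_natDegree_lt (lt_of_lt_of_le (hD i) (not_lt.1 hne)))

/-- reduced echelon form -/
lemma echelon {J0 : Fin d → ℕ} {f : Fin d → K[X]} (h : (At J0 f).det ≠ 0) :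
    ∃ J, (At J f).det ≠ 0 ∧ ∀ t, (nrm J f t).natDegree ≤ J t := by
  classical
  obtain ⟨D, hD⟩ := exists_bound f
  let S : Finset (Fin d → Fin D) := Finset.univ.filter fun e => (At (fun t => (e t : ℕ)) f).det ≠ 0
  have hS : S.Nonempty := ⟨fun t => ⟨J0 t, At_lt h hD t⟩, by simp [S, h]⟩
  obtain ⟨e, he, hmax⟩ := Finset.exists_max_image S (fun e => ∑ t, (e t : ℕ)) hS
  have he' : (At (fun t => (e t : ℕ)) f).det ≠ 0 := (Finset.mem_filter.1 he).2
  refine ⟨fun t => (e t : ℕ), he', fun t => ?_⟩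
  rw [natDegree_le_iff_coeff_eq_zero]
  intro k hk
  by_contra hne
  have h1 := nrm_cramer he' t k
  have h2 : (At (Function.update (fun t => (e t : ℕ)) t k) f).det ≠ 0 := by
    rw [← h1]; exact mul_ne_zero he' hne
  have h3 : k < D := by simpa using At_lt h2 hD t
  have h4 : (fun s => ((Function.update e t ⟨k, h3⟩ s : Fin D) : ℕ)) = Function.update (fun t => (e t : ℕ)) t k := by
    ext s; by_cases hs : s = t
    · subst hs; simp
    · simp [hs]
  have h5 := hmax (Function.update e t ⟨k, h3⟩) (by
    simp only [S, Finset.mem_filter, Finset.mem_univ, true_and]; rw [h4]; exact h2)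
  refine absurd h5 (not_le.2 ?_)
  refine Finset.sum_lt_sum (fun s _ => ?_) ⟨t, Finset.mem_univ _, by simpa using hk⟩
  by_cases hs : s = t
  · subst hs; simpa using hk.le
  · simp [hs]

lemma coeff_of_At_one {J : Fin d → ℕ} {f : Fin d → K[X]} (h : At J f = 1) (i t : Fin d) :
    (f i).coeff (J t) = if i = t then 1 else 0 := by
  have := congrFun (congrFun h i) t
  simpa [At, Matrix.one_apply] using this

lemma sum_of_lead {J : Fin d → ℕ} {f : Fin d → K[X]} (h : At J f = 1) (hJ : Function.Injective J)
    (hd : ∀ i, (f i).natDegree ≤ J i) :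
    (wr f).coeff (∑ i, J i - tri d) ≠ 0 ∧ ∑ i, J i = (wr f).natDegree + tri d := by
  have h0 := tri_le_sum J hJ
  have h1 := wr_lead f J hd (∑ i, J i - tri d) (by omega)
  have h2 : (wr f).coeff (∑ i, J i - tri d) ≠ 0 := by
    rw [h1]; simp only [coeff_of_At_one h, if_true, Finset.prod_const_one, mul_one]
    exact vander_ne J hJ
  refine ⟨h2, ?_⟩
  have h3 := le_natDegree_of_ne_zero h2
  have h4 : (wr f) ≠ 0 := by intro h; simp [h] at h2
  have h5 := wr_natDegree_le f J hd (wr f).natDegree (by simpa using h4)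
  omega

lemma wr_ne {J : Fin d → ℕ} {f : Fin d → K[X]} (h : (At J f).det ≠ 0) : wr f ≠ 0 := by
  obtain ⟨J', h', hd⟩ := echelon h
  have := (sum_of_lead (At_nrm h') (At_inj h') hd).1
  intro h0
  rw [wr_nrm, h0] at this
  simp at this

lemma perm_eq {J l : Fin d → ℕ} (σ : Equiv.Perm (Fin d)) (h : ∀ i, J (σ i) ≤ l i) (hs : ∑ i, J i = ∑ i, l i) :
    ∀ i, J (σ i) = l i := by
  have h1 : ∑ i, J (σ i) = ∑ i, l i := by rw [← hs]; exact Equiv.sum_comp σ J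
  intro i
  exact (Finset.sum_eq_sum_iff_of_le fun i _ => h i).1 h1 i (Finset.mem_univ i)

lemma det_perm {A : Matrix (Fin d) (Fin d) K} (h : A.det ≠ 0) : ∃ σ : Equiv.Perm (Fin d), ∀ i, A i (σ i) ≠ 0 := by
  rw [← Matrix.det_transpose, Matrix.det_apply] at h
  obtain ⟨σ, -, hσ⟩ := Finset.exists_ne_zero_of_sum_ne_zero h
  refine ⟨σ, fun i hi => hσ ?_⟩
  rw [Finset.prod_eq_zero (Finset.mem_univ i) (by simpa using hi), smul_zero]

lemma tri_det {l : Fin d → ℕ} (hl : Function.Injective l) {f : Fin d → K[X]} (hf : ∀ i, (f i).natDegree ≤ l i) :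
    (At l f).det = ∏ i, (f i).coeff (l i) := by
  rw [← Matrix.det_transpose, Matrix.det_apply, Finset.sum_eq_single 1]
  · simp [At]
  · intro σ _ hσ
    by_contra hne
    have h1 : ∀ i, l (σ i) ≤ l i := by
      intro i
      by_contra hlt
      refine hne ?_
      rw [Finset.prod_eq_zero (Finset.mem_univ i), smul_zero]
      simp only [At, Matrix.transpose_apply, Matrix.of_apply]
      exact coeff_eq_zero_of_natDegree_lt (lt_of_le_of_lt (hf i) (not_le.1 hlt))
    have h2 := perm_eq (J := l) σ h1 rfl
    exact hσ (Equiv.ext fun i => hl (h2 i))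
  · simp

lemma inv_triang {l : Fin d → ℕ} {A : Matrix (Fin d) (Fin d) K} (hA : A.det ≠ 0)
    (h : ∀ i t, A i t ≠ 0 → l t ≤ l i) : ∀ i t, A⁻¹ i t ≠ 0 → l t ≤ l i := by
  intro i t hit
  haveI : Invertible A := A.invertibleOfIsUnitDet (isUnit_iff_ne_zero.2 hA)
  have hb : Matrix.BlockTriangular A (fun i => OrderDual.toDual (l i)) := by
    intro i t hlt
    by_contra hne
    have := h i t hne
    exact absurd (OrderDual.toDual_lt_toDual.1 hlt) (not_lt.2 this)
  have := Matrix.blockTriangular_inv_of_blockTriangular hb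
  by_contra hlt
  exact hit (this (OrderDual.toDual_lt_toDual.2 (not_le.1 hlt)))

lemma nrm_perm (J : Fin d → ℕ) (σ : Equiv.Perm (Fin d)) (f : Fin d → K[X]) (t : Fin d) :
    nrm (J ∘ σ) f t = nrm J f (σ t) := by
  have h1 : At (J ∘ σ) f = (At J f).submatrix (Equiv.refl _) σ := by ext i s; simp [At]
  rw [nrm, h1, Matrix.inv_submatrix_equiv, nrm]
  simp [act]

lemma At_perm (J : Fin d → ℕ) (σ : Equiv.Perm (Fin d)) (f : Fin d → K[X]) (h : (At J f).det ≠ 0) :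
    (At (J ∘ σ) f).det ≠ 0 := by
  have h1 : At (J ∘ σ) f = (At J f).submatrix id σ := by ext i s; simp [At]
  rw [h1, Matrix.det_permute']
  refine mul_ne_zero ?_ h
  rcases Int.units_eq_one_or (Equiv.Perm.sign σ) with h | h <;> simp [h]

/-- parity of normalised families -/
lemma nrm_parity {J l : Fin d → ℕ} {f : Fin d → K[X]} (h : (At J f).det ≠ 0)
    (hf : ∀ i k, (f i).coeff k ≠ 0 → k % 2 = l i % 2) (t : Fin d) (k : ℕ) (hk : (nrm J f t).coeff k ≠ 0) :
    k % 2 = J t % 2 := by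
  -- the part of the combination with the wrong parity
  let c : Fin d → K := fun i => if l i % 2 = J t % 2 then 0 else (At J f)⁻¹ t i
  have h0 : ∀ q, ∑ i, c i * (f i).coeff q = if q % 2 = J t % 2 then 0 else (nrm J f t).coeff q := by
    intro q
    rw [nrm, act_coeff]
    split_ifs with hq
    · refine Finset.sum_eq_zero fun i _ => ?_
      by_cases hi : (f i).coeff q = 0
      · rw [hi, mul_zero]
      · have := hf i q hi
        simp [c, ← this, hq]
    · refine Finset.sum_congr rfl fun i _ => ?_
      by_cases hi : (f i).coeff q = 0
      · rw [hi, mul_zero, mul_zero]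
      · have := hf i q hi
        simp [c, ← this, hq]
  have h1 : c ᵥ* At J f = 0 := by
    ext s
    simp only [Matrix.vecMul, dotProduct, At, Matrix.of_apply, Pi.zero_apply]
    rw [h0]
    split_ifs with hs
    · rfl
    · rw [coeff_of_At_one (At_nrm h)]
      rw [if_neg]; rintro rfl; exact hs rfl
  have h2 : c = 0 := by
    have := congrArg (fun v => v ᵥ* (At J f)⁻¹) h1
    simpa [Matrix.vecMul_vecMul, Matrix.mul_nonsing_inv _ (isUnit_iff_ne_zero.2 h)] using this
  by_contra hne
  have h3 := h0 k
  rw [if_neg hne, h2] at h3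
  simp at h3
  exact hk h3.symm

end nrm
end
end WS

open Polynomial Filter Topology
open scoped Matrix

namespace WS
noncomputable section

section cpt
variable {d : ℕ}

/-- reduced families with parity -/
def Red (l : Fin d → ℕ) (f : Fin d → ℝ[X]) : Prop :=
  At l f = 1 ∧ ∀ i k, (f i).coeff k ≠ 0 → k ≤ l i ∧ k % 2 = l i % 2

/-- reduced families whose Wronskian is proportional to `h` -/
def Sol (l : Fin d → ℕ) (h : ℝ[X]) : Set (Fin d → ℝ[X]) := {f | Red l f ∧ ∃ γ, wr f = C γ * h}

/-- coefficientwise neighbourhoods -/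
def nh (G : Fin d → ℝ[X]) : Filter (Fin d → ℝ[X]) :=
  ⨅ i, ⨅ k, comap (fun f : Fin d → ℝ[X] => (f i).coeff k) (𝓝 ((G i).coeff k))

lemma tendsto_nh {Ω : Type*} {u : Filter Ω} {g : Ω → Fin d → ℝ[X]} {G : Fin d → ℝ[X]} :
    Tendsto g u (nh G) ↔ ∀ i k, Tendsto (fun ω => (g ω i).coeff k) u (𝓝 ((G i).coeff k)) := by
  simp only [nh, tendsto_iInf, tendsto_comap_iff, Function.comp_def]

lemma tendsto_At {Ω : Type*} {u : Filter Ω} {g : Ω → Fin d → ℝ[X]} {G : Fin d → ℝ[X]} (h : Tendsto g u (nh G))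
    (J : Fin d → ℕ) : Tendsto (fun ω => At J (g ω)) u (𝓝 (At J G)) := by
  refine tendsto_pi_nhds.2 fun i => tendsto_pi_nhds.2 fun t => ?_
  exact tendsto_nh.1 h i (J t)

lemma tendsto_det {Ω : Type*} {u : Filter Ω} {g : Ω → Fin d → ℝ[X]} {G : Fin d → ℝ[X]} (h : Tendsto g u (nh G))
    (J : Fin d → ℕ) : Tendsto (fun ω => (At J (g ω)).det) u (𝓝 (At J G).det) :=
  ((Continuous.matrix_det continuous_id).tendsto _).comp (tendsto_At h J)

lemma tendsto_nrm {Ω : Type*} {u : Filter Ω} {g : Ω → Fin d → ℝ[X]} {G : Fin d → ℝ[X]} (h : Tendsto g u (nh G))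
    (J : Fin d → ℕ) (hJ : (At J G).det ≠ 0) : Tendsto (fun ω => nrm J (g ω)) u (nh (nrm J G)) := by
  rw [tendsto_nh]
  intro t k
  have h1 := tendsto_det h J
  have h2 := tendsto_det h (Function.update J t k)
  have h3 := h2.div h1 hJ
  have e1 : ∀ F : Fin d → ℝ[X], (At J F).det ≠ 0 → (nrm J F t).coeff k = (At (Function.update J t k) F).det / (At J F).det := by
    intro F hF
    rw [eq_div_iff hF, mul_comm, nrm_cramer hF]
  rw [e1 G hJ]
  refine h3.congr' ?_
  filter_upwards [h1.eventually_ne hJ] with ω hω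
  exact (e1 _ hω).symm

lemma tendsto_wr {Ω : Type*} {u : Filter Ω} {g : Ω → Fin d → ℝ[X]} {G : Fin d → ℝ[X]} (h : Tendsto g u (nh G))
    (D : ℕ) (hD : ∀ᶠ ω in u, ∀ i, (g ω i).natDegree < D) (hG : ∀ i, (G i).natDegree < D) (m : ℕ) :
    Tendsto (fun ω => (wr (g ω)).coeff m) u (𝓝 ((wr G).coeff m)) := by
  rw [wr_coeff G D hG]
  have h1 : Tendsto (fun ω => ∑ r : Fin d → Fin D, if ∑ i, (r i : ℕ) = m + tri d then
      (Matrix.vandermonde (fun i => ((r i : ℕ) : ℝ))).det * ∏ i, (g ω i).coeff (r i) else 0) u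
      (𝓝 (∑ r : Fin d → Fin D, if ∑ i, (r i : ℕ) = m + tri d then
      (Matrix.vandermonde (fun i => ((r i : ℕ) : ℝ))).det * ∏ i, (G i).coeff (r i) else 0)) := by
    refine tendsto_finsetSum _ fun r _ => ?_
    split_ifs
    · exact (tendsto_finsetProd _ fun i _ => tendsto_nh.1 h i (r i)).const_mul _
    · exact tendsto_const_nhds
  refine h1.congr' ?_
  filter_upwards [hD] with ω hω
  exact (wr_coeff (g ω) D hω m).symm

lemma Red.natDegree_le {l : Fin d → ℕ} {f : Fin d → ℝ[X]} (h : Red l f) (i : Fin d) : (f i).natDegree ≤ l i := by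
  rw [natDegree_le_iff_coeff_eq_zero]
  intro k hk
  by_contra hne
  exact absurd (h.2 i k hne).1 (not_le.2 hk)

lemma Red.inj {l : Fin d → ℕ} {f : Fin d → ℝ[X]} (h : Red l f) : Function.Injective l :=
  At_inj (f := f) (by rw [h.1]; simp)

lemma cpt {Ω : Type*} (u : Ultrafilter Ω) (f : Ω → Fin d → ℝ[X]) (l : Fin d → ℕ) (h : Ω → ℝ[X]) (hs : ℝ[X]) (m : ℕ)
    (hm : hs.coeff m ≠ 0) (hh : ∀ k, Tendsto (fun ω => (h ω).coeff k) u (𝓝 (hs.coeff k)))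
    (hf : ∀ᶠ ω in (u : Filter Ω), f ω ∈ Sol l (h ω)) :
    ∃ J G, G ∈ Sol J hs ∧ (∀ t, J t ≤ l t ∧ J t % 2 = l t % 2) ∧ (∀ᶠ ω in (u : Filter Ω), (At J (f ω)).det ≠ 0) ∧
      Tendsto (fun ω => nrm J (f ω)) u (nh G) := by
  classical
  obtain ⟨D, hD⟩ : ∃ D, ∀ i, l i < D :=
    ⟨(Finset.univ.sup l) + 1, fun i => Nat.lt_succ_of_le (Finset.le_sup (f := l) (Finset.mem_univ i))⟩
  haveI : Nonempty (Fin d → Fin D) := ⟨fun i => ⟨l i, hD i⟩⟩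
  have hmax : ∀ ω, ∃ e : Fin d → Fin D, ∀ e' : Fin d → Fin D,
      |(At (fun t => (e' t : ℕ)) (f ω)).det| ≤ |(At (fun t => (e t : ℕ)) (f ω)).det| := fun ω =>
    Finite.exists_max fun e : Fin d → Fin D => |(At (fun t => (e t : ℕ)) (f ω)).det|
  choose e he using hmax
  obtain ⟨e0, he0⟩ := Ultrafilter.eq_pure_of_finite (u.map e)
  have hee : ∀ᶠ ω in (u : Filter Ω), e ω = e0 := by
    have : {e0} ∈ u.map e := by rw [he0]; simp
    exact this
  set E0 : Fin d → ℕ := fun t => (e0 t : ℕ) with hE0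
  set H : Ω → Fin d → ℝ[X] := fun ω => nrm E0 (f ω) with hH
  have hdeg : ∀ᶠ ω in (u : Filter Ω), ∀ i, (f ω i).natDegree < D := by
    filter_upwards [hf] with ω hω i
    exact lt_of_le_of_lt (hω.1.natDegree_le i) (hD i)
  have hdet : ∀ᶠ ω in (u : Filter Ω), (At E0 (f ω)).det ≠ 0 := by
    filter_upwards [hf, hee] with ω h1 h2 h3
    have := he ω (fun i => ⟨l i, hD i⟩)
    rw [h2] at this
    simp only [h1.1.1] at this
    rw [h3] at this
    simp at this
    linarith
  have hbig : ∀ᶠ ω in (u : Filter Ω), ∀ t k, D ≤ k → (H ω t).coeff k = 0 := by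
    filter_upwards [hdeg] with ω h1 t k hk
    rw [hH]; simp only [nrm, act_coeff]
    refine Finset.sum_eq_zero fun i _ => ?_
    rw [coeff_eq_zero_of_natDegree_lt (lt_of_lt_of_le (h1 i) hk), mul_zero]
  have hbd : ∀ᶠ ω in (u : Filter Ω), ∀ t k, (H ω t).coeff k ∈ Set.Icc (-1 : ℝ) 1 := by
    filter_upwards [hbig, hdet, hee] with ω h1 h2 h3 t k
    rcases lt_or_ge k D with hk | hk
    · have h4 := nrm_cramer h2 t k
      have h5 := he ω (Function.update e0 t ⟨k, hk⟩)
      rw [h3] at h5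
      have h6 : (fun s => ((Function.update e0 t ⟨k, hk⟩ s : Fin D) : ℕ)) = Function.update E0 t k := by
        ext s; by_cases hs : s = t
        · subst hs; simp
        · simp [hs, hE0]
      rw [h6, ← h4, abs_mul] at h5
      have h7 : 0 < |(At E0 (f ω)).det| := abs_pos.2 h2
      have h8 : |(nrm E0 (f ω) t).coeff k| ≤ 1 := by
        by_contra hlt
        nlinarith [not_le.1 hlt]
      exact abs_le.1 h8
    · rw [h1 t k hk]; simp
  have hlim : ∀ t k, ∃ c, Tendsto (fun ω => (H ω t).coeff k) u (𝓝 c) := by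
    intro t k
    obtain ⟨c, -, hc⟩ := isCompact_Icc.ultrafilter_le_nhds (u.map fun ω => (H ω t).coeff k)
      (s := Set.Icc (-1 : ℝ) 1) (by
        rw [le_principal_iff]
        change ∀ᶠ ω in (u : Filter Ω), (H ω t).coeff k ∈ Set.Icc (-1 : ℝ) 1
        filter_upwards [hbd] with ω hω
        exact hω t k)
    exact ⟨c, hc⟩
  choose c hc using hlim
  set Hs : Fin d → ℝ[X] := fun t => ∑ k ∈ Finset.range D, C (c t k) * X ^ k with hHs
  have hHsc : ∀ t k, (Hs t).coeff k = if k < D then c t k else 0 := by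
    intro t k
    simp [hHs, finsetSum_coeff, coeff_X_pow]
  have hHsd : ∀ t, (Hs t).natDegree < D := by
    intro t
    have : 0 < D := lt_of_le_of_lt (Nat.zero_le _) (hD t)
    refine lt_of_le_of_lt (natDegree_le_iff_coeff_eq_zero.2 fun k hk => ?_) (Nat.sub_lt this one_pos)
    rw [hHsc, if_neg (by omega)]
  have hHt : Tendsto H u (nh Hs) := by
    rw [tendsto_nh]
    intro t k
    rw [hHsc]
    split_ifs with hk
    · exact hc t k
    · refine tendsto_const_nhds.congr' ?_
      filter_upwards [hbig] with ω hω
      exact (hω t k (not_lt.1 hk)).symm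
  have hHs1 : At E0 Hs = 1 := by
    refine tendsto_nhds_unique (tendsto_At hHt E0) (tendsto_const_nhds.congr' ?_)
    filter_upwards [hdet] with ω hω
    exact (At_nrm hω).symm
  obtain ⟨J0, hJ0, hJd⟩ := echelon (J0 := E0) (f := Hs) (by rw [hHs1]; simp)
  have hJf : ∀ᶠ ω in (u : Filter Ω), (At J0 (f ω)).det ≠ 0 := by
    filter_upwards [(tendsto_det hHt J0).eventually_ne hJ0] with ω hω h0
    rw [hH] at hω
    simp only at hω
    rw [At_det_nrm, h0, mul_zero] at hω
    exact hω rfl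
  obtain ⟨ω0, hω1, hω2⟩ := (hJf.and hf).exists
  obtain ⟨σ, hσ⟩ := det_perm hω1
  have hJs : (At (J0 ∘ σ) Hs).det ≠ 0 := At_perm _ _ _ hJ0
  have hJtend : Tendsto (fun ω => nrm (J0 ∘ σ) (f ω)) u (nh (nrm (J0 ∘ σ) Hs)) := by
    refine (tendsto_nrm hHt _ hJs).congr' ?_
    filter_upwards [hdet] with ω hω
    exact nrm_nrm _ _ hω
  have hJff : ∀ᶠ ω in (u : Filter Ω), (At (J0 ∘ σ) (f ω)).det ≠ 0 := by
    filter_upwards [hJf] with ω hω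
    exact At_perm _ _ _ hω
  refine ⟨J0 ∘ σ, nrm (J0 ∘ σ) Hs, ⟨⟨At_nrm hJs, fun t k hk => ⟨?_, ?_⟩⟩, ?_⟩, fun t => ?_, hJff, hJtend⟩
  · have h1 := le_natDegree_of_ne_zero hk
    rw [nrm_perm] at h1
    exact h1.trans (hJd _)
  · obtain ⟨ω, h1, h2, h3⟩ := (((tendsto_nh.1 hJtend t k).eventually_ne hk).and (hJff.and hf)).exists
    exact nrm_parity h2 (fun i k hik => (h3.1.2 i k hik).2) t k h1
  · have hHd : ∀ᶠ ω in (u : Filter Ω), ∀ i, (H ω i).natDegree < D := by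
      filter_upwards [hbig] with ω h1 t
      have : 0 < D := lt_of_le_of_lt (Nat.zero_le _) (hD t)
      exact lt_of_le_of_lt (natDegree_le_iff_coeff_eq_zero.2 fun k hk => h1 t k (by omega)) (Nat.sub_lt this one_pos)
    have hw : ∀ k, (wr Hs).coeff k * hs.coeff m = (wr Hs).coeff m * hs.coeff k := by
      intro k
      have t1 := (tendsto_wr hHt D hHd hHsd k).mul (hh m)
      have t2 := (tendsto_wr hHt D hHd hHsd m).mul (hh k)
      refine tendsto_nhds_unique t1 (t2.congr' ?_)
      filter_upwards [hf] with ω hω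
      obtain ⟨γ, hγ⟩ := hω.2
      simp only [hH, wr_nrm, hγ, coeff_C_mul]; ring
    refine ⟨((At (J0 ∘ σ) Hs)⁻¹).det * ((wr Hs).coeff m / hs.coeff m), ?_⟩
    rw [wr_nrm, C_mul, mul_assoc]
    congr 1
    ext k
    rw [coeff_C_mul]
    field_simp
    exact hw k
  · exact hω2.1.2 t _ (hσ t)

end cpt
end
end WS

open Polynomial Filter Topology
open scoped Matrix

namespace WS
noncomputable section

section chart
variable {d : ℕ}

/-- all positions of the right parity -/
def Tot (l : Fin d → ℕ) : Finset (Fin d × ℕ) :=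
  (Finset.univ ×ˢ Finset.range (Finset.univ.sup l + 1)).filter fun x => x.2 ≤ l x.1 ∧ x.2 % 2 = l x.1 % 2

lemma mem_Tot {l : Fin d → ℕ} {x : Fin d × ℕ} : x ∈ Tot l ↔ x.2 ≤ l x.1 ∧ x.2 % 2 = l x.1 % 2 := by
  simp only [Tot, Finset.mem_filter, Finset.mem_product, Finset.mem_univ, true_and, Finset.mem_range, and_iff_right_iff_imp]
  intro h
  exact Nat.lt_succ_of_le (h.1.trans (Finset.le_sup (f := l) (Finset.mem_univ x.1)))

/-- free positions of the chart -/
def AA (l J : Fin d → ℕ) : Finset (Fin d × ℕ) := (Tot l).filter fun x => ∀ s, x.2 ≠ J s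

lemma mem_AA {l J : Fin d → ℕ} {x : Fin d × ℕ} : x ∈ AA l J ↔ (x.2 ≤ l x.1 ∧ x.2 % 2 = l x.1 % 2) ∧ ∀ s, x.2 ≠ J s := by
  simp [AA, mem_Tot]

def PP (l J : Fin d → ℕ) : Finset (Fin d × Fin d) :=
  Finset.univ.filter fun x => J x.2 ≤ l x.1 ∧ J x.2 % 2 = l x.1 % 2

lemma card_AA (l J : Fin d → ℕ) (hJ : Function.Injective J) : (AA l J).card + (PP l J).card = (Tot l).card := by
  classical
  have h1 := Finset.card_filter_add_card_filter_not (s := Tot l) (fun x => ∀ s, x.2 ≠ J s)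
  rw [← h1, AA]
  congr 1
  refine Finset.card_bij (fun x _ => (x.1, J x.2)) ?_ ?_ ?_
  · intro x hx
    simp only [PP, Finset.mem_filter, Finset.mem_univ, true_and] at hx
    simp [mem_Tot, hx]
  · intro x _ y _ hxy
    simp only [Prod.mk.injEq] at hxy
    exact Prod.ext hxy.1 (hJ hxy.2)
  · intro x hx
    simp only [Finset.mem_filter, mem_Tot, not_forall, not_not] at hx
    obtain ⟨hx1, s, hs⟩ := hx
    refine ⟨(x.1, s), ?_, ?_⟩
    · simp [PP, ← hs, hx1]
    · simp [← hs]

lemma card_Tot (l : Fin d → ℕ) : (Tot l).card = ∑ i, (l i / 2 + 1) := by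
  classical
  have : (Finset.univ.sigma fun i : Fin d => Finset.range (l i / 2 + 1)).card = (Tot l).card := by
    refine Finset.card_bij (fun x _ => (x.1, 2 * x.2 + l x.1 % 2)) ?_ ?_ ?_
    · rintro ⟨i, r⟩ hx
      simp only [Finset.mem_sigma, Finset.mem_univ, true_and, Finset.mem_range] at hx
      simp only [mem_Tot]; omega
    · rintro ⟨i, r⟩ _ ⟨i', r'⟩ _ h
      simp only [Prod.mk.injEq] at h
      obtain ⟨rfl, h⟩ := h
      have : r = r' := by omega
      rw [this]
    · rintro ⟨i, k⟩ hx
      simp only [mem_Tot] at hx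
      refine ⟨⟨i, k / 2⟩, ?_, ?_⟩
      · simp only [Finset.mem_sigma, Finset.mem_univ, true_and, Finset.mem_range]; omega
      · simp only [Prod.mk.injEq, true_and]; omega
  rw [← this, Finset.card_sigma]; simp

lemma card_PP_self (l : Fin d → ℕ) (hl : Function.Injective l) :
    2 * (PP l l).card = (Finset.univ.filter fun x : Fin d × Fin d => l x.2 % 2 = l x.1 % 2).card + d := by
  classical
  have h1 : (PP l l).card = (Finset.univ.filter fun x : Fin d × Fin d => l x.1 ≤ l x.2 ∧ l x.2 % 2 = l x.1 % 2).card := by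
    refine Finset.card_bij (fun x _ => (x.2, x.1)) ?_ ?_ ?_
    · intro x hx
      simp only [PP, Finset.mem_filter, Finset.mem_univ, true_and] at hx ⊢
      exact ⟨hx.1, hx.2.symm⟩
    · intro x _ y _ h; simp only [Prod.mk.injEq] at h; exact Prod.ext h.2 h.1
    · intro x hx
      simp only [Finset.mem_filter, Finset.mem_univ, true_and] at hx
      exact ⟨(x.2, x.1), by simp [PP, hx.1, hx.2], rfl⟩
  have h2 := Finset.card_union_add_card_inter (PP l l)
    (Finset.univ.filter fun x : Fin d × Fin d => l x.1 ≤ l x.2 ∧ l x.2 % 2 = l x.1 % 2)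
  have h3 : PP l l ∪ (Finset.univ.filter fun x : Fin d × Fin d => l x.1 ≤ l x.2 ∧ l x.2 % 2 = l x.1 % 2) =
      Finset.univ.filter fun x : Fin d × Fin d => l x.2 % 2 = l x.1 % 2 := by
    ext x
    simp only [PP, Finset.mem_union, Finset.mem_filter, Finset.mem_univ, true_and]
    have := le_total (l x.1) (l x.2)
    tauto
  have h4 : (PP l l ∩ (Finset.univ.filter fun x : Fin d × Fin d => l x.1 ≤ l x.2 ∧ l x.2 % 2 = l x.1 % 2)).card = d := by
    have : PP l l ∩ (Finset.univ.filter fun x : Fin d × Fin d => l x.1 ≤ l x.2 ∧ l x.2 % 2 = l x.1 % 2) =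
      (Finset.univ : Finset (Fin d)).image fun i => (i, i) := by
      ext x
      simp only [PP, Finset.mem_inter, Finset.mem_filter, Finset.mem_univ, true_and, Finset.mem_image]
      constructor
      · rintro ⟨⟨a, -⟩, b, -⟩
        exact ⟨x.1, Prod.ext rfl (hl (le_antisymm b a))⟩
      · rintro ⟨i, rfl⟩; simp
    rw [this, Finset.card_image_of_injective _ (fun i j h => (Prod.mk.inj h).1)]; simp
  rw [h3, h4] at h2
  omega

lemma card_AA_compare (l k : Fin d → ℕ) (hl : Function.Injective l) (hk : Function.Injective k)
    (hp : ∀ i, k i % 2 = l i % 2) : (AA l l).card + ∑ i, k i / 2 = (AA k k).card + ∑ i, l i / 2 := by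
  have h1 := card_AA l l hl
  have h2 := card_AA k k hk
  have h3 := card_PP_self l hl
  have h4 := card_PP_self k hk
  simp only [hp] at h4
  rw [card_Tot, Finset.sum_add_distrib] at h1 h2
  omega

/-- if the sum is (almost) minimal there are no free positions -/
lemma AA_empty (l : Fin d → ℕ) (hl : Function.Injective l) (m : ℕ) (hm : m ≤ 1) (hs : ∑ i, l i = m + tri d) : AA l l = ∅ := by
  classical
  rw [Finset.eq_empty_iff_forall_notMem]
  rintro ⟨i, k⟩ hx
  rw [mem_AA] at hx
  obtain ⟨⟨h1, h2⟩, h3⟩ := hx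
  simp only at h1 h2 h3
  have h4 : Function.Injective (Function.update l i k) := by
    intro a b hab
    by_cases ha : a = i <;> by_cases hb : b = i
    · rw [ha, hb]
    · subst ha; simp [hb] at hab; exact absurd hab (h3 b)
    · subst hb; simp [ha] at hab; exact absurd hab.symm (h3 a)
    · simp [ha, hb] at hab; exact hl hab
  have h5 := tri_le_sum _ h4
  have h6 := Finset.sum_update_of_mem (Finset.mem_univ i) l k
  have h7 := Finset.add_sum_erase Finset.univ l (Finset.mem_univ i)
  rw [Finset.sdiff_singleton_eq_erase] at h6
  have := h3 i
  omega

/-- existence of a solution forces the number of free positions -/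
lemma card_of_point {l : Fin d → ℕ} {h : ℝ[X]} {m M : ℕ} (hm : m ≤ 1) (hc : h.coeff m ≠ 0)
    (hs : ∑ i, l i = 2 * M + m + tri d) {f : Fin d → ℝ[X]} (hf : f ∈ Sol l h) : (AA l l).card = M := by
  obtain ⟨γ, hγ⟩ := hf.2
  have h0 : wr f ≠ 0 := wr_ne (J := l) (by rw [hf.1.1]; simp)
  have hγ0 : γ ≠ 0 := by rintro rfl; simp [hγ] at h0
  obtain ⟨k, hk, hk1, hk2⟩ := wr_supp f m (by rw [hγ, coeff_C_mul]; exact mul_ne_zero hγ0 hc)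
  have h1 := card_AA_compare l k hf.1.inj hk (fun i => (hf.1.2 i _ (hk1 i)).2)
  rw [AA_empty k hk m hm hk2] at h1
  have h2 : ∑ i, l i = ∑ i, (2 * (l i / 2) + k i % 2) :=
    Finset.sum_congr rfl fun i _ => by have := (hf.1.2 i _ (hk1 i)).2; omega
  have h3 : ∑ i, k i = ∑ i, (2 * (k i / 2) + k i % 2) := Finset.sum_congr rfl fun i _ => by omega
  rw [Finset.sum_add_distrib, ← Finset.mul_sum] at h2 h3
  simp only [Finset.card_empty, zero_add] at h1
  omega

structure Chart (l J : Fin d → ℕ) : Prop where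
  hl : Function.Injective l
  hJ : Function.Injective J
  le : ∀ t, J t ≤ l t
  par : ∀ t, J t % 2 = l t % 2
  cc : ∀ r t, J t ≤ l r → J t % 2 = l r % 2 → l t ≤ l r

lemma Chart.card {l J : Fin d → ℕ} (c : Chart l J) : (AA l J).card = (AA l l).card := by
  have h1 := card_AA l J c.hJ
  have h2 := card_AA l l c.hl
  have : PP l J = PP l l := by
    ext x
    simp only [PP, Finset.mem_filter, Finset.mem_univ, true_and, c.par]
    constructor
    · rintro ⟨a, b⟩; exact ⟨c.cc _ _ a (by rw [c.par, b]), b⟩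
    · rintro ⟨a, b⟩; exact ⟨(c.le _).trans a, b⟩
  rw [this] at h1
  omega

lemma Chart.refl {l : Fin d → ℕ} (hl : Function.Injective l) : Chart l l :=
  ⟨hl, hl, fun _ => le_rfl, fun _ => rfl, fun _ _ h _ => h⟩

/-- the index can be lowered by two -/
def RR (l : Fin d → ℕ) : Finset (Fin d) := Finset.univ.filter fun i => 2 ≤ l i ∧ ∀ s, l s ≠ l i - 2

def low (l : Fin d → ℕ) (i : Fin d) : Fin d → ℕ := Function.update l i (l i - 2)

lemma mem_RR {l : Fin d → ℕ} {i : Fin d} : i ∈ RR l ↔ 2 ≤ l i ∧ ∀ s, l s ≠ l i - 2 := by simp [RR]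

lemma low_self (l : Fin d → ℕ) (i : Fin d) : low l i i = l i - 2 := by simp [low]
lemma low_ne (l : Fin d → ℕ) {i t : Fin d} (h : t ≠ i) : low l i t = l t := by simp [low, h]

lemma low_inj {l : Fin d → ℕ} (hl : Function.Injective l) {i : Fin d} (hi : i ∈ RR l) : Function.Injective (low l i) := by
  intro a b hab
  have := (mem_RR.1 hi).2
  by_cases ha : a = i <;> by_cases hb : b = i
  · rw [ha, hb]
  · subst ha; rw [low_self, low_ne _ hb] at hab; exact absurd hab.symm (this b)
  · subst hb; rw [low_self, low_ne _ ha] at hab; exact absurd hab (this a)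
  · rw [low_ne _ ha, low_ne _ hb] at hab; exact hl hab

lemma low_sum {l : Fin d → ℕ} {i : Fin d} (hi : i ∈ RR l) : ∑ t, low l i t + 2 = ∑ t, l t := by
  have h6 := Finset.sum_update_of_mem (Finset.mem_univ i) l (l i - 2)
  have h7 := Finset.add_sum_erase Finset.univ l (Finset.mem_univ i)
  rw [Finset.sdiff_singleton_eq_erase] at h6
  have := (mem_RR.1 hi).1
  simp only [low] at *
  omega

lemma Chart.low {l : Fin d → ℕ} (hl : Function.Injective l) {i : Fin d} (hi : i ∈ RR l) : Chart l (low l i) := by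
  have hi' := mem_RR.1 hi
  refine ⟨hl, low_inj hl hi, fun t => ?_, fun t => ?_, fun r t h1 h2 => ?_⟩
  · by_cases ht : t = i
    · subst ht; rw [low_self]; omega
    · rw [low_ne _ ht]
  · by_cases ht : t = i
    · subst ht; rw [low_self]; omega
    · rw [low_ne _ ht]
  · by_cases ht : t = i
    · subst ht; rw [low_self] at h1 h2; have := hi'.2 r; omega
    · rwa [low_ne _ ht] at h1

lemma chart_cases {l J : Fin d → ℕ} (hJ : Function.Injective J) (h : ∀ t, J t ≤ l t ∧ J t % 2 = l t % 2)
    (hs : ∑ t, J t + 2 = ∑ t, l t) : ∃ i ∈ RR l, J = low l i := by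
  obtain ⟨i, hi⟩ : ∃ i, J i ≠ l i := by
    by_contra hne
    push Not at hne
    simp [hne] at hs
  have h1 := Finset.add_sum_erase Finset.univ l (Finset.mem_univ i)
  have h2 := Finset.add_sum_erase Finset.univ J (Finset.mem_univ i)
  have h3 : ∑ t ∈ Finset.univ.erase i, J t ≤ ∑ t ∈ Finset.univ.erase i, l t := Finset.sum_le_sum fun t _ => (h t).1
  have h4 := h i
  have h5 : J i = l i - 2 ∧ 2 ≤ l i ∧ ∑ t ∈ Finset.univ.erase i, J t = ∑ t ∈ Finset.univ.erase i, l t := by omega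
  have h6 := (Finset.sum_eq_sum_iff_of_le fun t (_ : t ∈ Finset.univ.erase i) => (h t).1).1 h5.2.2
  have h7 : ∀ t, t ≠ i → J t = l t := fun t ht => h6 t (by simp [ht])
  refine ⟨i, mem_RR.2 ⟨h5.2.1, fun s hs' => ?_⟩, ?_⟩
  · by_cases hsi : s = i
    · subst hsi; omega
    · rw [← h7 s hsi, ← h5.1] at hs'
      exact hsi (hJ hs')
  · ext t
    by_cases ht : t = i
    · subst ht; rw [low_self, h5.1]
    · rw [low_ne _ ht, h7 t ht]

/-- families in the chart -/
def InCh (l J : Fin d → ℕ) (f : Fin d → ℝ[X]) : Prop :=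
  At J f = 1 ∧ ∀ i k, (f i).coeff k ≠ 0 → k ≤ l i ∧ k % 2 = l i % 2

def dirn (A : Finset (Fin d × ℕ)) (v : A → ℝ) (i : Fin d) : ℝ[X] :=
  ∑ x : A, if x.1.1 = i then C (v x) * X ^ x.1.2 else 0

def ch (J : Fin d → ℕ) (A : Finset (Fin d × ℕ)) (y : A → ℝ) (i : Fin d) : ℝ[X] := X ^ (J i) + dirn A y i

def crd (A : Finset (Fin d × ℕ)) (f : Fin d → ℝ[X]) : A → ℝ := fun x => (f x.1.1).coeff x.1.2

lemma dirn_coeff (A : Finset (Fin d × ℕ)) (v : A → ℝ) (i : Fin d) (k : ℕ) :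
    (dirn A v i).coeff k = if h : (i, k) ∈ A then v ⟨(i, k), h⟩ else 0 := by
  rw [dirn, finsetSum_coeff]
  have h1 : ∀ x : A, (if x.1.1 = i then C (v x) * X ^ x.1.2 else 0 : ℝ[X]).coeff k = if x.1 = (i, k) then v x else 0 := by
    intro x
    by_cases hx : x.1.1 = i
    · rw [if_pos hx, coeff_C_mul, coeff_X_pow]
      by_cases hk : k = x.1.2
      · rw [if_pos hk, if_pos (Prod.ext hx hk.symm), mul_one]
      · rw [if_neg hk, if_neg, mul_zero]; intro h; exact hk (by rw [h])
    · rw [if_neg hx, if_neg, coeff_zero]; intro h; exact hx (by rw [h])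
  simp only [h1]
  split_ifs with h
  · rw [Finset.sum_eq_single ⟨(i, k), h⟩]
    · simp
    · intro x _ hx; rw [if_neg]; intro h'; exact hx (Subtype.ext h')
    · simp
  · refine Finset.sum_eq_zero fun x _ => ?_
    rw [if_neg]; intro h'; exact h (h' ▸ x.2)

lemma ch_line (J : Fin d → ℕ) (A : Finset (Fin d × ℕ)) (y v : A → ℝ) (s : ℝ) (i : Fin d) :
    ch J A (y + s • v) i = ch J A y i + C s * dirn A v i := by
  ext k
  simp only [ch, coeff_add, coeff_C_mul, dirn_coeff]
  split_ifs <;> simp; ring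

lemma ch_smooth (J : Fin d → ℕ) (A : Finset (Fin d × ℕ)) (i : Fin d) : SmoothP fun y => ch J A y i := by
  refine (SmoothP.const _).add (SmoothP.sum _ fun x _ => ?_)
  split_ifs
  · exact (SmoothP.C (contDiff_apply ℝ ℝ x)).mul (SmoothP.const _)
  · exact SmoothP.const _

lemma ch_crd {l J : Fin d → ℕ} {f : Fin d → ℝ[X]} (h : InCh l J f) (hJ : Function.Injective J) : ch J (AA l J) (crd (AA l J) f) = f := by
  ext i k
  simp only [ch, coeff_add, dirn_coeff, coeff_X_pow, crd]
  by_cases hk : ∃ s, k = J s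
  · obtain ⟨s, rfl⟩ := hk
    rw [coeff_of_At_one h.1, dif_neg]
    · simp [hJ.eq_iff, eq_comm]
    · rw [mem_AA]; push Not; intro _; exact ⟨s, rfl⟩
  · push Not at hk
    rw [if_neg (hk i), zero_add]
    split_ifs with h'
    · rfl
    · by_contra hne
      exact h' (mem_AA.2 ⟨h.2 i k (Ne.symm hne), hk⟩)

lemma ch_inCh {l J : Fin d → ℕ} (c : Chart l J) (y : AA l J → ℝ) : InCh l J (ch J (AA l J) y) := by
  constructor
  · ext i t
    simp only [At, Matrix.of_apply, ch, coeff_add, dirn_coeff, coeff_X_pow]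
    rw [dif_neg]
    · simp [c.hJ.eq_iff, Matrix.one_apply, eq_comm]
    · rw [mem_AA]; push Not; intro _; exact ⟨t, rfl⟩
  · intro i k hk
    simp only [ch, coeff_add, dirn_coeff, coeff_X_pow] at hk
    by_cases h : (i, k) ∈ AA l J
    · exact (mem_AA.1 h).1
    · by_cases hki : k = J i
      · rw [hki]; exact ⟨c.le i, c.par i⟩
      · simp [h, hki] at hk

lemma crd_ch {l J : Fin d → ℕ} (y : AA l J → ℝ) : crd (AA l J) (ch J (AA l J) y) = y := by
  ext ⟨⟨i, k⟩, hx⟩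
  simp only [crd, ch, coeff_add, dirn_coeff, coeff_X_pow, hx, dif_pos]
  rw [if_neg ((mem_AA.1 hx).2 i), zero_add]

lemma InCh.natDegree_le {l J : Fin d → ℕ} {f : Fin d → ℝ[X]} (h : InCh l J f) (i : Fin d) : (f i).natDegree ≤ l i := by
  rw [natDegree_le_iff_coeff_eq_zero]
  intro k hk
  by_contra hne
  exact absurd (h.2 i k hne).1 (not_le.2 hk)

lemma nrm_supp {l J J' : Fin d → ℕ} {f : Fin d → ℝ[X]} (h : InCh l J f) (hd : (At J' f).det ≠ 0)
    (hp : ∀ t, J' t % 2 = l t % 2)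
    (ht : ∀ i t, At J' f i t ≠ 0 → l t ≤ l i) : InCh l J' (nrm J' f) := by
  refine ⟨At_nrm hd, fun t k hk => ⟨?_, ?_⟩⟩
  · have hk' := hk
    rw [nrm, act_coeff] at hk'
    obtain ⟨i, -, hi⟩ := Finset.exists_ne_zero_of_sum_ne_zero hk'
    have h1 := inv_triang hd ht t i (left_ne_zero_of_mul hi)
    exact (h.2 i k (right_ne_zero_of_mul hi)).1.trans h1
  · rw [← hp]
    exact nrm_parity hd (fun i k hik => (h.2 i k hik).2) t k hk

lemma Chart.to {l J : Fin d → ℕ} (c : Chart l J) {f : Fin d → ℝ[X]} (h : Red l f) (hd : (At J f).det ≠ 0) :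
    InCh l J (nrm J f) := by
  refine nrm_supp (J := l) h hd c.par fun i t hit => ?_
  have := h.2 i (J t) hit
  exact c.cc i t this.1 this.2

lemma Chart.back {l J : Fin d → ℕ} {f : Fin d → ℝ[X]} (h : InCh l J f) (hd : (At l f).det ≠ 0) :
    Red l (nrm l f) :=
  nrm_supp h hd (fun _ => rfl) fun i t hit => (h.2 i (l t) hit).1

end chart
end
end WS

open Polynomial Filter Topology
open scoped Matrix

namespace WS
noncomputable section

section loc

/-- products of distinct real linear factors -/
def RD (h : ℝ[X]) : Prop := ∃ S : Finset ℝ, ∃ c : ℝ, c ≠ 0 ∧ h = C c * ∏ s ∈ S, (X - C s)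

lemma RD.ne {h : ℝ[X]} (hh : RD h) : h ≠ 0 := by
  obtain ⟨S, c, hc, rfl⟩ := hh
  exact mul_ne_zero (C_ne_zero.2 hc) (Finset.prod_ne_zero_iff.2 fun s _ => X_sub_C_ne_zero s)

lemma RD.fin {h : ℝ[X]} (hh : RD h) : ∃ a : Fin h.natDegree → ℝ, Function.Injective a ∧ ∃ c : ℝ, c ≠ 0 ∧
    h = C c * ∏ k, (X - C (a k)) := by
  obtain ⟨S, c, hc, rfl⟩ := hh
  have h1 : (C c * ∏ s ∈ S, (X - C s)).natDegree = S.card := by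
    rw [natDegree_C_mul hc, natDegree_prod_of_monic _ _ fun s _ => monic_X_sub_C s]; simp
  rw [h1]
  refine ⟨fun k => (S.equivFin.symm k : ℝ), fun x y hxy => by simpa using hxy, c, hc, ?_⟩
  congr 1
  rw [← Finset.prod_coe_sort S (fun s => X - C s)]
  exact (Equiv.prod_comp S.equivFin.symm (fun s : S => X - C (s : ℝ))).symm

variable {e : ℕ}

lemma Sol.gamma_ne {d : ℕ} {l : Fin d → ℕ} {h : ℝ[X]} {f : Fin d → ℝ[X]} (hf : Red l f) {γ : ℝ} (hγ : wr f = C γ * h) : γ ≠ 0 := by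
  have h0 : wr f ≠ 0 := wr_ne (J := l) (by rw [hf.1]; simp)
  rintro rfl; simp [hγ] at h0

lemma Sol.sum {d : ℕ} {l : Fin d → ℕ} {h : ℝ[X]} {f : Fin d → ℝ[X]} (hf : f ∈ Sol l h) : ∑ i, l i = h.natDegree + tri d := by
  obtain ⟨hr, γ, hγ⟩ := hf
  rw [(sum_of_lead hr.1 hr.inj hr.natDegree_le).2, hγ, natDegree_C_mul (Sol.gamma_ne hr hγ)]

lemma nondeg {l J : Fin (e + 1) → ℕ} (c : Chart l J) (hcase : J = l ∨ ∃ i ∈ RR l, J = low l i) {h0 : ℝ[X]} (hRD : RD h0)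
    {G : Fin (e + 1) → ℝ[X]} (hG : G ∈ Sol J h0) (v : AA l J → ℝ) (g : ℝ)
    (hv : ∀ k, HasDerivAt (fun s : ℝ => (wr (ch J (AA l J) (crd (AA l J) G + s • v))).coeff k) (g * h0.coeff k) 0) : v = 0 := by
  have hInCh : InCh l J G := ⟨hG.1.1, fun i k hk => by
    have := hG.1.2 i k hk
    exact ⟨this.1.trans (c.le i), this.2.trans (c.par i)⟩⟩
  have hline : ∀ s : ℝ, ch J (AA l J) (crd (AA l J) G + s • v) = fun i => G i + C s * dirn (AA l J) v i := by
    intro s; ext1 i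
    rw [ch_line, ch_crd hInCh c.hJ]
  simp only [hline] at hv
  have hdl : ∀ i, (dirn (AA l J) v i).natDegree ≤ l i := by
    intro i
    rw [natDegree_le_iff_coeff_eq_zero]
    intro k hk
    rw [dirn_coeff, dif_neg]
    rw [mem_AA]; rintro ⟨⟨a, -⟩, -⟩; simp only at a; omega
  have hd0 : ∀ i t, (dirn (AA l J) v i).coeff (J t) = 0 := by
    intro i t
    rw [dirn_coeff, dif_neg]
    rw [mem_AA]; push Not; intro _; exact ⟨t, rfl⟩
  have hsumJ := Sol.sum hG
  have hd : ∀ i, (dirn (AA l J) v i).natDegree ≤ J i := by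
    rcases hcase with hcase | ⟨i, hi, hcase⟩
    · intro i; exact (hdl i).trans (le_of_eq (congrFun hcase i).symm)
    · have hi' := mem_RR.1 hi
      have hsum := low_sum hi
      rw [← hcase] at hsum
      have htop : (dirn (AA l J) v i).coeff (l i) = 0 := by
        have h1 : ∀ s : ℝ, (wr (fun i => G i + C s * dirn (AA l J) v i)).coeff (h0.natDegree + 2) =
            (Matrix.vandermonde (fun i => (l i : ℝ))).det * (s * (dirn (AA l J) v i).coeff (l i)) := by
          intro s
          rw [wr_lead _ l (fun t => (natDegree_add_le _ _).trans (max_le ((hG.1.natDegree_le t).trans (c.le t))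
            ((natDegree_C_mul_le _ _).trans (hdl t)))) _ (by omega)]
          congr 1
          rw [Finset.prod_eq_single i]
          · rw [coeff_add, coeff_C_mul, coeff_eq_zero_of_natDegree_lt (p := G i), zero_add]
            refine lt_of_le_of_lt (hG.1.natDegree_le i) ?_
            rw [hcase, low_self]; omega
          · intro t _ ht
            have : l t = J t := by rw [hcase, low_ne _ ht]
            rw [this, coeff_add, coeff_C_mul, hd0, mul_zero, add_zero, coeff_of_At_one hG.1.1, if_pos rfl]
          · simp
        have h2 := hv (h0.natDegree + 2)
        simp only [h1] at h2
        rw [coeff_eq_zero_of_natDegree_lt (p := h0) (by omega), mul_zero] at h2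
        have h3 := ((hasDerivAt_id (0 : ℝ)).mul_const ((dirn (AA l J) v i).coeff (l i))).const_mul
          (Matrix.vandermonde (fun i => (l i : ℝ))).det
        have h4 := h2.unique h3
        have h5 := vander_ne (K := ℝ) l c.hl
        simp only [one_mul] at h4
        exact (mul_eq_zero.1 h4.symm).resolve_left h5
      intro t
      by_cases ht : t = i
      · subst ht
        rw [natDegree_le_iff_coeff_eq_zero]
        intro k hk
        by_cases hk' : k = l t
        · rw [hk', htop]
        · rw [dirn_coeff, dif_neg]
          rw [hcase, low_self] at hk
          rw [mem_AA]; rintro ⟨⟨a, b⟩, -⟩; simp only at a b; omega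
      · have : l t = J t := by rw [hcase, low_ne _ ht]
        rw [← this]; exact hdl t
  have hg : g = 0 := by
    have h1 : ∀ s : ℝ, (wr (fun i => G i + C s * dirn (AA l J) v i)).coeff h0.natDegree =
        (Matrix.vandermonde (fun i => (J i : ℝ))).det := by
      intro s
      rw [wr_lead _ J (fun t => (natDegree_add_le _ _).trans (max_le (hG.1.natDegree_le t)
            ((natDegree_C_mul_le _ _).trans (hd t)))) _ hsumJ]
      rw [Finset.prod_eq_one, mul_one]
      intro t _
      rw [coeff_add, coeff_C_mul, hd0, mul_zero, add_zero, coeff_of_At_one hG.1.1, if_pos rfl]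
    have h2 := hv h0.natDegree
    simp only [h1] at h2
    have h3 := h2.unique (hasDerivAt_const _ _)
    refine (mul_eq_zero.1 h3).resolve_right ?_
    simpa using hRD.ne
  obtain ⟨a, ha, cc, hcc, hprod⟩ := hRD.fin
  obtain ⟨γ, hγ⟩ := hG.2
  have hfin := transv G (dirn (AA l J) v) J c.hJ hsumJ hG.1.natDegree_le
    (fun i => by rw [coeff_of_At_one hG.1.1, if_pos rfl]) hd hd0 (γ * cc) a ha
    (by rw [hγ, C_mul, mul_assoc, ← hprod]) (by
      intro k
      have := hv k
      rw [hg, zero_mul] at this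
      exact this)
  ext ⟨⟨i, k⟩, hx⟩
  have h1 := dirn_coeff (AA l J) v i k
  rw [hfin i, dif_pos hx, coeff_zero] at h1
  exact h1.symm

/-- the filter of families close to `G` after normalisation -/
def FF {d : ℕ} (J : Fin d → ℕ) (G : Fin d → ℝ[X]) : Filter (Fin d → ℝ[X]) :=
  comap (nrm J) (nh G) ⊓ 𝓟 {f | (At J f).det ≠ 0}

lemma mem_FF {d : ℕ} {J : Fin d → ℕ} {G : Fin d → ℝ[X]} {U : Set (Fin d → ℝ[X])} :
    U ∈ FF J G ↔ ∃ W ∈ nh G, ∀ f, (At J f).det ≠ 0 → nrm J f ∈ W → f ∈ U := by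
  rw [FF, mem_inf_principal, mem_comap]
  constructor
  · rintro ⟨W, hW, h⟩; exact ⟨W, hW, fun f h1 h2 => h h2 h1⟩
  · rintro ⟨W, hW, h⟩; exact ⟨W, hW, fun f h1 h2 => h f h2 h1⟩

lemma tendsto_FF {d : ℕ} {Ω : Type*} {u : Filter Ω} {J : Fin d → ℕ} {G : Fin d → ℝ[X]} {f : Ω → Fin d → ℝ[X]} :
    Tendsto f u (FF J G) ↔ Tendsto (fun ω => nrm J (f ω)) u (nh G) ∧ ∀ᶠ ω in u, (At J (f ω)).det ≠ 0 := by
  rw [FF, tendsto_inf, tendsto_comap_iff, tendsto_principal]; rfl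

lemma ch_supp {l J : Fin (e + 1) → ℕ} {M m : ℕ} (hm : m ≤ 1) (hs : ∑ i, l i = 2 * M + m + tri (e + 1))
    {f : Fin (e + 1) → ℝ[X]} (hf : InCh l J f) (k : ℕ) (hk : (wr f).coeff k ≠ 0) : ∃ r ≤ M, k = m + 2 * r := by
  obtain ⟨q, -, hq, hqs⟩ := wr_supp f k hk
  have h1 : ∑ i, q i ≤ ∑ i, l i := Finset.sum_le_sum fun i _ => (hf.2 i _ (hq i)).1
  have h2 : (∑ i, q i) % 2 = (∑ i, l i) % 2 := by
    rw [Finset.sum_nat_mod, Finset.sum_nat_mod (f := l)]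
    congr 1
    exact Finset.sum_congr rfl fun i _ => (hf.2 i _ (hq i)).2
  exact ⟨(k - m) / 2, by omega, by omega⟩

lemma local_thm {l J : Fin (e + 1) → ℕ} (c : Chart l J) (hcase : J = l ∨ ∃ i ∈ RR l, J = low l i) {M m : ℕ} (hm : m ≤ 1)
    (hs : ∑ i, l i = 2 * M + m + tri (e + 1)) (hM : (AA l l).card = M) (h : ℝ → ℝ[X]) (hh : SmoothP h)
    (hhs : ∀ τ k, (h τ).coeff k ≠ 0 → ∃ r ≤ M, k = m + 2 * r) (c0 : ℝ) (hc0 : c0 ≠ 0) (hc : ∀ τ, (h τ).coeff m = c0)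
    (τ0 : ℝ) (hRD : RD (h τ0)) {G : Fin (e + 1) → ℝ[X]} (hG : G ∈ Sol J (h τ0)) :
    (∀ U ∈ FF J G, ∀ᶠ τ in 𝓝 τ0, (h τ).coeff (2 * M + m) ≠ 0 → ∃ x ∈ U, x ∈ Sol l (h τ)) ∧
    ∃ U ∈ FF J G, ∀ᶠ τ in 𝓝 τ0, (U ∩ Sol l (h τ)).Subsingleton := by
  have hInCh : InCh l J G := ⟨hG.1.1, fun i k hk => by
    have := hG.1.2 i k hk
    exact ⟨this.1.trans (c.le i), this.2.trans (c.par i)⟩⟩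
  obtain ⟨γ0, hγ0⟩ := hG.2
  obtain ⟨hI, V, hV, hII⟩ := chart_ift (ι := AA l J) (M := M) (m := m) (by rw [Fintype.card_coe, c.card, hM])
    (fun y => wr (ch J (AA l J) y)) (smooth_wr fun i => ch_smooth _ _ i) (fun y k => ch_supp hm hs (ch_inCh c y) k)
    h hh hhs c0 hc0 hc (crd (AA l J) G) τ0 γ0 (by simp only [ch_crd hInCh c.hJ, hγ0])
    (nondeg c hcase hRD hG)
  constructor
  · intro U hU
    obtain ⟨W, hW, hWU⟩ := mem_FF.1 hU
    have hcont : Tendsto (fun y => ch J (AA l J) y) (𝓝 (crd (AA l J) G)) (nh G) := by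
      rw [tendsto_nh]
      intro i k
      have h1 := ((ch_smooth J (AA l J) i) k).continuous.tendsto (crd (AA l J) G)
      simp only [ch_crd hInCh c.hJ] at h1
      exact h1
    filter_upwards [hI _ (hcont hW)] with τ hτ hne
    obtain ⟨y, hy, γ, hγ⟩ := hτ
    have hin := ch_inCh c y
    have hw0 : wr (ch J (AA l J) y) ≠ 0 := wr_ne (J := J) (by rw [hin.1]; simp)
    have hγ' : γ ≠ 0 := by rintro rfl; simp [hγ] at hw0
    have hdet : (At l (ch J (AA l J) y)).det ≠ 0 := by
      rw [tri_det c.hl hin.natDegree_le]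
      have h1 := wr_lead _ l hin.natDegree_le _ hs
      rw [hγ, coeff_C_mul] at h1
      intro h2
      rw [h2, mul_zero] at h1
      exact mul_ne_zero hγ' hne h1
    refine ⟨nrm l (ch J (AA l J) y), hWU _ ?_ ?_, Chart.back hin hdet, ((At l (ch J (AA l J) y))⁻¹).det * γ, ?_⟩
    · rw [At_det_nrm, hin.1]
      simpa using det_inv_ne hdet
    · rw [nrm_nrm _ _ hdet, nrm_of_one hin.1]; exact hy
    · rw [wr_nrm, hγ, C_mul, mul_assoc]
  · have hcont : Tendsto (crd (AA l J)) (nh G) (𝓝 (crd (AA l J) G)) := by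
      rw [tendsto_pi_nhds]
      intro x
      exact tendsto_nh.1 tendsto_id x.1.1 x.1.2
    refine ⟨{f | (At J f).det ≠ 0 ∧ nrm J f ∈ crd (AA l J) ⁻¹' V}, mem_FF.2 ⟨_, hcont hV, fun f h1 h2 => ⟨h1, h2⟩⟩, ?_⟩
    filter_upwards [hII] with τ hτ f hf f' hf'
    have key : ∀ f, f ∈ {f | (At J f).det ≠ 0 ∧ nrm J f ∈ crd (AA l J) ⁻¹' V} ∩ Sol l (h τ) →
        ch J (AA l J) (crd (AA l J) (nrm J f)) = nrm J f ∧ ∃ γ, wr (ch J (AA l J) (crd (AA l J) (nrm J f))) = C γ * h τ := by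
      rintro f ⟨⟨h1, h2⟩, h3, γ, hγ⟩
      have h4 := ch_crd (c.to h3 h1) c.hJ
      refine ⟨h4, ((At J f)⁻¹).det * γ, ?_⟩
      rw [h4, wr_nrm, hγ, C_mul, mul_assoc]
    obtain ⟨k1, k2⟩ := key f hf
    obtain ⟨k1', k2'⟩ := key f' hf'
    have h1 := hτ _ hf.1.2 _ hf'.1.2 k2 k2'
    have h2 : nrm J f = nrm J f' := by rw [← k1, ← k1', h1]
    have h3 : ∀ f ∈ {f | (At J f).det ≠ 0 ∧ nrm J f ∈ crd (AA l J) ⁻¹' V} ∩ Sol l (h τ), nrm l (nrm J f) = f := by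
      intro f hf
      rw [nrm_nrm _ _ hf.1.1, nrm_of_one hf.2.1.1]
    rw [← h3 f hf, ← h3 f' hf', h2]

end loc
end
end WS

open Polynomial Filter Topology
open scoped Matrix

namespace WS
noncomputable section

section count
variable {e : ℕ}

lemma FF_disj {d : ℕ} {J J' : Fin d → ℕ} {G G' : Fin d → ℝ[X]} (hG : Red J G) (hG' : Red J' G')
    (hs : ∑ i, J' i = ∑ i, J i) (hnd : ¬ Disjoint (FF J G) (FF J' G')) :
    (∃ σ : Equiv.Perm (Fin d), ∀ i, J' (σ i) = J i) ∧ (J = J' → G = G') := by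
  have hne : NeBot (FF J G ⊓ FF J' G') := by
    rw [disjoint_iff] at hnd; exact ⟨hnd⟩
  set v := FF J G ⊓ FF J' G'
  obtain ⟨t1, d1⟩ := tendsto_FF.1 ((tendsto_id (x := v)).mono_right (inf_le_left : v ≤ FF J G))
  obtain ⟨t2, d2⟩ := tendsto_FF.1 ((tendsto_id (x := v)).mono_right (inf_le_right : v ≤ FF J' G'))
  have e1 : ∀ᶠ f in v, act (At J' (nrm J f)) (nrm J' f) = nrm J f := by
    filter_upwards [d1, d2] with f h1 h2
    simp only [id] at h1 h2
    have h3 := act_nrm (J := J') (f := nrm J f) (by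
      rw [At_det_nrm]; exact mul_ne_zero (det_inv_ne h1) h2)
    rw [nrm_nrm _ _ h1] at h3
    exact h3
  have e2 : act (At J' G) G' = G := by
    ext i k
    refine tendsto_nhds_unique ?_ (tendsto_nh.1 t1 i k)
    have h1 : Tendsto (fun f => (act (At J' (nrm J f)) (nrm J' f) i).coeff k) v (𝓝 ((act (At J' G) G' i).coeff k)) := by
      simp only [act_coeff]
      exact tendsto_finsetSum _ fun r _ => (tendsto_nh.1 t1 i (J' r)).mul (tendsto_nh.1 t2 r k)
    refine h1.congr' ?_
    filter_upwards [e1] with f hf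
    rw [hf]; rfl
  constructor
  · have h1 : At J' G * At J G' = 1 := by rw [← At_act, e2, hG.1]
    have h2 : (At J' G).det ≠ 0 := by
      intro h0
      have := congrArg Matrix.det h1
      rw [Matrix.det_mul, h0] at this; simp at this
    obtain ⟨σ, hσ⟩ := det_perm h2
    exact ⟨σ, perm_eq σ (fun i => (hG.2 i _ (hσ i)).1) hs⟩
  · rintro rfl
    rw [hG.1, act_one] at e2
    exact e2.symm

lemma sum_eq_imp {d : ℕ} {J l : Fin d → ℕ} (h : ∀ t, J t ≤ l t ∧ J t % 2 = l t % 2) (hs : ∑ t, J t = ∑ t, l t) : J = l := by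
  ext t
  exact (Finset.sum_eq_sum_iff_of_le fun t _ => (h t).1).1 hs t (Finset.mem_univ t)

lemma finite_Sol {l : Fin (e + 1) → ℕ} {M m : ℕ} (hm : m ≤ 1)
    (hs : ∑ i, l i = 2 * M + m + tri (e + 1)) (h : ℝ[X])
    (hhs : ∀ k, h.coeff k ≠ 0 → ∃ r ≤ M, k = m + 2 * r) (hc : h.coeff m ≠ 0) (hRD : RD h) : (Sol l h).Finite := by
  by_contra hinf
  haveI : Infinite (Sol l h) := Set.infinite_coe_iff.2 hinf
  obtain ⟨x0⟩ := (inferInstance : Nonempty (Sol l h))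
  have hM := card_of_point hm hc hs x0.2
  obtain ⟨J, G, hG, hJl, h1, h2⟩ := cpt (hyperfilter (Sol l h)) (fun x => (x : Fin (e + 1) → ℝ[X])) l (fun _ => h) h m hc
    (fun k => tendsto_const_nhds) (Eventually.of_forall fun x => x.2)
  have hJ : J = l := sum_eq_imp hJl (by rw [Sol.sum hG, Sol.sum x0.2])
  subst hJ
  obtain ⟨-, U, hU, hUs⟩ := local_thm (Chart.refl hG.1.inj) (Or.inl rfl) hm hs hM (fun _ => h) (SmoothP.const h)
    (fun _ => hhs) (h.coeff m) hc (fun _ => rfl) 0 hRD hG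
  have h3 := hUs.self_of_nhds
  have h4 := tendsto_FF.2 ⟨h2, h1⟩ hU
  have h5 : ((fun x : Sol J h => (x : Fin (e + 1) → ℝ[X])) ⁻¹' U).Finite := by
    refine Set.Subsingleton.finite fun x hx y hy => Subtype.ext (h3 ⟨hx, x.2⟩ ⟨hy, y.2⟩)
  exact h5.notMem_hyperfilter h4

lemma count_thm {I : Type} [Fintype I] {l : Fin (e + 1) → ℕ} (J : I → Fin (e + 1) → ℕ) (hch : ∀ i, Chart l (J i))
    (hcase : ∀ i, J i = l ∨ ∃ j ∈ RR l, J i = low l j) (hinj : ∀ i i' (σ : Equiv.Perm (Fin (e + 1))), (∀ t, J i' (σ t) = J i t) → i = i')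
    {M m : ℕ} (hm : m ≤ 1)
    (hs : ∑ i, l i = 2 * M + m + tri (e + 1)) (hM : (AA l l).card = M) (h : ℝ → ℝ[X]) (hh : SmoothP h)
    (hhs : ∀ τ k, (h τ).coeff k ≠ 0 → ∃ r ≤ M, k = m + 2 * r) (c0 : ℝ) (hc0 : c0 ≠ 0) (hc : ∀ τ, (h τ).coeff m = c0)
    (τ0 : ℝ) (hRD : RD (h τ0)) (hsum : ∀ i, ∑ t, J i t = (h τ0).natDegree + tri (e + 1))
    (hcov : ∀ J' : Fin (e + 1) → ℕ, Function.Injective J' → (∀ t, J' t ≤ l t ∧ J' t % 2 = l t % 2) →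
      ∑ t, J' t = (h τ0).natDegree + tri (e + 1) → ∃ i, J' = J i)
    (hfin : ∀ i, (Sol (J i) (h τ0)).Finite)
    (F : Filter ℝ) (hF : F ≤ 𝓝 τ0) (hFt : ∀ᶠ τ in F, (h τ).coeff (2 * M + m) ≠ 0) :
    ∀ᶠ τ in F, (Sol l (h τ)).ncard = ∑ i, (Sol (J i) (h τ0)).ncard := by
  classical
  haveI : ∀ i, Finite (Sol (J i) (h τ0)) := fun i => (hfin i).to_subtype
  letI : Fintype (Σ i, Sol (J i) (h τ0)) := Fintype.ofFinite _
  have hcard : Fintype.card (Σ i, Sol (J i) (h τ0)) = ∑ i, (Sol (J i) (h τ0)).ncard := by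
    rw [← Nat.card_eq_fintype_card, Nat.card_sigma]; rfl
  rw [← hcard]
  have hloc := fun α : Σ i, Sol (J i) (h τ0) => local_thm (hch α.1) (hcase α.1) hm hs hM h hh hhs c0 hc0 hc τ0 hRD α.2.2
  refine count_filter F (fun τ => Sol l (h τ)) (fun α : Σ i, Sol (J i) (h τ0) => FF (J α.1) α.2.1) ?_ ?_ ?_ ?_
  · intro α U hU
    filter_upwards [hF ((hloc α).1 U hU), hFt] with τ h1 h2
    exact h1 h2
  · intro α
    obtain ⟨U, hU, hUs⟩ := (hloc α).2
    exact ⟨U, hU, hF hUs⟩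
  · intro U hU
    by_contra hcon
    rw [not_eventually] at hcon
    have hcon2 : ∃ᶠ τ in F, ∃ f, f ∈ Sol l (h τ) ∧ f ∉ ⋃ α, U α := by
      refine hcon.mono fun τ hτ => ?_
      rw [Set.not_subset] at hτ
      exact hτ
    have hneb : NeBot (F ⊓ 𝓟 {τ | ∃ f, f ∈ Sol l (h τ) ∧ f ∉ ⋃ α, U α}) := by
      rw [← frequently_mem_iff_neBot]; exact hcon2
    set u := Ultrafilter.of (F ⊓ 𝓟 {τ | ∃ f, f ∈ Sol l (h τ) ∧ f ∉ ⋃ α, U α}) with hu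
    have hule : (u : Filter ℝ) ≤ F ⊓ 𝓟 {τ | ∃ f, f ∈ Sol l (h τ) ∧ f ∉ ⋃ α, U α} := Ultrafilter.of_le _
    have hu2 : ∀ᶠ τ in (u : Filter ℝ), ∃ f, f ∈ Sol l (h τ) ∧ f ∉ ⋃ α, U α :=
      hule (mem_inf_of_right (mem_principal_self _))
    let f : ℝ → Fin (e + 1) → ℝ[X] := fun τ => if hx : ∃ f, f ∈ Sol l (h τ) ∧ f ∉ ⋃ α, U α then hx.choose else 0
    have hf : ∀ᶠ τ in (u : Filter ℝ), f τ ∈ Sol l (h τ) ∧ f τ ∉ ⋃ α, U α := by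
      filter_upwards [hu2] with τ hτ
      simp only [f, dif_pos hτ]
      exact hτ.choose_spec
    obtain ⟨J', G, hG, hJl, h1, h2⟩ := cpt u f l h (h τ0) m (by rw [hc]; exact hc0)
      (fun k => ((hh k).continuous.tendsto τ0).mono_left ((hule.trans inf_le_left).trans hF)) (hf.mono fun τ hτ => hτ.1)
    obtain ⟨i, hi⟩ := hcov J' hG.1.inj hJl (Sol.sum hG)
    subst hi
    have h3 := tendsto_FF.2 ⟨h2, h1⟩ (hU ⟨i, G, hG⟩)
    have h3' : ∀ᶠ τ in (u : Filter ℝ), f τ ∈ U ⟨i, G, hG⟩ := h3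
    obtain ⟨τ, h4, h5⟩ := (h3'.and hf).exists
    exact h5.2 (Set.mem_iUnion.2 ⟨_, h4⟩)
  · rintro ⟨i, G, hG⟩ ⟨i', G', hG'⟩ hne
    by_contra hnd
    obtain ⟨⟨σ, hσ⟩, hGG⟩ := FF_disj hG.1 hG'.1 (by rw [hsum, hsum]) hnd
    have := hinj i i' σ hσ
    subst this
    have := hGG rfl
    subst this
    exact hne rfl

lemma count_same {l : Fin (e + 1) → ℕ} (hl : Function.Injective l)
    {M m : ℕ} (hm : m ≤ 1)
    (hs : ∑ i, l i = 2 * M + m + tri (e + 1)) (hM : (AA l l).card = M) (h : ℝ → ℝ[X]) (hh : SmoothP h)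
    (hhs : ∀ τ k, (h τ).coeff k ≠ 0 → ∃ r ≤ M, k = m + 2 * r) (c0 : ℝ) (hc0 : c0 ≠ 0) (hc : ∀ τ, (h τ).coeff m = c0)
    (τ0 : ℝ) (hRD : RD (h τ0)) (hN : (h τ0).coeff (2 * M + m) ≠ 0) :
    ∀ᶠ τ in 𝓝 τ0, (Sol l (h τ)).ncard = (Sol l (h τ0)).ncard := by
  have hdeg : (h τ0).natDegree = 2 * M + m := by
    refine le_antisymm ?_ (le_natDegree_of_ne_zero hN)
    obtain ⟨r, hr, hr'⟩ := hhs τ0 (h τ0).natDegree (by simpa using hRD.ne)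
    omega
  have := count_thm (I := Unit) (l := l) (fun _ => l) (fun _ => Chart.refl hl) (fun _ => Or.inl rfl)
    (fun _ _ _ _ => rfl) hm hs hM h hh hhs c0 hc0 hc τ0 hRD (fun _ => by rw [hs, hdeg])
    (fun J' _ hJ' hsJ => ⟨(), sum_eq_imp hJ' (by rw [hsJ, hs, hdeg])⟩)
    (fun _ => finite_Sol hm hs _ (hhs τ0) (by rw [hc]; exact hc0) hRD) (𝓝 τ0) le_rfl
    (((hh (2 * M + m)).continuous.tendsto τ0).eventually_ne hN)
  simpa using this

lemma count_low {l : Fin (e + 1) → ℕ} (hl : Function.Injective l)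
    {M m : ℕ} (hm : m ≤ 1)
    (hs : ∑ i, l i = 2 * (M + 1) + m + tri (e + 1)) (hM : (AA l l).card = M + 1) (h : ℝ → ℝ[X]) (hh : SmoothP h)
    (hhs : ∀ τ k, (h τ).coeff k ≠ 0 → ∃ r ≤ M + 1, k = m + 2 * r) (c0 : ℝ) (hc0 : c0 ≠ 0) (hc : ∀ τ, (h τ).coeff m = c0)
    (hRD : RD (h 0)) (hN : ∀ τ, 0 < τ → (h τ).coeff (2 * (M + 1) + m) ≠ 0) (hN0 : (h 0).natDegree = 2 * M + m) :
    ∀ᶠ τ in 𝓝[>] (0 : ℝ), (Sol l (h τ)).ncard = ∑ i ∈ RR l, (Sol (low l i) (h 0)).ncard := by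
  have hsum : ∀ i : RR l, ∑ t, low l i t = (h 0).natDegree + tri (e + 1) := by
    intro i
    have := low_sum i.2
    omega
  have hhs0 : ∀ k, (h 0).coeff k ≠ 0 → ∃ r ≤ M, k = m + 2 * r := by
    intro k hk
    obtain ⟨r, hr, hr'⟩ := hhs 0 k hk
    have := le_natDegree_of_ne_zero hk
    exact ⟨r, by omega, hr'⟩
  have := count_thm (I := RR l) (l := l) (fun i => low l i) (fun i => Chart.low hl i.2) (fun i => Or.inr ⟨i, i.2, rfl⟩)
    (by
      rintro ⟨i, hi⟩ ⟨i', hi'⟩ σ hσ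
      simp only at hσ
      have h1 := hσ i
      rw [low_self] at h1
      by_cases h2 : σ i = i'
      · rw [h2, low_self] at h1
        have h3 := (mem_RR.1 hi).1
        have h4 := (mem_RR.1 hi').1
        exact Subtype.ext (hl (show l i = l i' by omega))
      · rw [low_ne _ h2] at h1
        exact absurd h1 ((mem_RR.1 hi).2 _)) hm hs hM h hh hhs c0 hc0 hc 0 hRD hsum
    (fun J' hJi hJ' hsJ => by
      obtain ⟨i, hi, h1⟩ := chart_cases hJi hJ' (by omega)
      exact ⟨⟨i, hi⟩, h1⟩)
    (fun i => finite_Sol (M := M) hm (by rw [hsum, hN0]) _ hhs0 (by rw [hc]; exact hc0) hRD) (𝓝[>] 0) nhdsWithin_le_nhds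
    (by filter_upwards [self_mem_nhdsWithin] with τ hτ; exact hN τ hτ)
  filter_upwards [this] with τ hτ
  rw [hτ]
  exact Finset.sum_coe_sort (RR l) (fun i => (Sol (low l i) (h 0)).ncard)

end count
end
end WS

open Polynomial Filter Topology
open scoped Matrix

namespace WS
noncomputable section

/-- even/odd polynomial `X^m p(X^2)` -/
def ex (m : ℕ) (p : ℝ[X]) : ℝ[X] := X ^ m * expand ℝ 2 p

def hB (m : ℕ) (B : Finset ℝ) : ℝ[X] := ex m (∏ b ∈ B, (X - C b))

lemma ex_coeff (m : ℕ) (p : ℝ[X]) (r : ℕ) : (ex m p).coeff (m + 2 * r) = p.coeff r := by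
  rw [ex, Nat.add_comm, coeff_X_pow_mul, Nat.mul_comm, coeff_expand_mul (by norm_num)]

lemma ex_supp {m : ℕ} {p : ℝ[X]} {k : ℕ} (h : (ex m p).coeff k ≠ 0) : ∃ r ≤ p.natDegree, k = m + 2 * r := by
  rw [ex, coeff_X_pow_mul'] at h
  split_ifs at h with h1
  · rw [coeff_expand (by norm_num)] at h
    split_ifs at h with h2
    · exact ⟨(k - m) / 2, le_natDegree_of_ne_zero h, by omega⟩
    · exact absurd rfl h
  · exact absurd rfl h

lemma ex_mul (m : ℕ) (p q : ℝ[X]) : ex m (p * q) = ex m p * expand ℝ 2 q := by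
  simp [ex, mul_assoc]

lemma ex_natDegree (m : ℕ) {p : ℝ[X]} (hp : p ≠ 0) : (ex m p).natDegree = 2 * p.natDegree + m := by
  have h1 : (ex m p).coeff (m + 2 * p.natDegree) ≠ 0 := by rw [ex_coeff]; simpa using hp
  refine le_antisymm ?_ (by have := le_natDegree_of_ne_zero h1; omega)
  have h2 : ex m p ≠ 0 := by rintro h; simp [h] at h1
  obtain ⟨r, hr, h3⟩ := ex_supp (m := m) (p := p) (k := (ex m p).natDegree) (by simpa using h2)
  omega

lemma RD.mul {h : ℝ[X]} (hh : RD h) {r : ℝ} (hr : h.eval r ≠ 0) : RD (h * (X - C r)) := by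
  classical
  obtain ⟨S, c, hc, rfl⟩ := hh
  refine ⟨insert r S, c, hc, ?_⟩
  rw [Finset.prod_insert, mul_assoc, mul_comm (∏ s ∈ S, (X - C s))]
  intro hS
  apply hr
  rw [eval_mul, eval_prod, Finset.prod_eq_zero hS (by simp), mul_zero]

lemma prodB_ne (B : Finset ℝ) : (∏ b ∈ B, (X - C b) : ℝ[X]) ≠ 0 := (monic_prod_of_monic _ _ fun b _ => monic_X_sub_C b).ne_zero

lemma prodB_deg (B : Finset ℝ) : (∏ b ∈ B, (X - C b) : ℝ[X]).natDegree = B.card := by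
  simp

lemma hB_natDegree (m : ℕ) (B : Finset ℝ) : (hB m B).natDegree = 2 * B.card + m := by
  rw [hB, ex_natDegree m (prodB_ne B), prodB_deg]

lemma hB_eval (m : ℕ) (B : Finset ℝ) (x : ℝ) : (hB m B).eval x = x ^ m * ∏ b ∈ B, (x ^ 2 - b) := by
  simp [hB, ex, eval_prod, expand_eval]

lemma hB_coeff (m : ℕ) (B : Finset ℝ) (hB0 : ∀ b ∈ B, 0 < b) : (hB m B).coeff m ≠ 0 := by
  have := ex_coeff m (∏ b ∈ B, (X - C b)) 0
  rw [mul_zero, add_zero] at this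
  rw [hB, this, coeff_zero_eq_eval_zero, eval_prod]
  exact Finset.prod_ne_zero_iff.2 fun b hb => by simpa using (hB0 b hb).ne'

lemma hB_insert (m : ℕ) (B : Finset ℝ) {b : ℝ} (hb : b ∉ B) : hB m (insert b B) = hB m B * (X ^ 2 - C b) := by
  rw [hB, Finset.prod_insert hb, mul_comm, ex_mul]
  simp [hB]

lemma RD_hB {m : ℕ} (hm : m ≤ 1) (B : Finset ℝ) (hB0 : ∀ b ∈ B, 0 < b) : RD (hB m B) := by
  classical
  induction B using Finset.induction_on with
  | empty =>
    have : m = 0 ∨ m = 1 := by omega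
    rcases this with rfl | rfl
    · exact ⟨∅, 1, one_ne_zero, by simp [hB, ex]⟩
    · exact ⟨{0}, 1, one_ne_zero, by simp [hB, ex]⟩
  | insert b B hb ih =>
    have hb0 : 0 < b := hB0 b (Finset.mem_insert_self _ _)
    have h1 := ih fun b' hb' => hB0 b' (Finset.mem_insert_of_mem hb')
    have hs : √b ^ 2 = b := Real.sq_sqrt hb0.le
    have hs0 : 0 < √b := Real.sqrt_pos.2 hb0
    have h2 : ∏ b' ∈ B, (b - b') ≠ 0 := Finset.prod_ne_zero_iff.2 fun b' hb' h => hb (by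
      have : b = b' := by linarith
      rwa [this])
    have h3 : hB m (insert b B) = hB m B * (X - C (√b)) * (X - C (-√b)) := by
      rw [hB_insert m B hb, mul_assoc]
      congr 1
      have : (C b : ℝ[X]) = C (√b) ^ 2 := by rw [← C_pow, hs]
      rw [this, C_neg]; ring
    rw [h3]
    refine (h1.mul ?_).mul ?_
    · rw [hB_eval, hs]
      exact mul_ne_zero (pow_ne_zero _ hs0.ne') h2
    · rw [eval_mul, hB_eval, neg_sq, hs]
      refine mul_ne_zero (mul_ne_zero (pow_ne_zero _ (neg_ne_zero.2 hs0.ne')) h2) ?_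
      simp only [eval_sub, eval_X, eval_C]
      linarith

lemma RD.cmul {h : ℝ[X]} (hh : RD h) {c : ℝ} (hc : c ≠ 0) : RD (C c * h) := by
  obtain ⟨S, c', hc', rfl⟩ := hh
  exact ⟨S, c * c', mul_ne_zero hc hc', by rw [C_mul, mul_assoc]⟩

lemma Sol_smul {d : ℕ} (l : Fin d → ℕ) (h : ℝ[X]) {c : ℝ} (hc : c ≠ 0) : Sol l (C c * h) = Sol l h := by
  ext f
  constructor
  · rintro ⟨h1, γ, h2⟩
    exact ⟨h1, γ * c, by rw [h2, C_mul, mul_assoc]⟩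
  · rintro ⟨h1, γ, h2⟩
    refine ⟨h1, γ * c⁻¹, ?_⟩
    rw [h2, ← mul_assoc, ← C_mul, mul_assoc, inv_mul_cancel₀ hc, mul_one]

def fam (m : ℕ) (B : Finset ℝ) (τ : ℝ) : ℝ[X] := ex m ((∏ b ∈ B, (X - C b)) * (1 - C τ * X))

lemma fam_zero (m : ℕ) (B : Finset ℝ) : fam m B 0 = hB m B := by simp [fam, hB]

lemma fam_pos (m : ℕ) (B : Finset ℝ) {τ : ℝ} (h0 : τ ≠ 0) (hτ : τ⁻¹ ∉ B) : fam m B τ = C (-τ) * hB m (insert τ⁻¹ B) := by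
  rw [hB_insert m B hτ, fam, ex_mul, ← hB, mul_left_comm]
  congr 1
  simp only [map_sub, map_one, map_mul, expand_C, expand_X]
  have : (C τ * C τ⁻¹ : ℝ[X]) = 1 := by rw [← C_mul, mul_inv_cancel₀ h0, C_1]
  rw [C_neg]
  linear_combination -this

lemma fam_smooth (m : ℕ) (B : Finset ℝ) : SmoothP (fam m B) := by
  intro k
  have : (fun τ => (fam m B τ).coeff k) = fun τ => (hB m B).coeff k - τ * (hB m B * X ^ 2).coeff k := by
    ext τ
    rw [fam, ex_mul, ← hB]
    simp only [map_sub, map_one, map_mul, expand_C, expand_X]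
    rw [mul_sub, mul_one, mul_left_comm, coeff_sub, coeff_C_mul]
  rw [this]
  fun_prop

lemma fam_supp (m : ℕ) (B : Finset ℝ) (τ : ℝ) (k : ℕ) (hk : (fam m B τ).coeff k ≠ 0) : ∃ r ≤ B.card + 1, k = m + 2 * r := by
  obtain ⟨r, hr, h⟩ := ex_supp hk
  refine ⟨r, hr.trans (natDegree_mul_le.trans ?_), h⟩
  rw [prodB_deg]
  gcongr
  compute_degree

lemma fam_coeff_low (m : ℕ) (B : Finset ℝ) (τ : ℝ) : (fam m B τ).coeff m = (hB m B).coeff m := by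
  have h1 := ex_coeff m ((∏ b ∈ B, (X - C b)) * (1 - C τ * X)) 0
  have h2 := ex_coeff m (∏ b ∈ B, (X - C b)) 0
  rw [mul_zero, add_zero] at h1 h2
  rw [fam, hB, h1, h2, mul_coeff_zero]; simp

lemma fam_coeff_top (m : ℕ) (B : Finset ℝ) {τ : ℝ} (hτ : 0 < τ) : (fam m B τ).coeff (2 * (B.card + 1) + m) ≠ 0 := by
  have h1 := ex_coeff m ((∏ b ∈ B, (X - C b)) * (1 - C τ * X)) (B.card + 1)
  rw [Nat.add_comm _ m, fam, h1]
  have h2 : (1 - C τ * X : ℝ[X]) = C (-τ) * (X - C τ⁻¹) := by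
    have : (C τ * C τ⁻¹ : ℝ[X]) = 1 := by rw [← C_mul, mul_inv_cancel₀ hτ.ne', C_1]
    rw [C_neg]
    linear_combination -this
  have h3 : ((∏ b ∈ B, (X - C b)) * (1 - C τ * X) : ℝ[X]) ≠ 0 := by
    rw [h2]
    exact mul_ne_zero (prodB_ne B) (mul_ne_zero (C_ne_zero.2 (neg_ne_zero.2 hτ.ne')) (X_sub_C_ne_zero _))
  have h4 : ((∏ b ∈ B, (X - C b)) * (1 - C τ * X) : ℝ[X]).natDegree = B.card + 1 := by
    rw [natDegree_mul (prodB_ne B) (right_ne_zero_of_mul h3), prodB_deg, h2, natDegree_C_mul (neg_ne_zero.2 hτ.ne'), natDegree_X_sub_C]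
  rw [← h4]
  simpa using h3

section
variable {e : ℕ}

lemma Sol_rec {l : Fin (e + 1) → ℕ} (hl : Function.Injective l) {m : ℕ} (hm : m ≤ 1) (B : Finset ℝ)
    (hB0 : ∀ b ∈ B, 0 < b) {b : ℝ} (hb : 0 < b) (hbB : ∀ b' ∈ B, b' < b)
    (hs : ∑ i, l i = 2 * (B.card + 1) + m + tri (e + 1)) :
    (Sol l (hB m (insert b B))).ncard = ∑ i ∈ RR l, (Sol (low l i) (hB m B)).ncard := by
  classical
  by_cases hM : (AA l l).card = B.card + 1
  · have hS : ∀ τ, 0 < τ → τ ≤ b⁻¹ → τ⁻¹ ∉ B := by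
      intro τ h0 h1 h2
      have h3 := hbB _ h2
      have h4 := (le_inv_comm₀ h0 hb).1 h1
      linarith
    have hc : ∀ τ, (fam m B τ).coeff m = (hB m B).coeff m := fam_coeff_low m B
    have hc0 := hB_coeff m B hB0
    have hRD : ∀ τ, 0 < τ → τ ≤ b⁻¹ → RD (fam m B τ) := by
      intro τ h0 h1
      rw [fam_pos m B h0.ne' (hS τ h0 h1)]
      refine (RD_hB hm _ ?_).cmul (neg_ne_zero.2 h0.ne')
      intro b' hb'
      rcases Finset.mem_insert.1 hb' with rfl | hb'
      · positivity
      · exact hB0 _ hb'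
    have h1 := count_low hl hm hs hM (fam m B) (fam_smooth m B) (fam_supp m B) _ hc0 hc
      (by rw [fam_zero]; exact RD_hB hm B hB0) (fun τ hτ => fam_coeff_top m B hτ) (by rw [fam_zero, hB_natDegree])
    have h2 : ∀ᶠ τ in 𝓝[>] (0 : ℝ), τ ∈ Set.Ioo 0 b⁻¹ := Ioo_mem_nhdsGT (by positivity)
    obtain ⟨τ, h3, h4, h5⟩ := (h1.and h2).exists
    have h6 : (Sol l (fam m B τ)).ncard = (Sol l (fam m B b⁻¹)).ncard := by
      refine isPreconnected_Icc.constant (s := Set.Icc τ b⁻¹) (f := fun τ => (Sol l (fam m B τ)).ncard) ?_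
        (Set.left_mem_Icc.2 h5.le) (Set.right_mem_Icc.2 h5.le)
      intro τ0 hτ0
      refine ContinuousAt.continuousWithinAt ?_
      have h7 := count_same hl hm hs hM (fam m B) (fam_smooth m B) (fam_supp m B) _ hc0 hc τ0
        (hRD τ0 (h4.trans_le hτ0.1) hτ0.2) (fam_coeff_top m B (h4.trans_le hτ0.1))
      exact tendsto_const_nhds.congr' (h7.mono fun _ h => h.symm)
    rw [h3, fam_zero, fam_pos m B (by positivity) (hS _ (by positivity) le_rfl), Sol_smul, inv_inv] at h6
    · exact h6.symm
    · exact neg_ne_zero.2 (by positivity)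
  · have h1 : Sol l (hB m (insert b B)) = ∅ := by
      rw [Set.eq_empty_iff_forall_notMem]
      intro f hf
      refine hM (card_of_point hm (hB_coeff m _ ?_) hs hf)
      intro b' hb'
      rcases Finset.mem_insert.1 hb' with rfl | hb'
      · positivity
      · exact hB0 _ hb'
    rw [h1, Set.ncard_empty]
    symm
    refine Finset.sum_eq_zero fun i hi => ?_
    have h2 : Sol (low l i) (hB m B) = ∅ := by
      rw [Set.eq_empty_iff_forall_notMem]
      intro f hf
      have h5 := low_sum hi
      have h3 := card_of_point (M := B.card) hm (hB_coeff m _ hB0) (by omega) hf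
      have hp : ∀ t, low l i t % 2 = l t % 2 := by
        intro t
        by_cases ht : t = i
        · subst ht; rw [low_self]; have := (mem_RR.1 hi).1; omega
        · rw [low_ne _ ht]
      have h4 := card_AA_compare l (low l i) hl hf.1.inj hp
      have h6 : ∑ t, l t = ∑ t, (2 * (l t / 2) + low l i t % 2) :=
        Finset.sum_congr rfl fun t _ => by have := hp t; omega
      have h7 : ∑ t, low l i t = ∑ t, (2 * (low l i t / 2) + low l i t % 2) := Finset.sum_congr rfl fun i _ => by omega
      rw [Finset.sum_add_distrib, ← Finset.mul_sum] at h6 h7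
      exact hM (by omega)
    rw [h2, Set.ncard_empty]

lemma Sol_base {d : ℕ} {l : Fin d → ℕ} (hl : Function.Injective l) {m : ℕ} (hm : m ≤ 1)
    (hs : ∑ i, l i = m + tri d) : (Sol l (hB m ∅)).ncard = 1 := by
  have hA := AA_empty l hl m hm hs
  rw [Set.ncard_eq_one]
  refine ⟨fun i => X ^ l i, ?_⟩
  have hred : Red l (fun i => (X ^ l i : ℝ[X])) := by
    constructor
    · ext i j
      simp only [At, Matrix.of_apply, coeff_X_pow, Matrix.one_apply]
      simp only [hl.eq_iff, eq_comm]
    · intro i k hk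
      simp only [coeff_X_pow, ne_eq, ite_eq_right_iff, one_ne_zero, imp_false, not_not] at hk
      subst hk; simp
  ext f
  rw [Set.mem_singleton_iff]
  constructor
  · rintro ⟨h1, -⟩
    have := ch_crd (l := l) (J := l) (f := f) ⟨h1.1, h1.2⟩ hl
    rw [← this]
    ext i k
    simp only [ch, coeff_add, dirn_coeff, hA]
    simp
  · rintro rfl
    refine ⟨hred, ?_⟩
    have h1 : ∀ k, (wr fun i => (X ^ l i : ℝ[X])).coeff k ≠ 0 → k = m := by
      intro k hk
      obtain ⟨g, hg, hg1, hg2⟩ := wr_supp _ k hk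
      have : g = l := by
        ext i
        have := hg1 i
        simp only [coeff_X_pow, ne_eq, ite_eq_right_iff, one_ne_zero, imp_false, not_not] at this
        exact this
      subst this
      omega
    refine ⟨(wr fun i => (X ^ l i : ℝ[X])).coeff m, ?_⟩
    ext k
    simp only [hB, ex, Finset.prod_empty, map_one, mul_one, coeff_C_mul, coeff_X_pow]
    by_cases hk : k = m
    · subst hk; simp
    · simp only [hk, if_false, mul_zero]
      by_contra h2
      exact hk (h1 k h2)

end
end
end WS

open Polynomial Filter Topology
open scoped Matrix

namespace WS
noncomputable section

section comb
variable {d w : ℕ}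

def ell (lam : PartitionIn d w) (i : Fin d) : ℕ := lam.part i + (d - 1 - i)

lemma ell_anti (lam : PartitionIn d w) {i j : Fin d} (h : i < j) : ell lam j < ell lam i := by
  have h1 := lam.antitone (show (i : ℕ) ≤ j from h.le)
  have h2 : (i : ℕ) < j := h
  have h3 := j.2
  simp only [ell]; omega

lemma ell_inj (lam : PartitionIn d w) : Function.Injective (ell lam) := by
  intro i j hij
  rcases lt_trichotomy i j with h | h | h
  · have := ell_anti lam h; omega
  · exact h
  · have := ell_anti lam h; omega

lemma ell_sum (lam : PartitionIn d w) : ∑ i, ell lam i = lam.size + tri d := by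
  simp only [ell, Finset.sum_add_distrib, PartitionIn.size, tri]
  rw [Finset.sum_range]
  congr 1
  rw [← Finset.sum_range (fun i => d - 1 - i)]
  rw [Finset.sum_range_reflect (fun i => i) d]
  exact Finset.sum_range (fun i => i)

/-- horizontal / vertical removable dominoes in row `i` -/
def hC (lam : PartitionIn d w) (i : ℕ) : Prop := lam.part (i + 1) + 2 ≤ lam.part i
def vC (lam : PartitionIn d w) (i : ℕ) : Prop := lam.part (i + 1) = lam.part i ∧ lam.part (i + 2) + 1 ≤ lam.part i

lemma pos_lt (lam : PartitionIn d w) {i : ℕ} (h : 0 < lam.part i) : i < d := by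
  by_contra h'
  rw [lam.eq_zero i (by omega)] at h
  omega

lemma mem_RR_ell (lam : PartitionIn d w) (i : Fin d) : i ∈ RR (ell lam) ↔ hC lam i ∨ vC lam i := by
  rw [mem_RR]
  have hi := i.2
  constructor
  · rintro ⟨h1, h2⟩
    by_cases hd1 : (i : ℕ) + 1 < d
    · have h3 := h2 ⟨i + 1, hd1⟩
      have h4 := lam.antitone (show (i : ℕ) ≤ i + 1 by omega)
      simp only [ell] at h1 h3
      by_cases h5 : lam.part (i + 1) = lam.part i
      · right
        refine ⟨h5, ?_⟩
        by_cases hd2 : (i : ℕ) + 2 < d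
        · have h6 := h2 ⟨i + 2, hd2⟩
          have h7 := lam.antitone (show (i : ℕ) ≤ i + 2 by omega)
          simp only [ell] at h6
          omega
        · rw [lam.eq_zero (i + 2) (by omega)]
          omega
      · left
        simp only [hC]
        omega
    · left
      simp only [hC]
      rw [lam.eq_zero (i + 1) (by omega)]
      simp only [ell] at h1
      omega
  · intro h
    constructor
    · simp only [ell]
      rcases h with h | h
      · simp only [hC] at h; omega
      · have := pos_lt lam (show 0 < lam.part (i + 1) by have := h.1; have := h.2; omega)
        have := h.2
        omega
    · intro s hs
      simp only [ell] at hs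
      have hs2 := s.2
      rcases h with h | h
      · simp only [hC] at h
        rcases le_or_gt (s : ℕ) i with h1 | h1
        · have := lam.antitone h1; omega
        · have := lam.antitone (show (i : ℕ) + 1 ≤ s from h1); omega
      · have h3 := h.1
        have h4 := h.2
        rcases le_or_gt (s : ℕ) i with h1 | h1
        · have := lam.antitone h1; omega
        · rcases eq_or_lt_of_le (show (i : ℕ) + 1 ≤ s from h1) with h5 | h5
          · rw [← h5] at hs; omega
          · have := lam.antitone (show (i : ℕ) + 2 ≤ s from h5); omega

def remf (lam : PartitionIn d w) (i k : ℕ) : ℕ :=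
  open Classical in
  if hC lam i then (if k = i then lam.part k - 2 else lam.part k) else
    (if k = i ∨ k = i + 1 then lam.part k - 1 else lam.part k)

lemma remf_le (lam : PartitionIn d w) (i k : ℕ) : remf lam i k ≤ lam.part k := by
  simp only [remf]; split_ifs <;> omega

lemma remf_h {lam : PartitionIn d w} {i : ℕ} (h : hC lam i) (k : ℕ) : remf lam i k = if k = i then lam.part k - 2 else lam.part k := by
  rw [remf, if_pos h]

lemma remf_v {lam : PartitionIn d w} {i : ℕ} (h : vC lam i) (k : ℕ) : remf lam i k = if k = i ∨ k = i + 1 then lam.part k - 1 else lam.part k := by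
  rw [remf, if_neg]
  have := h.1
  simp only [hC]; omega

lemma remf_anti {lam : PartitionIn d w} {i : ℕ} (h : hC lam i ∨ vC lam i) {a b : ℕ} (hab : a ≤ b) : remf lam i b ≤ remf lam i a := by
  have h0 := lam.antitone hab
  rcases h with h | h
  · rw [remf_h h, remf_h h]
    simp only [hC] at h
    split_ifs with h1 h2 h2
    · omega
    · omega
    · subst h2
      have := lam.antitone (show a + 1 ≤ b by omega)
      omega
    · omega
  · rw [remf_v h, remf_v h]
    obtain ⟨h3, h4⟩ := h
    split_ifs with h1 h2 h2
    · omega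
    · omega
    · have h5 := lam.antitone (show i + 2 ≤ b by omega)
      rcases h2 with rfl | rfl <;> omega
    · omega

def rem (lam : PartitionIn d w) (i : ℕ) (h : hC lam i ∨ vC lam i) : PartitionIn d w where
  part := remf lam i
  antitone := fun _ _ hab => remf_anti h hab
  le_w := fun k => (remf_le lam i k).trans (lam.le_w k)
  eq_zero := fun k hk => by have := remf_le lam i k; rw [lam.eq_zero k hk] at this; omega

lemma ell_rem (lam : PartitionIn d w) (i : Fin d) (h : hC lam i ∨ vC lam i) :
    ∃ σ : Equiv.Perm (Fin d), ∀ t, ell (rem lam i h) t = low (ell lam) i (σ t) := by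
  have hi := i.2
  rcases h with h | h
  · refine ⟨1, fun t => ?_⟩
    rw [Equiv.Perm.one_apply]
    by_cases ht : t = i
    · subst ht
      rw [low_self]
      simp only [ell, rem, remf_h h, if_true]
      simp only [hC] at h; omega
    · rw [low_ne _ ht]
      simp only [ell, rem, remf_h h]
      rw [if_neg (fun h => ht (Fin.ext h))]
  · have h3 := h.1
    have h4 := h.2
    have h1 := pos_lt lam (show 0 < lam.part (i + 1) by omega)
    refine ⟨Equiv.swap i ⟨i + 1, h1⟩, fun t => ?_⟩
    have hne : (⟨i + 1, h1⟩ : Fin d) ≠ i := by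
      intro h; have := congrArg Fin.val h; simp at this
    by_cases ht : t = i
    · subst ht
      rw [Equiv.swap_apply_left, low_ne _ hne]
      simp only [ell, rem, remf_v h, true_or, if_true]
      omega
    · by_cases ht2 : t = ⟨i + 1, h1⟩
      · subst ht2
        rw [Equiv.swap_apply_right, low_self]
        simp only [ell, rem, remf_v h, or_true, if_true]
        omega
      · rw [Equiv.swap_apply_of_ne_of_ne ht ht2, low_ne _ ht]
        simp only [ell, rem, remf_v h]
        rw [if_neg]
        rintro (h | h)
        · exact ht (Fin.ext h)
        · exact ht2 (Fin.ext h)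

lemma rem_size (lam : PartitionIn d w) (i : Fin d) (h : hC lam i ∨ vC lam i) : (rem lam i h).size + 2 = lam.size := by
  obtain ⟨σ, hσ⟩ := ell_rem lam i h
  have h1 := low_sum ((mem_RR_ell lam i).2 h)
  have h2 := ell_sum (rem lam i h)
  have h3 := ell_sum lam
  have h4 : ∑ t, ell (rem lam i h) t = ∑ t, low (ell lam) i t := by
    simp only [hσ]; exact Equiv.sum_comp σ (low (ell lam) i)
  omega

lemma Sol_perm {l l' : Fin d → ℕ} (σ : Equiv.Perm (Fin d)) (h : ∀ t, l' t = l (σ t)) (p : ℝ[X]) :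
    (Sol l' p).ncard = (Sol l p).ncard := by
  have key : ∀ {l l' : Fin d → ℕ} (σ : Equiv.Perm (Fin d)) (h : ∀ t, l' t = l (σ t)) (f : Fin d → ℝ[X]), f ∈ Sol l p → f ∘ σ ∈ Sol l' p := by
    intro l l' σ h f hf
    obtain ⟨⟨h1, h2⟩, γ, h3⟩ := hf
    refine ⟨⟨?_, ?_⟩, ?_⟩
    · ext i j
      have := congrFun (congrFun h1 (σ i)) (σ j)
      simp only [At, Matrix.of_apply, Function.comp, h, Matrix.one_apply] at this ⊢
      rw [this]; simp
    · intro i k hk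
      rw [h]; exact h2 _ _ hk
    · have h4 : wr (f ∘ σ) = (Equiv.Perm.sign σ : ℝ[X]) * wr f := by
        rw [wr, wr, ← Matrix.det_permute]; rfl
      rw [h4, h3]
      rcases Int.units_eq_one_or (Equiv.Perm.sign σ) with h | h
      · exact ⟨γ, by simp [h]⟩
      · exact ⟨-γ, by simp [h]⟩
  refine Set.ncard_congr (fun f _ => f ∘ σ.symm) (fun f hf => key σ.symm (fun t => by rw [h]; simp) f hf) ?_ ?_
  · intro f g _ _ hfg
    ext1 t
    have := congrFun hfg (σ t)
    simpa using this
  · intro f hf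
    exact ⟨f ∘ σ, key σ h f hf, by ext1 t; simp⟩

end comb
end
end WS

open Polynomial Filter Topology
open scoped Matrix

namespace WS
noncomputable section

section comb
variable {d w : ℕ}

lemma ribbon_of_adj {p q : ℕ × ℕ} (h : BoxAdj p q) : IsRibbon 2 {p, q} := by
  have hne : p ≠ q := by
    rintro rfl
    rcases h with ⟨-, h | h⟩ | ⟨-, h | h⟩ <;> omega
  have hs : BoxAdj q p := by
    rcases h with ⟨h1, h2⟩ | ⟨h1, h2⟩
    · exact Or.inl ⟨h1.symm, h2.symm⟩
    · exact Or.inr ⟨h1.symm, h2.symm⟩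
  refine ⟨Set.ncard_pair hne, ?_, ?_⟩
  · rintro a (rfl | rfl) b (rfl | rfl)
    · exact Relation.ReflTransGen.refl
    · exact Relation.ReflTransGen.single ⟨by simp, by simp, h⟩
    · exact Relation.ReflTransGen.single ⟨by simp, by simp, hs⟩
    · exact Relation.ReflTransGen.refl
  · rintro ⟨i, j, h1, h2, h3, -⟩
    simp only [Set.mem_insert_iff, Set.mem_singleton_iff] at h1 h2 h3
    obtain ⟨a, b⟩ := p
    obtain ⟨a', b'⟩ := q
    simp only [Prod.mk.injEq] at h1 h2 h3
    omega

lemma adj_of_ribbon {S : Set (ℕ × ℕ)} (h : IsRibbon 2 S) :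
    ∃ a b, S = {(a, b), (a, b + 1)} ∨ S = {(a, b), (a + 1, b)} := by
  obtain ⟨h1, h2, -⟩ := h
  obtain ⟨p, q, hne, rfl⟩ := Set.ncard_eq_two.1 h1
  have h3 : BoxAdj p q := by
    have h4 := h2 p (by simp) q (by simp)
    rcases Relation.ReflTransGen.cases_head h4 with h5 | ⟨c, ⟨-, h6, h7⟩, -⟩
    · exact absurd h5 hne
    · rcases h6 with rfl | rfl
      · rcases h7 with ⟨-, h | h⟩ | ⟨-, h | h⟩ <;> omega
      · exact h7
  obtain ⟨a, b⟩ := p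
  obtain ⟨a', b'⟩ := q
  rcases h3 with ⟨h, h' | h'⟩ | ⟨h, h' | h'⟩ <;> simp only at h h' <;> subst h <;> subst h'
  · exact ⟨a, b, Or.inl rfl⟩
  · exact ⟨a, b', Or.inl (Set.pair_comm _ _)⟩
  · exact ⟨a, b, Or.inr rfl⟩
  · exact ⟨a', b, Or.inr (Set.pair_comm _ _)⟩

/-- the boxes removed -/
lemma rem_boxes {lam : PartitionIn d w} {i : ℕ} (h : hC lam i ∨ vC lam i) :
    ∃ p q : ℕ × ℕ, BoxAdj p q ∧ ∀ a b, (remf lam i a ≤ b ∧ b < lam.part a) ↔ ((a, b) = p ∨ (a, b) = q) := by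
  rcases h with h | h
  · have h' := h
    simp only [hC] at h'
    refine ⟨(i, lam.part i - 2), (i, lam.part i - 1), Or.inl ⟨rfl, Or.inl (by simp only; omega)⟩, ?_⟩
    intro a b
    rw [remf_h h, Prod.mk.injEq, Prod.mk.injEq]
    split_ifs with h1
    · subst h1; omega
    · omega
  · obtain ⟨h1, h2⟩ := id h
    refine ⟨(i, lam.part i - 1), (i + 1, lam.part i - 1), Or.inr ⟨rfl, Or.inl rfl⟩, ?_⟩
    intro a b
    rw [remf_v h, Prod.mk.injEq, Prod.mk.injEq]
    split_ifs with h3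
    · rcases h3 with rfl | rfl <;> omega
    · omega

lemma rem_of_boxes_h {lam : PartitionIn d w} {a b : ℕ} (h1 : lam.part a = b + 2) (h2 : lam.part (a + 1) ≤ b) :
    hC lam a ∧ ∀ r c, (remf lam a r ≤ c ∧ c < lam.part r) ↔ ((r, c) = (a, b) ∨ (r, c) = (a, b + 1)) := by
  have h : hC lam a := by simp only [hC]; omega
  refine ⟨h, fun r c => ?_⟩
  rw [remf_h h, Prod.mk.injEq, Prod.mk.injEq]
  split_ifs with h3
  · subst h3; omega
  · omega

lemma rem_of_boxes_v {lam : PartitionIn d w} {a b : ℕ} (h1 : lam.part a = b + 1) (h1' : lam.part (a + 1) = b + 1) (h2 : lam.part (a + 2) ≤ b) :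
    vC lam a ∧ ∀ r c, (remf lam a r ≤ c ∧ c < lam.part r) ↔ ((r, c) = (a, b) ∨ (r, c) = (a + 1, b)) := by
  have h : vC lam a := ⟨by omega, by omega⟩
  refine ⟨h, fun r c => ?_⟩
  rw [remf_v h, Prod.mk.injEq, Prod.mk.injEq]
  split_ifs with h3
  · rcases h3 with rfl | rfl <;> omega
  · omega

def extE (nu lam mu : PartitionIn d w) (M : ℕ) (E : ℕ → ℕ → ℕ) : ℕ → ℕ → ℕ := fun i j =>
  open Classical in
  if InShape nu mu i j then E i j else if InShape lam mu i j then M + 1 else 0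

/-- extension is a tableau -/
lemma ext_srt {nu lam mu : PartitionIn d w} {M : ℕ} {E : ℕ → ℕ → ℕ} (hnl : ∀ k, nu.part k ≤ lam.part k) (hmn : ∀ k, mu.part k ≤ nu.part k)
    {p q : ℕ × ℕ} (hpq : BoxAdj p q)
    (hb : ∀ a b, (nu.part a ≤ b ∧ b < lam.part a) ↔ ((a, b) = p ∨ (a, b) = q)) (hE : IsSRT 2 M nu mu E) :
    IsSRT 2 (M + 1) lam mu (extE nu lam mu M E) := by
  obtain ⟨e1, e2, e3, e4, e5⟩ := hE
  have hin : ∀ i j, InShape nu mu i j → InShape lam mu i j := fun i j h => ⟨h.1, h.2.1, h.2.2.trans_le (hnl i)⟩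
  have hv1 : ∀ i j, InShape nu mu i j → extE nu lam mu M E i j = E i j := fun i j h => by rw [extE, if_pos h]
  have hv2 : ∀ i j, InShape lam mu i j → ¬ InShape nu mu i j → extE nu lam mu M E i j = M + 1 := fun i j h h' => by
    rw [extE, if_neg h', if_pos h]
  have hle : ∀ i j, InShape lam mu i j → 1 ≤ extE nu lam mu M E i j ∧ extE nu lam mu M E i j ≤ M + 1 := by
    intro i j h
    by_cases h' : InShape nu mu i j
    · rw [hv1 i j h']; have := e2 i j h'; omega
    · rw [hv2 i j h h']; omega
  refine ⟨?_, hle, ?_, ?_, ?_⟩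
  · intro i j h
    rw [extE, if_neg (fun h' => h (hin i j h')), if_neg h]
  · intro i j j' h h' hjj
    by_cases h1 : InShape nu mu i j'
    · have h2 : InShape nu mu i j := ⟨h.1, h.2.1, hjj.trans_lt h1.2.2⟩
      rw [hv1 _ _ h1, hv1 _ _ h2]; exact e3 _ _ _ h2 h1 hjj
    · rw [hv2 _ _ h' h1]; exact (hle _ _ h).2
  · intro i i' j h h' hii
    by_cases h1 : InShape nu mu i' j
    · have h2 : InShape nu mu i j := ⟨h.1, h.2.1, h1.2.2.trans_le (nu.antitone hii)⟩
      rw [hv1 _ _ h1, hv1 _ _ h2]; exact e4 _ _ _ h2 h1 hii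
    · rw [hv2 _ _ h' h1]; exact (hle _ _ h).2
  · intro k hk1 hk2
    by_cases hk : k = M + 1
    · subst hk
      have : {p : ℕ × ℕ | InShape lam mu p.1 p.2 ∧ extE nu lam mu M E p.1 p.2 = M + 1} = {p, q} := by
        ext ⟨a, b⟩
        simp only [Set.mem_setOf_eq, Set.mem_insert_iff, Set.mem_singleton_iff]
        rw [← hb a b]
        constructor
        · rintro ⟨h1, h2⟩
          refine ⟨?_, h1.2.2⟩
          by_contra h3
          have h4 : InShape nu mu a b := ⟨h1.1, h1.2.1, by omega⟩
          rw [hv1 _ _ h4] at h2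
          have := e2 _ _ h4
          omega
        · rintro ⟨h1, h2⟩
          have h3 : InShape lam mu a b := ⟨pos_lt lam (by omega), (hmn a).trans h1, h2⟩
          refine ⟨h3, hv2 _ _ h3 fun h4 => ?_⟩
          have := h4.2.2
          omega
      rw [this]
      exact ribbon_of_adj hpq
    · have := e5 k hk1 (by omega)
      convert this using 1
      ext ⟨a, b⟩
      simp only [Set.mem_setOf_eq]
      constructor
      · rintro ⟨h1, h2⟩
        by_cases h3 : InShape nu mu a b
        · exact ⟨h3, by rw [hv1 _ _ h3] at h2; exact h2⟩
        · rw [hv2 _ _ h1 h3] at h2; omega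
      · rintro ⟨h1, h2⟩
        exact ⟨hin _ _ h1, by rw [hv1 _ _ h1]; exact h2⟩

/-- restriction is a tableau -/
lemma res_srt {nu lam mu : PartitionIn d w} {M : ℕ} {E : ℕ → ℕ → ℕ} (hnl : ∀ k, nu.part k ≤ lam.part k)
    (hE : IsSRT 2 (M + 1) lam mu E) (hT : ∀ a b, InShape lam mu a b → (E a b = M + 1 ↔ ¬ InShape nu mu a b)) :
    ∃ E', IsSRT 2 M nu mu E' ∧ extE nu lam mu M E' = E := by
  classical
  obtain ⟨e1, e2, e3, e4, e5⟩ := hE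
  have hin : ∀ i j, InShape nu mu i j → InShape lam mu i j := fun i j h => ⟨h.1, h.2.1, h.2.2.trans_le (hnl i)⟩
  refine ⟨fun i j => if InShape nu mu i j then E i j else 0, ⟨?_, ?_, ?_, ?_, ?_⟩, ?_⟩
  · intro i j h; simp only [if_neg h]
  · intro i j h
    simp only [if_pos h]
    have h1 := e2 i j (hin _ _ h)
    have h2 := (hT i j (hin _ _ h)).not.2 (not_not.2 h)
    omega
  · intro i j j' h h' hjj
    simp only [if_pos h, if_pos h']
    exact e3 _ _ _ (hin _ _ h) (hin _ _ h') hjj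
  · intro i i' j h h' hii
    simp only [if_pos h, if_pos h']
    exact e4 _ _ _ (hin _ _ h) (hin _ _ h') hii
  · intro k hk1 hk2
    have := e5 k hk1 (by omega)
    convert this using 1
    ext ⟨a, b⟩
    simp only [Set.mem_setOf_eq]
    constructor
    · rintro ⟨h1, h2⟩
      rw [if_pos h1] at h2
      exact ⟨hin _ _ h1, h2⟩
    · rintro ⟨h1, h2⟩
      have h3 : InShape nu mu a b := by
        by_contra h3
        have := (hT a b h1).2 h3
        omega
      exact ⟨h3, by rw [if_pos h3]; exact h2⟩
  · ext i j
    simp only [extE]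
    by_cases h : InShape nu mu i j
    · simp only [if_pos h]
    · rw [if_neg h]
      by_cases h' : InShape lam mu i j
      · rw [if_pos h']; exact ((hT i j h').2 h).symm
      · rw [if_neg h']; exact (e1 i j h').symm

/-- the largest entry occupies a removable domino -/
lemma top_domino {lam mu : PartitionIn d w} {M : ℕ} {E : ℕ → ℕ → ℕ} (hE : IsSRT 2 (M + 1) lam mu E) :
    ∃ i < d, (hC lam i ∨ vC lam i) ∧ ∀ a b, InShape lam mu a b → (E a b = M + 1 ↔ ¬ (b < remf lam i a)) := by
  obtain ⟨e1, e2, e3, e4, e5⟩ := hE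
  have hR := e5 (M + 1) (by omega) le_rfl
  obtain ⟨a, b, hS⟩ := adj_of_ribbon hR
  have hmem : ∀ r c, (InShape lam mu r c ∧ E r c = M + 1) ↔ (r, c) ∈ {p : ℕ × ℕ | InShape lam mu p.1 p.2 ∧ E p.1 p.2 = M + 1} := fun r c => Iff.rfl
  have hright : ∀ r c, InShape lam mu r c ∧ E r c = M + 1 → c + 1 < lam.part r → InShape lam mu r (c + 1) ∧ E r (c + 1) = M + 1 := by
    rintro r c ⟨h1, h2⟩ h3
    have h4 : InShape lam mu r (c + 1) := ⟨h1.1, by have := h1.2.1; omega, h3⟩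
    have := e3 r c (c + 1) h1 h4 (by omega)
    have := e2 _ _ h4
    exact ⟨h4, by omega⟩
  have hdown : ∀ r c, InShape lam mu r c ∧ E r c = M + 1 → c < lam.part (r + 1) → InShape lam mu (r + 1) c ∧ E (r + 1) c = M + 1 := by
    rintro r c ⟨h1, h2⟩ h3
    have h4 : InShape lam mu (r + 1) c := ⟨pos_lt lam (by omega), by have := h1.2.1; have := mu.antitone (show r ≤ r + 1 by omega); omega, h3⟩
    have := e4 r (r + 1) c h1 h4 (by omega)
    have := e2 _ _ h4
    exact ⟨h4, by omega⟩
  have fin : ∀ i, (hC lam i ∨ vC lam i) → (∀ r c, (remf lam i r ≤ c ∧ c < lam.part r) ↔ (InShape lam mu r c ∧ E r c = M + 1)) →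
      ∀ a b, InShape lam mu a b → (E a b = M + 1 ↔ ¬ (b < remf lam i a)) := by
    intro i hi hrc r c hsh
    rw [not_lt]
    constructor
    · intro h; exact ((hrc r c).2 ⟨hsh, h⟩).1
    · intro h; exact ((hrc r c).1 ⟨h, hsh.2.2⟩).2
  rcases hS with hS | hS
  · simp only [hS, Set.mem_insert_iff, Set.mem_singleton_iff] at hmem
    have m1 := (hmem a b).2 (by simp)
    have m2 := (hmem a (b + 1)).2 (by simp)
    have h1 : lam.part a = b + 2 := by
      have := m2.1.2.2
      by_contra hne
      have := (hmem _ _).1 (hright _ _ m2 (by omega))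
      simp only [Prod.mk.injEq] at this
      omega
    have h2 : lam.part (a + 1) ≤ b := by
      by_contra hne
      have := (hmem _ _).1 (hdown _ _ m1 (by omega))
      simp only [Prod.mk.injEq] at this
      omega
    obtain ⟨hc, hb⟩ := rem_of_boxes_h h1 h2
    exact ⟨a, m1.1.1, Or.inl hc, fin a (Or.inl hc) fun r c => by rw [hb, hmem]⟩
  · simp only [hS, Set.mem_insert_iff, Set.mem_singleton_iff] at hmem
    have m1 := (hmem a b).2 (by simp)
    have m2 := (hmem (a + 1) b).2 (by simp)
    have h1 : lam.part a = b + 1 := by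
      have := m1.1.2.2
      by_contra hne
      have := (hmem _ _).1 (hright _ _ m1 (by omega))
      simp only [Prod.mk.injEq] at this
      omega
    have h1' : lam.part (a + 1) = b + 1 := by
      have := m2.1.2.2
      by_contra hne
      have := (hmem _ _).1 (hright _ _ m2 (by omega))
      simp only [Prod.mk.injEq] at this
      omega
    have h2 : lam.part (a + 2) ≤ b := by
      by_contra hne
      have := (hmem _ _).1 (hdown _ _ m2 (show b < lam.part (a + 2) by omega))
      simp only [Prod.mk.injEq] at this
      omega
    obtain ⟨hc, hb⟩ := rem_of_boxes_v h1 h1' h2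
    exact ⟨a, m1.1.1, Or.inr hc, fin a (Or.inr hc) fun r c => by rw [hb, hmem]⟩

lemma mu_le {lam mu : PartitionIn d w} (hm : mu.size ≤ 1) (h : mu.size ≤ lam.size) (k : ℕ) : mu.part k ≤ lam.part k := by
  by_cases hk : k < d
  swap
  · rw [mu.eq_zero k (by omega)]; exact Nat.zero_le _
  have h1 : mu.part k ≤ mu.size := Finset.single_le_sum (f := mu.part) (fun _ _ => Nat.zero_le _) (Finset.mem_range.2 hk)
  by_contra hlt
  have hk0 : k = 0 := by
    by_contra hk0
    have h2 := mu.antitone (Nat.zero_le k)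
    have h3 : mu.part 0 + mu.part k ≤ mu.size := by
      have : ∑ i ∈ ({0, k} : Finset ℕ), mu.part i ≤ mu.size := Finset.sum_le_sum_of_subset (by
        intro x hx; simp only [Finset.mem_insert, Finset.mem_singleton] at hx; rw [Finset.mem_range]; omega)
      rwa [Finset.sum_pair (Ne.symm hk0)] at this
    omega
  subst hk0
  have h4 : lam.size = 0 := Finset.sum_eq_zero fun i _ => by have := lam.antitone (Nat.zero_le i); omega
  omega

lemma SRT_rec {lam mu : PartitionIn d w} {M : ℕ} (hm : mu.size ≤ 1) (hs : lam.size = 2 * (M + 1) + mu.size)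
    (hfin : ∀ i : RR (ell lam), {E | IsSRT 2 M (rem lam i.1 ((mem_RR_ell lam i.1).1 i.2)) mu E}.Finite) :
    {E | IsSRT 2 (M + 1) lam mu E}.Finite ∧
    {E | IsSRT 2 (M + 1) lam mu E}.ncard = ∑ i : RR (ell lam), {E | IsSRT 2 M (rem lam i.1 ((mem_RR_ell lam i.1).1 i.2)) mu E}.ncard := by
  classical
  have hmn : ∀ i : RR (ell lam), ∀ k, mu.part k ≤ (rem lam i.1 ((mem_RR_ell lam i.1).1 i.2)).part k := by
    intro i
    have := rem_size lam i.1 ((mem_RR_ell lam i.1).1 i.2)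
    exact mu_le hm (by omega)
  have hnl : ∀ i : RR (ell lam), ∀ k, (rem lam i.1 ((mem_RR_ell lam i.1).1 i.2)).part k ≤ lam.part k := fun i k => remf_le lam _ k
  let Φ : (Σ i : RR (ell lam), {E | IsSRT 2 M (rem lam i.1 ((mem_RR_ell lam i.1).1 i.2)) mu E}) → {E | IsSRT 2 (M + 1) lam mu E} :=
    fun x => ⟨extE (rem lam x.1.1 ((mem_RR_ell lam x.1.1).1 x.1.2)) lam mu M x.2.1, by
      obtain ⟨p, q, hpq, hb⟩ := rem_boxes ((mem_RR_ell lam x.1.1).1 x.1.2)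
      exact ext_srt (hnl x.1) (hmn x.1) hpq hb x.2.2⟩
  have hbij : Function.Bijective Φ := by
    constructor
    · have key : ∀ (i i' : RR (ell lam)) E E', i.1 < i'.1 → IsSRT 2 M (rem lam i'.1 ((mem_RR_ell lam i'.1).1 i'.2)) mu E' →
          extE (rem lam i.1 ((mem_RR_ell lam i.1).1 i.2)) lam mu M E ≠ extE (rem lam i'.1 ((mem_RR_ell lam i'.1).1 i'.2)) lam mu M E' := by
        intro i i' E E' hlt hE' heq
        have hi := (mem_RR_ell lam i.1).1 i.2
        have hi' := (mem_RR_ell lam i'.1).1 i'.2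
        have hlt' : (i.1 : ℕ) < i'.1 := hlt
        have h1 : remf lam i.1 i.1 < lam.part i.1 := by
          rcases hi with h | h
          · rw [remf_h h, if_pos rfl]; simp only [hC] at h; omega
          · rw [remf_v h, if_pos (Or.inl rfl)]; have := h.2; omega
        have h2 : remf lam i'.1 i.1 = lam.part i.1 := by
          rcases hi' with h | h
          · rw [remf_h h, if_neg (by omega)]
          · rw [remf_v h, if_neg (by omega)]
        have h3 : mu.part i.1 ≤ remf lam i.1 i.1 := hmn i i.1
        have h4 : InShape lam mu i.1 (lam.part i.1 - 1) := ⟨i.1.2, by omega, by omega⟩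
        have h5 : ¬ InShape (rem lam i.1 hi) mu i.1 (lam.part i.1 - 1) := by
          rintro ⟨-, -, h⟩
          have h' : lam.part i.1 - 1 < remf lam i.1 i.1 := h
          omega
        have h6 : InShape (rem lam i'.1 hi') mu i.1 (lam.part i.1 - 1) :=
          ⟨i.1.2, by omega, by show _ < remf lam i'.1 i.1; omega⟩
        have h7 := congrFun (congrFun heq i.1) (lam.part i.1 - 1)
        simp only [extE] at h7
        rw [if_neg h5, if_pos h4, if_pos h6] at h7
        have := hE'.2.1 _ _ h6
        omega
      rintro ⟨i, E, hE⟩ ⟨i', E', hE'⟩ heq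
      have heq' := congrArg Subtype.val heq
      simp only [Φ] at heq'
      have hii : i = i' := by
        rcases lt_trichotomy i.1 i'.1 with h | h | h
        · exact absurd heq' (key i i' E E' h hE')
        · exact Subtype.ext h
        · exact absurd heq'.symm (key i' i E' E h hE)
      subst hii
      have : E = E' := by
        ext a b
        by_cases h : InShape (rem lam i.1 ((mem_RR_ell lam i.1).1 i.2)) mu a b
        · have h7 := congrFun (congrFun heq' a) b
          simp only [extE, if_pos h] at h7
          exact h7
        · rw [hE.1 _ _ h, hE'.1 _ _ h]
      subst this
      rfl
    · rintro ⟨E, hE⟩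
      obtain ⟨i, hi, hc, hT⟩ := top_domino hE
      have hi' : (⟨i, hi⟩ : Fin d) ∈ RR (ell lam) := (mem_RR_ell lam ⟨i, hi⟩).2 hc
      obtain ⟨E', h1, h2⟩ := res_srt (nu := rem lam i hc) (fun k => remf_le lam i k) hE (fun a b hab => by
        rw [hT a b hab]
        constructor
        · rintro h ⟨-, -, h'⟩; exact h h'
        · intro h h'; exact h ⟨hab.1, hab.2.1, h'⟩)
      exact ⟨⟨⟨⟨i, hi⟩, hi'⟩, ⟨E', h1⟩⟩, Subtype.ext h2⟩
  have : ∀ i : RR (ell lam), Finite {E | IsSRT 2 M (rem lam i.1 ((mem_RR_ell lam i.1).1 i.2)) mu E} := fun i => (hfin i).to_subtype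
  constructor
  · rw [← Set.finite_coe_iff]
    exact Finite.of_equiv _ (Equiv.ofBijective Φ hbij)
  · rw [← Nat.card_coe_set_eq, ← Nat.card_congr (Equiv.ofBijective Φ hbij), Nat.card_sigma]
    rfl

end comb
end
end WS

open Polynomial Filter Topology
open scoped Matrix

namespace WS
noncomputable section

lemma SRT_base {d w : ℕ} {lam mu : PartitionIn d w} (hle : ∀ k, mu.part k ≤ lam.part k) (hs : lam.size = mu.size) :
    {E | IsSRT 2 0 lam mu E} = {fun _ _ => 0} := by
  have h1 : ∀ i ∈ Finset.range d, mu.part i = lam.part i :=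
    (Finset.sum_eq_sum_iff_of_le fun i _ => hle i).1 hs.symm
  have h2 : ∀ i j, ¬ InShape lam mu i j := by
    rintro i j ⟨h3, h4, h5⟩
    have := h1 i (Finset.mem_range.2 h3)
    omega
  ext E
  simp only [Set.mem_setOf_eq, Set.mem_singleton_iff]
  constructor
  · intro h; ext i j; exact h.1 i j (h2 i j)
  · rintro rfl
    refine ⟨fun _ _ _ => rfl, fun i j h => absurd h (h2 i j), fun i j _ h => absurd h (h2 i j), fun i _ j h => absurd h (h2 i j), ?_⟩
    intro k h3 h4; omega

theorem Sol_eq_SRT {e w : ℕ} (mu : PartitionIn (e + 1) w) (hm : mu.size ≤ 1) (B : Finset ℝ) (hB0 : ∀ b ∈ B, 0 < b)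
    (lam : PartitionIn (e + 1) w) (hs : lam.size = 2 * B.card + mu.size) :
    {E | IsSRT 2 B.card lam mu E}.Finite ∧
    (Sol (ell lam) (hB mu.size B)).ncard = {E | IsSRT 2 B.card lam mu E}.ncard := by
  classical
  induction B using Finset.induction_on_max generalizing lam with
  | empty =>
    rw [Finset.card_empty, SRT_base (mu_le hm (by omega)) (by simpa using hs)]
    refine ⟨Set.finite_singleton _, ?_⟩
    rw [Set.ncard_singleton]
    refine Sol_base (ell_inj lam) hm ?_
    rw [ell_sum, hs]; simp
  | insert b B hb ih =>
    have hnb : b ∉ B := fun h => lt_irrefl _ (hb b h)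
    have hB0' : ∀ b ∈ B, 0 < b := fun b' hb' => hB0 b' (Finset.mem_insert_of_mem hb')
    rw [Finset.card_insert_of_notMem hnb] at hs ⊢
    have ih' := fun i : RR (ell lam) => ih hB0' (rem lam i.1 ((mem_RR_ell lam i.1).1 i.2)) (by
      have := rem_size lam i.1 ((mem_RR_ell lam i.1).1 i.2); omega)
    obtain ⟨h1, h2⟩ := SRT_rec hm hs fun i => (ih' i).1
    refine ⟨h1, ?_⟩
    rw [h2, Sol_rec (ell_inj lam) hm B hB0' (hB0 b (Finset.mem_insert_self _ _)) hb (by rw [ell_sum, hs]),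
      ← Finset.sum_coe_sort (RR (ell lam)) (fun i => (Sol (low (ell lam) i) (hB mu.size B)).ncard)]
    refine Finset.sum_congr rfl fun i _ => ?_
    rw [← (ih' i).2]
    obtain ⟨σ, hσ⟩ := ell_rem lam i.1 ((mem_RR_ell lam i.1).1 i.2)
    exact (Sol_perm σ hσ _).symm

end
end WS

open Polynomial Filter Topology
open scoped Matrix

namespace WS
noncomputable section

section part
variable {d w : ℕ}

lemma part_ext {a b : PartitionIn d w} (h : ∀ k, a.part k = b.part k) : a = b := by
  cases a; cases b
  congr
  exact funext h

def small (m : ℕ) (hd : 0 < d) (hm : m ≤ w) : PartitionIn d w where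
  part := fun k => if k = 0 then m else 0
  antitone := by
    intro i j hij
    split_ifs <;> omega
  le_w := by intro i; split_ifs <;> omega
  eq_zero := by intro i hi; rw [if_neg (by omega)]

lemma small_size (m : ℕ) (hd : 0 < d) (hm : m ≤ w) : (small (d := d) m hd hm).size = m := by
  simp only [PartitionIn.size, small, Finset.sum_ite_eq', Finset.mem_range, if_pos hd]

def compl (a : PartitionIn d w) : PartitionIn d w where
  part := fun k => if k < d then w - a.part (d - 1 - k) else 0
  antitone := by
    intro i j hij
    have := a.antitone (show d - 1 - j ≤ d - 1 - i by omega)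
    split_ifs <;> omega
  le_w := by intro i; split_ifs <;> omega
  eq_zero := by intro i hi; rw [if_neg (by omega)]

lemma compl_size (a : PartitionIn d w) : (compl a).size + a.size = d * w := by
  have h1 : (compl a).size = ∑ k ∈ Finset.range d, (w - a.part k) := by
    rw [← Finset.sum_range_reflect (fun k => w - a.part k)]
    exact Finset.sum_congr rfl fun k hk => by
      simp only [compl]; rw [if_pos (Finset.mem_range.1 hk)]
  rw [h1, PartitionIn.size, ← Finset.sum_add_distrib]
  rw [Finset.sum_congr rfl fun k _ => Nat.sub_add_cancel (a.le_w k)]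
  simp

lemma part_unique_small {a b : PartitionIn d w} (ha : a.size ≤ 1) (h : a.size = b.size) : a = b :=
  part_ext fun k => le_antisymm (mu_le ha h.le k) (mu_le (h ▸ ha) h.ge k)

lemma part_unique_big {a b : PartitionIn d w} (ha : d * w ≤ a.size + 1) (h : a.size = b.size) : a = b := by
  have h1 := compl_size a
  have h2 := compl_size b
  have h3 : compl a = compl b := part_unique_small (by omega) (by omega)
  refine part_ext fun k => ?_
  by_cases hk : k < d
  · have h4 := congrArg (fun c => c.part (d - 1 - k)) h3
    simp only [compl] at h4
    rw [if_pos (by omega), if_pos (by omega), show d - 1 - (d - 1 - k) = k by omega] at h4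
    have := a.le_w k
    have := b.le_w k
    omega
  · rw [a.eq_zero k (by omega), b.eq_zero k (by omega)]

/-- a strictly decreasing sequence comes from a partition -/
lemma exists_part {K : Fin d → ℕ} (hK : StrictAnti K) (hlt : ∀ i, K i < w + d) : ∃ lam : PartitionIn d w, ∀ i, ell lam i = K i := by
  have h1 : ∀ (s : ℕ) (i j : Fin d), (j : ℕ) = i + s → K j + s ≤ K i := by
    intro s
    induction s with
    | zero => intro i j h; rw [show j = i from Fin.ext h]; simp
    | succ s ih =>
      intro i j h
      have hj := j.2
      have h2 := ih i ⟨i + s, by omega⟩ rfl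
      have h3 : K j < K ⟨i + s, by omega⟩ := hK (show (⟨i + s, _⟩ : Fin d) < j by rw [Fin.lt_def]; simp only; omega)
      omega
  have h2 : ∀ i : Fin d, d - 1 - i ≤ K i := by
    intro i
    have := i.2
    have := h1 (d - 1 - i) i ⟨d - 1, by omega⟩ (by simp only; omega)
    omega
  have h3 : ∀ i : Fin d, K i + i < w + d := by
    intro i
    have := i.2
    have := h1 i ⟨0, by omega⟩ i (by simp)
    have := hlt ⟨0, by omega⟩
    omega
  refine ⟨⟨fun k => if h : k < d then K ⟨k, h⟩ - (d - 1 - k) else 0, ?_, ?_, ?_⟩, ?_⟩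
  · intro i j hij
    by_cases hj : j < d
    · have hi : i < d := by omega
      simp only [hi, hj, dif_pos]
      have := h1 (j - i) ⟨i, hi⟩ ⟨j, hj⟩ (by simp only; omega)
      omega
    · simp [hj]
  · intro i
    split_ifs with h
    · have := h3 ⟨i, h⟩
      have h4 : ((⟨i, h⟩ : Fin d) : ℕ) = i := rfl
      omega
    · omega
  · intro i hi; rw [dif_neg (by omega)]
  · intro i
    simp only [ell, i.2, dif_pos]
    have := h2 i
    simp only [Fin.eta]; omega

lemma exists_sort (J : Fin d → ℕ) (hJ : Function.Injective J) : ∃ σ : Equiv.Perm (Fin d), StrictAnti (J ∘ σ) := by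
  refine ⟨Fin.revPerm.trans (Tuple.sort J), ?_⟩
  have h1 : StrictMono (J ∘ Tuple.sort J) := (Tuple.monotone_sort J).strictMono_of_injective (hJ.comp (Equiv.injective _))
  intro i j hij
  exact h1 (Fin.rev_lt_rev.2 hij)

lemma sort_ell {J : Fin d → ℕ} (hJ : Function.Injective J) (hlt : ∀ i, J i < w + d) (lam : PartitionIn d w)
    (hl : d * w ≤ lam.size + 1) (hs : ∑ i, J i = lam.size + tri d) : ∃ σ : Equiv.Perm (Fin d), ∀ i, J (σ i) = ell lam i := by
  obtain ⟨σ, hσ⟩ := exists_sort J hJ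
  obtain ⟨lam', h'⟩ := exists_part (w := w) hσ (fun i => hlt _)
  have h1 := ell_sum lam'
  have h2 : ∑ i, ell lam' i = ∑ i, J i := by
    simp only [h', Function.comp]; exact Equiv.sum_comp σ J
  have h3 : lam = lam' := part_unique_big hl (by omega)
  exact ⟨σ, fun i => by rw [h3, h']; rfl⟩

end part

section factor

lemma prod_symm (S : Finset ℝ) (hS : ∀ s ∈ S, -s ∈ S) : ∃ m ≤ 1, ∃ B : Finset ℝ, (∀ b ∈ B, 0 < b) ∧
    ∏ s ∈ S, (X - C s : ℝ[X]) = hB m B := by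
  classical
  set P := S.filter (0 < ·) with hP
  have hinj : Set.InjOn (fun s : ℝ => s ^ 2) P := by
    intro a ha b hb hab
    simp only [hP, Finset.coe_filter, Set.mem_setOf_eq] at ha hb
    exact (pow_left_inj₀ ha.2.le hb.2.le two_ne_zero).1 hab
  have h1 : ∏ s ∈ S, (X - C s : ℝ[X]) = (∏ s ∈ S.filter (· = 0), (X - C s)) * ∏ s ∈ P.image (fun s => s ^ 2), (X ^ 2 - C s) := by
    rw [Finset.prod_image hinj]
    rw [← Finset.prod_filter_mul_prod_filter_not S (· = 0)]
    congr 1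
    rw [← Finset.prod_filter_mul_prod_filter_not (S.filter (¬ · = 0)) (0 < ·)]
    have e1 : (S.filter (¬ · = 0)).filter (0 < ·) = P := by
      ext s; simp only [Finset.mem_filter, hP]
      constructor
      · rintro ⟨⟨h1, -⟩, h2⟩; exact ⟨h1, h2⟩
      · rintro ⟨h1, h2⟩; exact ⟨⟨h1, h2.ne'⟩, h2⟩
    have e2 : ∏ s ∈ (S.filter (¬ · = 0)).filter (¬ 0 < ·), (X - C s : ℝ[X]) = ∏ s ∈ P, (X + C s) := by
      refine Finset.prod_nbij' (fun s => -s) (fun s => -s) ?_ ?_ ?_ ?_ ?_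
      · intro s hs
        simp only [Finset.mem_filter, hP] at hs ⊢
        refine ⟨hS s hs.1.1, ?_⟩
        have := lt_of_le_of_ne (not_lt.1 hs.2) hs.1.2
        linarith
      · intro s hs
        simp only [Finset.mem_filter, hP] at hs ⊢
        exact ⟨⟨hS s hs.1, by linarith [hs.2]⟩, by linarith [hs.2]⟩
      · intro s _; simp
      · intro s _; simp
      · intro s _; simp [sub_eq_add_neg]
    rw [e1, e2, ← Finset.prod_mul_distrib]
    refine Finset.prod_congr rfl fun s _ => ?_
    rw [C_pow]; ring
  refine ⟨(S.filter (· = 0)).card, ?_, P.image (fun s => s ^ 2), ?_, ?_⟩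
  · rw [Finset.card_le_one]
    intro a ha b hb
    simp only [Finset.mem_filter] at ha hb
    rw [ha.2, hb.2]
  · intro b hb
    obtain ⟨s, hs, rfl⟩ := Finset.mem_image.1 hb
    have := (Finset.mem_filter.1 hs).2
    positivity
  · rw [h1, hB, ex, map_prod]
    congr 1
    · rw [← Finset.prod_const]
      refine Finset.prod_congr rfl fun s hs => ?_
      rw [(Finset.mem_filter.1 hs).2]; simp
    · simp

lemma factor (h : ℂ[X]) (hne : h ≠ 0) (heo : h.comp (-X) = h ∨ h.comp (-X) = -h) (hsq : Squarefree h)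
    (hroots : ∀ z ∈ h.roots, z.im = 0) :
    ∃ m ≤ 1, ∃ B : Finset ℝ, (∀ b ∈ B, 0 < b) ∧ ∃ c : ℂ, c ≠ 0 ∧ h = C c * (hB m B).map Complex.ofRealHom := by
  classical
  have hnd : h.roots.Nodup := nodup_roots (PerfectField.separable_iff_squarefree.2 hsq)
  have hsp := IsAlgClosed.splits h
  have hprod := hsp.eq_prod_roots
  set S : Finset ℝ := h.roots.toFinset.image Complex.re with hS
  have hre : ∀ z ∈ h.roots, ((z.re : ℝ) : ℂ) = z := fun z hz => Complex.ext (by simp) (by simp [hroots z hz])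
  have hmem : ∀ s : ℝ, s ∈ S ↔ h.eval (s : ℂ) = 0 := by
    intro s
    rw [hS, Finset.mem_image]
    constructor
    · rintro ⟨z, hz, rfl⟩
      rw [Multiset.mem_toFinset] at hz
      rw [hre z hz]
      exact (mem_roots hne).1 hz
    · intro hs
      exact ⟨s, by rw [Multiset.mem_toFinset, mem_roots hne]; exact hs, by simp⟩
  have hsym : ∀ s ∈ S, -s ∈ S := by
    intro s hs
    rw [hmem] at hs ⊢
    have h1 : (h.comp (-X)).eval (s : ℂ) = h.eval ((-s : ℝ) : ℂ) := by simp [eval_comp]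
    rw [← h1]
    rcases heo with h2 | h2 <;> rw [h2] <;> simp [hs]
  obtain ⟨m, hm, B, hB0, hp⟩ := prod_symm S hsym
  refine ⟨m, hm, B, hB0, h.leadingCoeff, leadingCoeff_ne_zero.2 hne, ?_⟩
  rw [← hp, Polynomial.map_prod, hS, Finset.prod_image]
  · conv_lhs => rw [hprod]
    congr 1
    rw [Finset.prod_eq_multiset_prod, Multiset.toFinset_val, hnd.dedup]
    congr 1
    refine Multiset.map_congr rfl fun z hz => ?_
    simp [hre z hz]
  · intro a ha b hb hab
    simp only [Finset.mem_coe, Multiset.mem_toFinset] at ha hb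
    rw [← hre a ha, ← hre b hb, hab]

lemma factor_deg {m : ℕ} {B : Finset ℝ} {c : ℂ} (hc : c ≠ 0) : (C c * (hB m B).map Complex.ofRealHom).natDegree = 2 * B.card + m := by
  rw [natDegree_C_mul hc, natDegree_map, hB_natDegree]

lemma factor_mult {m : ℕ} {B : Finset ℝ} (hB0 : ∀ b ∈ B, 0 < b) {c : ℂ} (hc : c ≠ 0) :
    (C c * (hB m B).map Complex.ofRealHom).rootMultiplicity 0 = m := by
  rw [rootMultiplicity_eq_natTrailingDegree']
  refine le_antisymm ?_ ?_
  · refine natTrailingDegree_le_of_ne_zero ?_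
    rw [coeff_C_mul, coeff_map]
    exact mul_ne_zero hc (by simpa using hB_coeff m B hB0)
  · refine le_natTrailingDegree ?_ ?_
    · refine mul_ne_zero (C_ne_zero.2 hc) ?_
      rw [Ne, Polynomial.map_eq_zero]
      intro h; have := hB_coeff m B hB0; rw [h] at this; simp at this
    · intro k hk
      rw [coeff_C_mul, coeff_map]
      by_contra h
      have h1 : (hB m B).coeff k ≠ 0 := by intro h'; rw [h'] at h; simp at h
      obtain ⟨r, -, hr⟩ := ex_supp h1
      omega

lemma hB_monic (m : ℕ) (B : Finset ℝ) : (hB m B).Monic := by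
  rw [hB, ex]
  exact (monic_X_pow m).mul ((monic_prod_of_monic _ _ fun b _ => monic_X_sub_C b).expand (by norm_num))

end factor
end
end WS

open Polynomial Filter Topology
open scoped Matrix

namespace WS
noncomputable section

section bridge
variable {K : Type*} [Field K] [CharZero K] {d : ℕ}

lemma li_of_At {J : Fin d → ℕ} {f : Fin d → K[X]} (h : (At J f).det ≠ 0) : LinearIndependent K f := by
  rw [Fintype.linearIndependent_iff]
  intro g hg
  have h1 : Matrix.vecMul g (At J f) = 0 := by
    ext t
    have := congrArg (fun p => p.coeff (J t)) hg
    simpa [Matrix.vecMul, dotProduct, At, finsetSum_coeff] using this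
  exact fun i => congrFun (Matrix.eq_zero_of_vecMul_eq_zero h h1) i

lemma exists_J0 {f : Fin d → K[X]} (hf : LinearIndependent K f) : ∃ J, (At J f).det ≠ 0 := by
  obtain ⟨D, hD⟩ := exists_bound f
  let M : Matrix (Fin d) (Fin D) K := Matrix.of fun i k => (f i).coeff k
  have h1 : LinearIndependent K M.row := by
    rw [Fintype.linearIndependent_iff] at hf ⊢
    intro g hg
    refine hf g ?_
    ext k
    simp only [finsetSum_coeff, coeff_smul, coeff_zero]
    by_cases hk : k < D
    · have := congrFun hg ⟨k, hk⟩
      simpa [M, Matrix.row] using this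
    · refine Finset.sum_eq_zero fun i _ => ?_
      rw [coeff_eq_zero_of_natDegree_lt (lt_of_lt_of_le (hD i) (not_lt.1 hk)), smul_zero]
  have h2 := h1.rank_matrix
  rw [Matrix.rank_eq_finrank_span_cols, Fintype.card_fin] at h2
  have h3 := Submodule.exists_fun_fin_finrank_span_eq K (Set.range M.col)
  rw [h2] at h3
  obtain ⟨v, hv, -, hli⟩ := h3
  choose J hJ using hv
  refine ⟨fun t => J t, ?_⟩
  have h4 : (At (fun t => (J t : ℕ)) f).col = v := by
    funext t
    rw [← hJ t]
    rfl
  rw [← h4] at hli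
  exact isUnit_iff_ne_zero.1 ((Matrix.isUnit_iff_isUnit_det _).1 (Matrix.linearIndependent_cols_iff_isUnit.1 hli))

lemma act_mem (A : Matrix (Fin d) (Fin d) K) (f : Fin d → K[X]) (i : Fin d) : act A f i ∈ Submodule.span K (Set.range f) := by
  refine Submodule.sum_mem _ fun k _ => ?_
  rw [← smul_eq_C_mul]
  exact Submodule.smul_mem _ _ (Submodule.subset_span ⟨k, rfl⟩)

lemma span_act {A : Matrix (Fin d) (Fin d) K} (hA : A.det ≠ 0) (f : Fin d → K[X]) :
    Submodule.span K (Set.range (act A f)) = Submodule.span K (Set.range f) := by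
  apply le_antisymm
  · rw [Submodule.span_le]; rintro _ ⟨i, rfl⟩; exact act_mem A f i
  · rw [Submodule.span_le]; rintro _ ⟨i, rfl⟩
    have := act_mem A⁻¹ (act A f) i
    rwa [act_act, Matrix.nonsing_inv_mul _ (isUnit_iff_ne_zero.2 hA), act_one] at this

lemma span_nrm {J : Fin d → ℕ} {f : Fin d → K[X]} (h : (At J f).det ≠ 0) :
    Submodule.span K (Set.range (nrm J f)) = Submodule.span K (Set.range f) := span_act (det_inv_ne h) f

lemma basis_change {f g : Fin d → K[X]} (hf : LinearIndependent K f)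
    (h : Submodule.span K (Set.range f) = Submodule.span K (Set.range g)) : ∃ A : Matrix (Fin d) (Fin d) K, A.det ≠ 0 ∧ f = act A g := by
  have h1 : ∀ i, ∃ c : Fin d → K, ∑ k, c k • g k = f i := fun i =>
    (Submodule.mem_span_range_iff_exists_fun K).1 (h ▸ Submodule.subset_span ⟨i, rfl⟩)
  choose A hA using h1
  have h2 : f = act (Matrix.of A) g := by
    funext i; rw [← hA i]; simp [act, smul_eq_C_mul]
  obtain ⟨J, hJ⟩ := exists_J0 hf
  refine ⟨Matrix.of A, ?_, h2⟩
  rw [h2, At_act, Matrix.det_mul] at hJ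
  exact left_ne_zero_of_mul hJ

lemma nrm_unique {J : Fin d → ℕ} {f g : Fin d → K[X]} (hf : At J f = 1) (hg : At J g = 1)
    (h : Submodule.span K (Set.range f) = Submodule.span K (Set.range g)) : f = g := by
  obtain ⟨A, hA, h1⟩ := basis_change (li_of_At (J := J) (f := f) (by rw [hf]; simp)) h
  rw [← nrm_of_one hf, h1, nrm_act J A hA, nrm_of_one hg]

/-- normal form at the positions given by `lam` -/
lemma normal_form {w : ℕ} {g : Fin d → K[X]} (hg : LinearIndependent K g) (hn : ∀ i, (g i).natDegree < w + d)
    (lam : PartitionIn d w) (hl : d * w ≤ lam.size + 1) (hs : lam.size = (wr g).natDegree) :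
    (At (ell lam) g).det ≠ 0 ∧ ∀ t, (nrm (ell lam) g t).natDegree ≤ ell lam t := by
  obtain ⟨J0, h0⟩ := exists_J0 hg
  obtain ⟨J, hJ, hd⟩ := echelon h0
  have h1 := (sum_of_lead (At_nrm hJ) (At_inj hJ) hd).2
  rw [wr_nrm, natDegree_C_mul (det_inv_ne hJ), ← hs] at h1
  obtain ⟨σ, hσ⟩ := sort_ell (At_inj hJ) (At_lt hJ hn) lam hl h1
  have h2 : J ∘ σ = ell lam := funext hσ
  rw [← h2]
  exact ⟨At_perm J σ g hJ, fun t => by rw [nrm_perm]; exact hd _⟩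

/-- order of vanishing at `0` of the Wronskian -/
lemma wr_zero (f : Fin d → K[X]) : (wr f).eval 0 = (∏ j : Fin d, ((j : ℕ).factorial : K)) * (At (fun j : Fin d => (j : ℕ)) f).det := by
  have h1 : (wr f).eval 0 = (Matrix.of fun i j : Fin d => ((j : ℕ).factorial : K) * At (fun j : Fin d => (j : ℕ)) f i j).det := by
    rw [wr, ← coe_evalRingHom, RingHom.map_det]
    congr 1
    ext i j
    simp only [RingHom.mapMatrix_apply, Matrix.map_apply, Matrix.of_apply, coe_evalRingHom, At]
    rw [← coeff_zero_eq_eval_zero, coeff_iterate_derivative, zero_add, Nat.descFactorial_self, nsmul_eq_mul]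
  rw [h1]
  exact Matrix.det_mul_row _ _

lemma parity_of_comp {p : K[X]} (h : p.comp (-X) = p ∨ p.comp (-X) = -p) : ∃ r, ∀ k, p.coeff k ≠ 0 → k % 2 = r % 2 := by
  have h1 : ∀ k, (p.comp (-X)).coeff k = p.coeff k * (-1) ^ k := by
    intro k
    rw [show (-X : K[X]) = C (-1) * X by simp, comp_C_mul_X_coeff]
  rcases h with h | h
  · refine ⟨0, fun k hk => ?_⟩
    rcases Nat.even_or_odd k with hk' | hk'
    · exact Nat.even_iff.1 hk'
    · have := h1 k
      rw [h, hk'.neg_one_pow] at this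
      exact absurd (self_eq_neg.1 (by linear_combination this)) hk
  · refine ⟨1, fun k hk => ?_⟩
    rcases Nat.even_or_odd k with hk' | hk'
    · have := h1 k
      rw [h, hk'.neg_one_pow, coeff_neg] at this
      exact absurd (self_eq_neg.1 (by linear_combination -this)) hk
    · exact Nat.odd_iff.1 hk'

lemma comp_of_parity {p : K[X]} {r : ℕ} (h : ∀ k, p.coeff k ≠ 0 → k % 2 = r % 2) : p.comp (-X) = p ∨ p.comp (-X) = -p := by
  have h1 : ∀ k, (p.comp (-X)).coeff k = p.coeff k * (-1) ^ k := by
    intro k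
    rw [show (-X : K[X]) = C (-1) * X by simp, comp_C_mul_X_coeff]
  rcases Nat.even_or_odd r with hr | hr
  · left
    ext k
    rw [h1]
    by_cases hk : p.coeff k = 0
    · simp [hk]
    · rw [(Nat.even_iff.2 ((h k hk).trans (Nat.even_iff.1 hr))).neg_one_pow, mul_one]
  · right
    ext k
    rw [h1, coeff_neg]
    by_cases hk : p.coeff k = 0
    · simp [hk]
    · rw [(Nat.odd_iff.2 ((h k hk).trans (Nat.odd_iff.1 hr))).neg_one_pow]; ring

end bridge
end
end WS

open Polynomial Filter Topology
open scoped Matrix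

namespace WS
noncomputable section

section rich
variable {d : ℕ}

lemma wronsk_eq (f : Fin d → ℂ[X]) : wronskDet d f = wr f := rfl

/-- the subspace has large intersection with `X ^ q` multiples -/
lemma flag_dim {x : Submodule ℂ ℂ[X]} {n i q : ℕ} (hx : x ≤ degreeLT ℂ n) (hfin : Module.finrank ℂ x = d) (hd : 0 < d) (hq : n - i = q) :
    d ≤ Module.finrank ℂ ↥(x ⊓ Fflag n i) + q := by
  haveI : FiniteDimensional ℂ x := FiniteDimensional.of_finrank_pos (by omega)
  let φ : x →ₗ[ℂ] (Fin q → ℂ) := LinearMap.pi fun k => (lcoeff ℂ (k : ℕ)).comp x.subtype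
  have h1 := φ.finrank_range_add_finrank_ker
  have h2 : Module.finrank ℂ (LinearMap.range φ) ≤ q := by
    simpa using Submodule.finrank_le (LinearMap.range φ)
  have h3 : Module.finrank ℂ (LinearMap.ker φ) ≤ Module.finrank ℂ ↥(x ⊓ Fflag n i) := by
    rw [← Submodule.finrank_map_subtype_eq x (LinearMap.ker φ)]
    haveI : FiniteDimensional ℂ ↥(x ⊓ Fflag n i) := Submodule.finiteDimensional_inf_left _ _
    refine Submodule.finrank_mono ?_
    rintro _ ⟨y, hy, rfl⟩
    refine ⟨y.2, hx y.2, ?_⟩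
    simp only [Submodule.coe_restrictScalars, SetLike.mem_coe, Ideal.mem_span_singleton, hq]
    refine X_pow_dvd_iff.2 fun k hk => ?_
    exact congrFun (LinearMap.mem_ker.1 hy) ⟨k, hk⟩
  omega

lemma flag_dim_one {x : Submodule ℂ ℂ[X]} {n i : ℕ} (hx : x ≤ degreeLT ℂ n) {g : Fin d → ℂ[X]} (hg : LinearIndependent ℂ g)
    (hgx : Submodule.span ℂ (Set.range g) = x) (hi : n - i = d) (hw : (wr g).eval 0 = 0) :
    1 ≤ Module.finrank ℂ ↥(x ⊓ Fflag n i) := by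
  rw [wr_zero, mul_eq_zero] at hw
  have h1 : (At (fun j : Fin d => (j : ℕ)) g).det = 0 := by
    rcases hw with h | h
    · exact absurd h (Finset.prod_ne_zero_iff.2 fun j _ => by exact_mod_cast Nat.factorial_ne_zero j)
    · exact h
  obtain ⟨v, hv, hv0⟩ := Matrix.exists_vecMul_eq_zero_iff.2 h1
  haveI : FiniteDimensional ℂ x := by
    rw [← hgx]; exact FiniteDimensional.span_of_finite ℂ (Set.finite_range g)
  haveI : FiniteDimensional ℂ ↥(x ⊓ Fflag n i) := Submodule.finiteDimensional_inf_left _ _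
  have hy : ∑ k, v k • g k ∈ x := by
    rw [← hgx]
    exact Submodule.sum_mem _ fun k _ => Submodule.smul_mem _ _ (Submodule.subset_span ⟨k, rfl⟩)
  have hy' : ∑ k, v k • g k ∈ x ⊓ Fflag n i := by
    refine ⟨hy, hx hy, ?_⟩
    simp only [Submodule.coe_restrictScalars, SetLike.mem_coe, Ideal.mem_span_singleton, hi]
    refine X_pow_dvd_iff.2 fun k hk => ?_
    have := congrFun hv0 ⟨k, hk⟩
    simpa [Matrix.vecMul, dotProduct, At, finsetSum_coeff] using this
  have hne : (⟨_, hy'⟩ : ↥(x ⊓ Fflag n i)) ≠ 0 := by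
    intro h0
    have h2 : ∑ k, v k • g k = 0 := congrArg Subtype.val h0
    exact hv (funext (Fintype.linearIndependent_iff.1 hg v h2))
  haveI : Nontrivial ↥(x ⊓ Fflag n i) := ⟨⟨_, _, hne⟩⟩
  exact Module.finrank_pos

lemma tilde_dim {x : Submodule ℂ ℂ[X]} {i M : ℕ} (hi : i < d) {F : Fin d → ℂ[X]} (hF : LinearIndependent ℂ F)
    (hFx : Submodule.span ℂ (Set.range F) = x) (hdeg : ∀ t : Fin d, d - 1 - i ≤ t → (F t).natDegree < M) :
    i + 1 ≤ Module.finrank ℂ ↥(x ⊓ Ftilde M) := by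
  let G : Fin (i + 1) → ℂ[X] := fun s => F ⟨d - 1 - i + s, by omega⟩
  have hG : LinearIndependent ℂ G := hF.comp (fun s : Fin (i + 1) => (⟨d - 1 - i + s, by omega⟩ : Fin d)) (by
    intro a b hab
    have := congrArg Fin.val hab
    simp only at this
    exact Fin.ext (by omega))
  haveI : FiniteDimensional ℂ x := by
    rw [← hFx]; exact FiniteDimensional.span_of_finite ℂ (Set.finite_range F)
  haveI : FiniteDimensional ℂ ↥(x ⊓ Ftilde M) := Submodule.finiteDimensional_inf_left _ _
  have h1 := finrank_span_eq_card hG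
  rw [Fintype.card_fin] at h1
  rw [← h1]
  refine Submodule.finrank_mono ?_
  rw [Submodule.span_le]
  rintro _ ⟨s, rfl⟩
  refine ⟨hFx ▸ Submodule.subset_span ⟨_, rfl⟩, ?_⟩
  have h2 := hdeg ⟨d - 1 - i + s, by omega⟩ (by simp)
  rw [Ftilde, SetLike.mem_coe, mem_degreeLT]
  exact lt_of_le_of_lt degree_le_natDegree (by exact_mod_cast h2)

lemma richardson {n : ℕ} (hd : 0 < d) (hdn : d < n) {h : ℂ[X]} (hne : h ≠ 0) (hdeg : d * (n - d) ≤ h.natDegree + 1)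
    (hm : h.rootMultiplicity 0 ≤ 1) {lam mu : PartitionIn d (n - d)} (hc : Compatible n d lam mu h) {x : Submodule ℂ ℂ[X]}
    (hx : IsGrPoint n d x) (hf : InFibre d x h) : InRichardson n d lam mu x := by
  obtain ⟨g, c, hc0, hg, hgx, hw⟩ := hf
  rw [wronsk_eq, smul_eq_C_mul] at hw
  have hgn : ∀ i, (g i).natDegree < n - d + d := by
    intro i
    have : g i ∈ degreeLT ℂ n := hx.1 (hgx ▸ Submodule.subset_span ⟨i, rfl⟩)
    rw [mem_degreeLT] at this
    rw [Nat.sub_add_cancel hdn.le]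
    exact (natDegree_lt_iff_degree_lt (hg.ne_zero i)).2 this
  obtain ⟨h1, h2⟩ := normal_form hg hgn lam (by rw [hc.2.1]; exact hdeg) (by rw [hw, natDegree_C_mul hc0, hc.2.1])
  intro i hi
  constructor
  · have hmi := mu.le_w i
    by_cases hmu : mu.part i = 0
    · have := flag_dim (i := n - d - mu.part i + (i + 1)) hx.1 hx.2 hd rfl
      omega
    · have h3 : i = 0 ∧ mu.part 0 = 1 ∧ h.rootMultiplicity 0 ≠ 0 := by
        have h4 : mu.size ≤ 1 := hc.2.2 ▸ hm
        have h5 := part_unique_small (b := small mu.size hd (by omega)) h4 (small_size _ _ _).symm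
        have h6 : mu.part i = if i = 0 then mu.size else 0 := by
          conv_lhs => rw [h5]
          rfl
        have h7 : mu.part 0 = mu.size := by
          conv_lhs => rw [h5]
          rfl
        rw [← hc.2.2]
        split_ifs at h6 <;> omega
      obtain ⟨rfl, h4, h5⟩ := h3
      rw [zero_add]
      refine flag_dim_one hx.1 hg hgx (by omega) ?_
      have h6 : h.IsRoot 0 := (rootMultiplicity_pos hne).1 (by omega)
      rw [hw, eval_mul, h6.eq_zero, mul_zero]
  · refine tilde_dim hi (F := nrm (ell lam) g) (li_of_At (J := ell lam) (by rw [At_nrm h1]; simp)) ((span_nrm h1).trans hgx) ?_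
    intro t ht
    refine lt_of_le_of_lt (h2 t) ?_
    have := lam.antitone ht
    have := t.2
    simp only [ell]
    omega

end rich
end
end WS

open Polynomial Filter Topology
open scoped Matrix

namespace WS
noncomputable section

section fin
variable {e n : ℕ}

lemma wr_cmap {d : ℕ} (f : Fin d → ℝ[X]) : wr (fun i => (f i).map Complex.ofRealHom) = (wr f).map Complex.ofRealHom := by
  rw [wr, wr, ← coe_mapRingHom, RingHom.map_det]
  congr 1
  ext1 i j
  simp only [RingHom.mapMatrix_apply, Matrix.map_apply, Matrix.of_apply, coe_mapRingHom]
  rw [iterate_derivative_map]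

lemma At_cmap {d : ℕ} (J : Fin d → ℕ) {f : Fin d → ℝ[X]} (h : At J f = 1) : At J (fun i => (f i).map Complex.ofRealHom) = 1 := by
  ext i t
  have := coeff_of_At_one h i t
  simp only [At, Matrix.of_apply, coeff_map, this, Matrix.one_apply]
  split_ifs <;> simp

lemma count_points (hdn : e + 1 < n) {m : ℕ} (hm : m ≤ 1) {B : Finset ℝ} (hB0 : ∀ b ∈ B, 0 < b) {c : ℂ} (hc0 : c ≠ 0)
    {h : ℂ[X]} (hh : h = C c * (hB m B).map Complex.ofRealHom) (hdeg : (e + 1) * (n - (e + 1)) ≤ h.natDegree + 1)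
    {lam mu : PartitionIn (e + 1) (n - (e + 1))} (hc : Compatible n (e + 1) lam mu h) :
    (Sol (ell lam) (hB m B)).ncard = Set.ncard {x : Submodule ℂ ℂ[X] |
          IsGrPoint n (e + 1) x ∧ InRichardson n (e + 1) lam mu x ∧ InFibre (e + 1) x h ∧ IsEvenOddPoint (e + 1) x} := by
  have hne : h ≠ 0 := by
    rw [hh]
    exact mul_ne_zero (C_ne_zero.2 hc0) (by
      rw [Polynomial.map_ne_zero_iff Complex.ofRealHom.injective]; exact (hB_monic m B).ne_zero)
  have hmult : h.rootMultiplicity 0 ≤ 1 := by rw [hh, factor_mult hB0 hc0]; exact hm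
  have hlt : ∀ i, ell lam i < n := by
    intro i
    have := lam.le_w i
    have := i.2
    simp only [ell]; omega
  refine Set.ncard_congr (fun f _ => Submodule.span ℂ (Set.range fun i => (f i).map Complex.ofRealHom)) ?_ ?_ ?_
  · rintro f ⟨hR, γ, hγ⟩
    have hA := At_cmap _ hR.1
    have hli : LinearIndependent ℂ (fun i => (f i).map Complex.ofRealHom) := li_of_At (J := ell lam) (by rw [hA]; simp)
    have hg : IsGrPoint n (e + 1) (Submodule.span ℂ (Set.range fun i => (f i).map Complex.ofRealHom)) := by
      refine ⟨?_, by rw [finrank_span_eq_card hli, Fintype.card_fin]⟩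
      rw [Submodule.span_le]
      rintro _ ⟨i, rfl⟩
      rw [SetLike.mem_coe, mem_degreeLT]
      refine lt_of_le_of_lt degree_le_natDegree ?_
      rw [natDegree_map]
      exact_mod_cast lt_of_le_of_lt (hR.natDegree_le i) (hlt i)
    have hγ0 : γ ≠ 0 := by
      rintro rfl
      refine wr_ne (J := ell lam) (f := f) (by rw [hR.1]; simp) ?_
      rw [hγ]; simp
    have hfib : InFibre (e + 1) (Submodule.span ℂ (Set.range fun i => (f i).map Complex.ofRealHom)) h := by
      refine ⟨_, γ * c⁻¹, mul_ne_zero (by exact_mod_cast hγ0) (inv_ne_zero hc0), hli, rfl, ?_⟩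
      rw [wronsk_eq, wr_cmap, hγ, hh, smul_eq_C_mul, ← mul_assoc, ← C_mul, inv_mul_cancel_right₀ hc0]
      simp
    refine ⟨hg, richardson (by omega) hdn hne hdeg hmult hc hg hfib, hfib, _, hli, rfl, fun i => ?_⟩
    refine comp_of_parity (r := ell lam i) fun k hk => ?_
    rw [coeff_map] at hk
    exact (hR.2 i k (fun h0 => hk (by rw [h0]; simp))).2
  · intro f g hf hg hfg
    have := nrm_unique (At_cmap _ hf.1.1) (At_cmap _ hg.1.1) hfg
    funext i
    exact map_injective _ Complex.ofRealHom.injective (congrFun this i)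
  · rintro x ⟨hx, -, ⟨g0, c', hc', hg0, hgx0, hw0⟩, g, hg, hgx, hpar⟩
    rw [wronsk_eq, smul_eq_C_mul] at hw0
    obtain ⟨A, hA, hA'⟩ := basis_change hg (hgx.trans hgx0.symm)
    have hw : wr g = C (A.det * c') * h := by rw [hA', wr_act, hw0, C_mul, mul_assoc]
    have hgn : ∀ i, (g i).natDegree < n - (e + 1) + (e + 1) := by
      intro i
      have : g i ∈ degreeLT ℂ n := hx.1 (hgx ▸ Submodule.subset_span ⟨i, rfl⟩)
      rw [mem_degreeLT] at this
      rw [Nat.sub_add_cancel hdn.le]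
      exact (natDegree_lt_iff_degree_lt (hg.ne_zero i)).2 this
    obtain ⟨h1, h2⟩ := normal_form hg hgn lam (by rw [hc.2.1]; exact hdeg)
      (by rw [hw, natDegree_C_mul (mul_ne_zero hA hc'), hc.2.1])
    set F := nrm (ell lam) g with hF
    choose r hr using fun i => parity_of_comp (hpar i)
    have hFp : ∀ t k, (F t).coeff k ≠ 0 → k % 2 = ell lam t % 2 := fun t k hk => nrm_parity h1 hr t k hk
    have hF1 := At_nrm h1
    rw [← hF] at hF1
    obtain ⟨δ, hδ, hwF⟩ : ∃ δ : ℂ, δ ≠ 0 ∧ wr F = C δ * (hB m B).map Complex.ofRealHom := by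
      refine ⟨((At (ell lam) g)⁻¹).det * (A.det * c' * c), mul_ne_zero (det_inv_ne h1) (mul_ne_zero (mul_ne_zero hA hc') hc0), ?_⟩
      rw [hF, wr_nrm, hw, hh]
      simp only [C_mul]; ring
    obtain ⟨a, ha, cc, hcc, hprod⟩ := (RD_hB hm B hB0).fin
    have hreal := reality F (ell lam) (ell_inj lam) (N := (hB m B).natDegree)
      (by rw [ell_sum, hc.2.1, hh, factor_deg hc0, hB_natDegree]) h2 (coeff_of_At_one hF1) (δ * cc)
      (mul_ne_zero hδ (by exact_mod_cast hcc)) a ha (by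
        rw [hwF, C_mul, mul_assoc]
        congr 1
        conv_lhs => rw [hprod]
        simp [Polynomial.map_prod])
    have hlift : ∀ t, ∃ p : ℝ[X], p.map Complex.ofRealHom = F t := by
      intro t
      rw [← mem_lifts, lifts_iff_coeff_lifts]
      intro k
      exact ⟨((F t).coeff k).re, Complex.conj_eq_iff_re.1 (hreal t k)⟩
    choose f hf using hlift
    have hf' : (fun i => (f i).map Complex.ofRealHom) = F := funext hf
    have hcoef : ∀ i k, (((f i).coeff k : ℝ) : ℂ) = (F i).coeff k := by
      intro i k; rw [← hf i, coeff_map]; rfl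
    refine ⟨f, ⟨⟨?_, ?_⟩, δ.re, ?_⟩, ?_⟩
    · ext i t
      have h3 := coeff_of_At_one hF1 i t
      rw [← hcoef] at h3
      simp only [At, Matrix.of_apply, Matrix.one_apply]
      split_ifs at h3 ⊢
      · exact_mod_cast h3
      · exact_mod_cast h3
    · intro i k hk
      have hk' : (F i).coeff k ≠ 0 := by rw [← hcoef]; exact_mod_cast hk
      exact ⟨(le_natDegree_of_ne_zero hk').trans (h2 i), hFp i k hk'⟩
    · have h3 : (wr f).map Complex.ofRealHom = C δ * (hB m B).map Complex.ofRealHom := by rw [← wr_cmap, hf', hwF]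
      have h4 : δ = ((wr f).coeff (hB m B).natDegree : ℝ) := by
        have := congrArg (fun p => p.coeff (hB m B).natDegree) h3
        simp only [coeff_C_mul, coeff_map] at this
        rw [(hB_monic m B).coeff_natDegree] at this
        simpa using this.symm
      apply map_injective _ Complex.ofRealHom.injective
      rw [h3, Polynomial.map_mul, map_C, h4]
      simp
    · show Submodule.span ℂ (Set.range fun i => (f i).map Complex.ofRealHom) = x
      rw [hf', hF, span_nrm h1, hgx]

end fin
end
end WS

/-- Let `h` be a polynomial of degree `N` or `N - 1`, either
even or odd, with distinct real roots.  Then there is a unique `h`-compatible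
Richardson variety `X_{λ/μ}`, and the number of even-odd points in
`X_{λ/μ}(h) = X_{λ/μ} ∩ Wr⁻¹(h)` equals the number of standard `2`-ribbon
(domino) tableaux of shape `λ/μ`. -/
theorem statement19 (d n : ℕ) (hd : 0 < d) (hdn : d < n)
    (h : Polynomial ℂ) (hne : h ≠ 0)
    (hdeg : h.natDegree = d * (n - d) ∨ h.natDegree = d * (n - d) - 1)
    (heo : h.comp (-Polynomial.X) = h ∨ h.comp (-Polynomial.X) = -h)
    (hsq : Squarefree h) (hroots : ∀ z ∈ h.roots, z.im = 0) :
    (∃! p : PartitionIn d (n - d) × PartitionIn d (n - d),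
      Compatible n d p.1 p.2 h) ∧
    ∀ lam mu : PartitionIn d (n - d), Compatible n d lam mu h →
      Set.ncard {x : Submodule ℂ (Polynomial ℂ) |
          IsGrPoint n d x ∧ InRichardson n d lam mu x ∧ InFibre d x h ∧
          IsEvenOddPoint d x} =
        Set.ncard {E : ℕ → ℕ → ℕ |
          IsSRT 2 ((lam.size - mu.size) / 2) lam mu E} := by
  obtain ⟨m, hm, B, hB0, c, hc0, hh⟩ := WS.factor h hne heo hsq hroots
  have hD : h.natDegree = 2 * B.card + m := by rw [hh, WS.factor_deg hc0]
  have hM : h.rootMultiplicity 0 = m := by rw [hh, WS.factor_mult hB0 hc0]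
  have hw : 0 < n - d := by omega
  have hN : 0 < d * (n - d) := Nat.mul_pos hd hw
  have hdeg' : d * (n - d) ≤ h.natDegree + 1 := by omega
  refine ⟨?_, ?_⟩
  · have h1 : d * (n - d) - h.natDegree ≤ n - d := by omega
    have h2 := WS.compl_size (WS.small (d := d) (d * (n - d) - h.natDegree) hd h1)
    rw [WS.small_size] at h2
    have h3 := WS.small_size (d := d) m hd (show m ≤ n - d by omega)
    refine ⟨(WS.compl (WS.small (d := d) (d * (n - d) - h.natDegree) hd h1), WS.small (d := d) m hd (by omega)), ⟨?_, ?_, ?_⟩, ?_⟩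
    · exact fun k => WS.mu_le (by simp only; omega) (by simp only; omega) k
    · simp only; omega
    · simp only; omega
    · rintro ⟨lam, mu⟩ ⟨-, h4, h5⟩
      simp only at h4 h5
      rw [Prod.mk.injEq]
      exact ⟨WS.part_unique_big (by omega) (by omega), WS.part_unique_small (by omega) (by omega)⟩
  · intro lam mu hc
    obtain ⟨e, rfl⟩ : ∃ e, d = e + 1 := ⟨d - 1, by omega⟩
    rw [← WS.count_points hdn hm hB0 hc0 hh hdeg' hc]
    have h1 : mu.size = m := hc.2.2.trans hM
    have h2 : lam.size = 2 * B.card + m := hc.2.1.trans hD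
    have h3 := (WS.Sol_eq_SRT mu (by omega) B hB0 lam (by omega)).2
    rw [h1] at h3
    rw [h3, show (lam.size - mu.size) / 2 = B.card by omega]
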